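/- arXiv:2403.19503 — 5 statements merged into one kernel-verified Lean document; each statement's English description precedes it below -/
import Mathlib

section
/- Let $p \ge 5$ be a prime and $n$ a positive integer. Then $D_{np} \equiv D_n + p^3 B_{p-3} \mathcal{D}_n \pmod{p^4}$ (as a congruence of rational numbers, i.e. the $p$-adic valuation of the difference is at least $4$), where $\mathcal{D}_n = 8\sum_{k=0}^{n-1}\binom{n}{k}^2\binom{2k}{k}\binom{2n-2k-2}{n-k-1} n(n-k)^2 - \frac{1}{3}\sum_{k=0}^{n}\binom{n}{k}^2\binom{2k}{k}\binom{2n-2k}{n-k}\bigl(2nk(n-k)+2k^3+2(n-k)^3\bigr)$. -/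
open Finset

/-- The Domb numbers, as rational numbers. -/
def domb (n : ℕ) : ℚ :=
  ∑ k ∈ range (n + 1),
    (n.choose k : ℚ) ^ 2 * ((2 * k).choose k) * ((2 * n - 2 * k).choose (n - k))

/-- The coefficient `𝒟ₙ` from the theorem. -/
def dombD (n : ℕ) : ℚ :=
  8 * ∑ k ∈ range n,
      (n.choose k : ℚ) ^ 2 * ((2 * k).choose k) * ((2 * n - 2 * k - 2).choose (n - k - 1)) *
        n * ((n - k : ℕ) : ℚ) ^ 2
  - (1 / 3) * ∑ k ∈ range (n + 1),
      (n.choose k : ℚ) ^ 2 * ((2 * k).choose k) * ((2 * n - 2 * k).choose (n - k)) *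
        (2 * n * k * ((n - k : ℕ) : ℚ) + 2 * (k : ℚ) ^ 3 + 2 * ((n - k : ℕ) : ℚ) ^ 3)

section ModPrime

variable {p : ℕ} [hpf : Fact p.Prime]

lemma natCast_zmod_ne_zero {i : ℕ} (hi : 0 < i) (hip : i < p) : (i : ZMod p) ≠ 0 := by
  rw [Ne, ZMod.natCast_eq_zero_iff]
  exact Nat.not_dvd_of_pos_of_lt hi hip

lemma choose_add_lucas (a b : ℕ) {i j : ℕ} (hi : i < p) (hj : j < p) :
    (((a * p + i).choose (b * p + j) : ℕ) : ZMod p) = i.choose j * a.choose b := by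
  have h := (ZMod.natCast_eq_natCast_iff _ _ _).2
    (Choose.choose_modEq_choose_mod_mul_choose_div_nat (p := p) (n := a * p + i) (k := b * p + j))
  have hp := hpf.out.pos
  have e : ∀ c l : ℕ, l < p → (c * p + l) / p = c := fun c l hl => by
    rw [mul_comm, Nat.mul_add_div hp, Nat.div_eq_of_lt hl, add_zero]
  have e' : ∀ c l : ℕ, l < p → (c * p + l) % p = l := fun c l hl => by
    rw [Nat.mul_add_mod', Nat.mod_eq_of_lt hl]
  rw [h, e _ _ hi, e _ _ hj, e' _ _ hi, e' _ _ hj, Nat.cast_mul]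

lemma choose_prime_sub_one {i : ℕ} (hi : i < p) : (((p - 1).choose i : ℕ) : ZMod p) = (-1) ^ i := by
  induction i with
  | zero => simp
  | succ i ih =>
    have hp := hpf.out.pos
    have h := Nat.choose_succ_succ (p - 1) i
    rw [Nat.succ_eq_add_one, Nat.sub_add_cancel hp] at h
    have h0 : ((p.choose (i + 1) : ℕ) : ZMod p) = 0 :=
      (ZMod.natCast_eq_zero_iff _ _).2 (hpf.out.dvd_choose_self (by omega) hi)
    rw [h, Nat.cast_add, ih (by omega)] at h0
    rw [Nat.succ_eq_add_one] at h0
    rw [pow_succ]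
    linear_combination h0

/-- A binomial coefficient `n * p` over a non-multiple of `p` is divisible by `p`, and the quotient
is known modulo `p`. -/
lemma exists_choose_mul_prime_eq (n k : ℕ) {i : ℕ} (hi : i + 1 < p) :
    ∃ a : ℕ, ((n + 1) * p).choose (k * p + (i + 1)) = p * a ∧
      (a : ZMod p) * (i + 1) = (n + 1) * n.choose k * (-1) ^ i := by
  have hp := hpf.out.pos
  have key := Nat.add_one_mul_choose_eq (n * p + (p - 1)) (k * p + i)
  have e : n * p + (p - 1) + 1 = (n + 1) * p := by rw [add_mul]; omega
  rw [e] at key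
  have hnd : ¬ p ∣ k * p + i + 1 := by
    rw [add_assoc, Nat.dvd_add_right (Dvd.intro_left k rfl)]
    exact Nat.not_dvd_of_pos_of_lt (by omega) hi
  have hd : p ∣ ((n + 1) * p).choose (k * p + i + 1) * (k * p + i + 1) := by
    rw [← key]; exact Dvd.dvd.mul_right (Dvd.intro_left _ rfl) _
  obtain ⟨a, ha⟩ := (hpf.out.dvd_mul.1 hd).resolve_right hnd
  refine ⟨a, ha, ?_⟩
  rw [ha] at key
  have key2 : (n + 1) * (n * p + (p - 1)).choose (k * p + i) = a * (k * p + i + 1) := by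
    apply Nat.eq_of_mul_eq_mul_left hp
    linarith
  have key3 := congrArg (Nat.cast : ℕ → ZMod p) key2
  rw [Nat.cast_mul, choose_add_lucas n k (by omega) (by omega),
    choose_prime_sub_one (by omega)] at key3
  push_cast at key3
  simp only [CharP.cast_eq_zero, mul_zero, zero_add] at key3
  linear_combination -key3

lemma not_dvd_choose_of_lt {n k : ℕ} (hk : k ≤ n) (hn : n < p) : ¬ p ∣ n.choose k := by
  intro h
  have h1 : p ∣ n.factorial := by
    rw [← Nat.choose_mul_factorial_mul_factorial hk, mul_assoc]
    exact h.mul_right _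
  exact absurd (hpf.out.dvd_factorial.1 h1) (by omega)

lemma choose_prime_sub {i : ℕ} (hi : 2 * (i + 1) < p) :
    (((p - (i + 1)).choose (i + 1) : ℕ) : ZMod p) * 2 =
      -(-1) ^ i * (2 * (i + 1)).choose (i + 1) := by
  have key := Nat.choose_mul (n := p - 1) (k := 2 * i + 1) (s := i) (by omega)
  rw [show p - 1 - i = p - (i + 1) by omega, show 2 * i + 1 - i = i + 1 by omega] at key
  have key2 := congrArg (Nat.cast : ℕ → ZMod p) key
  rw [Nat.cast_mul, Nat.cast_mul, choose_prime_sub_one (by omega),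
    choose_prime_sub_one (by omega), pow_succ, pow_mul] at key2
  have h2 : (2 * (i + 1)).choose (i + 1) = 2 * (2 * i + 1).choose i := by
    rw [show 2 * (i + 1) = 2 * i + 1 + 1 by ring, Nat.choose_succ_succ, Nat.succ_eq_add_one,
      Nat.choose_symm_half]
    ring
  rw [h2]
  push_cast
  have h3 : ((-1 : ZMod p) ^ i) * (-1) ^ i = 1 := by rw [← mul_pow]; simp
  simp only [even_two, Even.neg_pow, one_pow, one_mul] at key2
  linear_combination (-2 * (-1) ^ i) * key2 - 2 * ((p - (i + 1)).choose (i + 1) : ZMod p) * h3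

lemma exists_centralBinom_mul (k m : ℕ) {i : ℕ} (hi : 2 * (i + 1) < p) :
    ∃ w : ℕ, (2 * (k * p + (i + 1))).choose (k * p + (i + 1)) *
        (2 * (m * p + (p - (i + 1)))).choose (m * p + (p - (i + 1))) = p * w ∧
      (w : ZMod p) * (i + 1) = -2 * (2 * k).choose k * ((2 * m + 1) * (2 * m).choose m) := by
  obtain ⟨a, ha, ha'⟩ := exists_choose_mul_prime_eq (p := p) (2 * m) m (i := i) (by omega)
  obtain ⟨t, ht⟩ : ∃ t, p = 2 * (i + 1) + t := ⟨_, (Nat.add_sub_of_le hi.le).symm⟩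
  have key := Nat.choose_mul (n := 2 * (m * p + (p - (i + 1)))) (k := m * p + (p - (i + 1)))
    (s := t) (by omega)
  have e1 : 2 * (m * p + (p - (i + 1))) = (2 * m + 1) * p + t := by
    rw [add_mul, mul_assoc]; omega
  have e2 : m * p + (p - (i + 1)) - t = m * p + (i + 1) := by omega
  rw [e2, e1, Nat.add_sub_cancel, ha] at key
  have hM : ((m * p + (p - (i + 1))).choose t : ZMod p) = (p - (i + 1)).choose (i + 1) := by
    have := choose_add_lucas (p := p) m 0 (i := p - (i + 1)) (j := t) (by omega) (by omega)
    rw [zero_mul, zero_add] at this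
    rw [this, Nat.choose_symm_of_eq_add (b := i + 1) (by omega)]
    simp
  have hN : (((2 * m + 1) * p + t).choose t : ZMod p) = 1 := by
    have := choose_add_lucas (p := p) (2 * m + 1) 0 (i := t) (j := t) (by omega) (by omega)
    rw [zero_mul, zero_add] at this
    rw [this]; simp
  have hne : ((p - (i + 1)).choose (i + 1) : ZMod p) ≠ 0 := by
    rw [Ne, ZMod.natCast_eq_zero_iff]
    exact not_dvd_choose_of_lt (by omega) (by omega)
  have hnd : ¬ p ∣ (m * p + (p - (i + 1))).choose t := by
    rwa [← ZMod.natCast_eq_zero_iff, hM]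
  have hd : p ∣ ((2 * m + 1) * p + t).choose (m * p + (p - (i + 1))) := by
    refine (hpf.out.dvd_mul.1 ?_).resolve_right hnd
    rw [key]
    exact (Dvd.intro _ rfl).mul_left _
  obtain ⟨b, hb⟩ := hd
  have key2 : b * (m * p + (p - (i + 1))).choose t = ((2 * m + 1) * p + t).choose t * a := by
    apply Nat.eq_of_mul_eq_mul_left hpf.out.pos
    rw [hb] at key
    linarith
  have key3 := congrArg (Nat.cast : ℕ → ZMod p) key2
  rw [Nat.cast_mul, Nat.cast_mul, hM, hN, one_mul] at key3
  have hk : ((2 * (k * p + (i + 1))).choose (k * p + (i + 1)) : ZMod p) =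
      (2 * (i + 1)).choose (i + 1) * (2 * k).choose k := by
    rw [show 2 * (k * p + (i + 1)) = (2 * k) * p + 2 * (i + 1) by ring]
    exact choose_add_lucas (2 * k) k hi (by omega)
  refine ⟨(2 * (k * p + (i + 1))).choose (k * p + (i + 1)) * b, ?_, ?_⟩
  · rw [e1, hb]; ring
  · rw [Nat.cast_mul, hk]
    have hc := choose_prime_sub (p := p) hi
    have h3 : ((-1 : ZMod p) ^ i) * (-1) ^ i = 1 := by rw [← mul_pow]; simp
    have hc' : ((2 * (i + 1)).choose (i + 1) : ZMod p) =
        -2 * (-1) ^ i * (p - (i + 1)).choose (i + 1) := by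
      linear_combination ((-1) ^ i) * hc - ((2 * (i + 1)).choose (i + 1) : ZMod p) * h3
    push_cast at ha'
    rw [hc']
    linear_combination (-2 * (-1) ^ i * ((2 * k).choose k : ZMod p)) * ((i + 1) * key3 + ha')
      - 2 * ((2 * k).choose k : ZMod p) * (2 * m + 1) * ((2 * m).choose m : ZMod p) * h3

end ModPrime

section HalfSums

lemma sum_range_two_mul_succ {M : Type*} [AddCommMonoid M] (f : ℕ → M) (h : ℕ) :
    ∑ i ∈ range (2 * h), f (i + 1) =
      ∑ i ∈ range h, (f (2 * (i + 1)) + f (2 * h + 1 - 2 * (i + 1))) := by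
  have e : ∑ i ∈ range h, f (2 * h + 1 - 2 * (i + 1)) = ∑ i ∈ range h, f (2 * i + 1) := by
    rw [← sum_range_reflect (fun i => f (2 * i + 1))]
    refine sum_congr rfl fun i hi => ?_
    have := mem_range.1 hi
    congr 1; omega
  rw [sum_add_distrib, e, ← sum_add_distrib]
  clear e
  induction h with
  | zero => simp
  | succ h ih =>
    rw [show 2 * (h + 1) = 2 * h + 1 + 1 by ring, sum_range_succ, sum_range_succ, ih,
      sum_range_succ, add_assoc, add_comm (f (2 * h + 1))]
    rfl

lemma sum_range_two_mul_succ' {M : Type*} [AddCommMonoid M] (f : ℕ → M) (h : ℕ) :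
    ∑ i ∈ range (2 * h), f (i + 1) =
      ∑ i ∈ range h, (f (i + 1) + f (2 * h + 1 - (i + 1))) := by
  rw [two_mul, sum_range_add, sum_add_distrib]
  congr 1
  rw [← sum_range_reflect]
  refine sum_congr rfl fun i hi => ?_
  have := mem_range.1 hi
  congr 1; omega

end HalfSums

lemma even_pow_sub_modEq (p : ℕ) {m : ℕ} (hm : Even m) (x : ℤ) :
    ((p : ℤ) - x) ^ m ≡ x ^ m - m * x ^ (m - 1) * p [ZMOD p ^ 2] := by
  rcases Nat.eq_zero_or_pos m with rfl | h0
  · simp [Int.ModEq.refl]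
  obtain ⟨k, hk⟩ := Polynomial.powAddExpansion (-x) (p : ℤ) m
  have ho : Odd (m - 1) := Nat.Even.sub_odd h0 hm odd_one
  rw [hm.neg_pow, ho.neg_pow] at hk
  refine (Int.modEq_iff_dvd.2 ⟨-k, ?_⟩)
  rw [show (p : ℤ) - x = -x + p by ring, hk]
  ring

section PowerSum

variable {p : ℕ} [hpf : Fact p.Prime]

/-- The sum of the inverse cubes up to `p / 2`, in terms of the sum of the `p - 3`-rd powers. -/
lemma sum_half_inv_cube {h : ℕ} (hph : p = 2 * h + 1) (hp5 : 5 ≤ p) {s : ℤ}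
    (hs : ∑ i ∈ range (p - 1), ((i : ℤ) + 1) ^ (p - 3) = p * s) :
    ∑ i ∈ range h, (((i : ZMod p) + 1) ^ 3)⁻¹ = -2 * (s : ZMod p) := by
  obtain ⟨m, hm⟩ : ∃ m, p = m + 4 := ⟨p - 4, by omega⟩
  have hev : Even (m + 1) := by rw [Nat.even_iff]; omega
  rw [show p - 3 = m + 1 by omega] at hs
  set A := ∑ i ∈ range h, ((i : ℤ) + 1) ^ (m + 1)
  set T := ∑ i ∈ range h, ((i : ℤ) + 1) ^ m
  have c2 : p * s ≡ 2 * A - (m + 1) * p * T [ZMOD p ^ 2] := by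
    have := sum_range_two_mul_succ' (fun i => (i : ℤ) ^ (m + 1)) h
    rw [show 2 * h = p - 1 by omega] at this
    push_cast at this
    rw [← hs, this]
    have e : 2 * A - (m + 1) * p * T =
        ∑ i ∈ range h, (((i : ℤ) + 1) ^ (m + 1) +
          (((i : ℤ) + 1) ^ (m + 1) - ((m + 1 : ℕ) : ℤ) * ((i : ℤ) + 1) ^ m * p)) := by
      simp only [A, T, sum_add_distrib, sum_sub_distrib, ← sum_mul, ← mul_sum]
      push_cast; ring
    rw [e]
    refine Int.ModEq.sum fun i hi => Int.ModEq.add_left _ ?_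
    have hi := mem_range.1 hi
    have := even_pow_sub_modEq p hev (i + 1 : ℤ)
    rw [show p - 1 - i = p - (i + 1) by omega, Nat.cast_sub (by omega)]
    exact_mod_cast this
  have c1 : p * s ≡ 2 ^ (m + 2) * A - (m + 1) * p * 2 ^ m * T [ZMOD p ^ 2] := by
    have := sum_range_two_mul_succ (fun i => (i : ℤ) ^ (m + 1)) h
    rw [show 2 * h = p - 1 by omega] at this
    simp only [Nat.cast_add_one] at this
    rw [← hs, this]
    have e : 2 ^ (m + 2) * A - (m + 1) * p * 2 ^ m * T =
        ∑ i ∈ range h, ((2 * ((i : ℤ) + 1)) ^ (m + 1) +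
          ((2 * ((i : ℤ) + 1)) ^ (m + 1) -
            ((m + 1 : ℕ) : ℤ) * (2 * ((i : ℤ) + 1)) ^ m * p)) := by
      simp only [A, T, mul_pow, sum_add_distrib, sum_sub_distrib, ← sum_mul, ← mul_sum]
      push_cast; ring
    rw [e]
    refine Int.ModEq.sum fun i hi => Int.ModEq.add_left _ ?_
    have hi := mem_range.1 hi
    have := even_pow_sub_modEq p hev (2 * (i + 1) : ℤ)
    rw [show p - 1 + 1 - 2 * (i + 1) = p - 2 * (i + 1) by omega, Nat.cast_sub (by omega)]
    exact_mod_cast this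
  have c3 : (p : ℤ) ^ 2 ∣ p * (s * (2 ^ (m + 1) - 1) + (m + 1) * 2 ^ m * T) := by
    have d := dvd_sub (dvd_mul_of_dvd_right c2.dvd (2 ^ (m + 1))) c1.dvd
    rw [← dvd_neg]
    convert d using 1
    ring
  rw [pow_two] at c3
  have c4 := Int.dvd_of_mul_dvd_mul_left (by exact_mod_cast hpf.out.ne_zero) c3
  rw [← ZMod.intCast_zmod_eq_zero_iff_dvd] at c4
  have hT : (T : ZMod p) = ∑ i ∈ range h, (((i : ZMod p) + 1) ^ 3)⁻¹ := by
    simp only [T]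
    push_cast
    refine sum_congr rfl fun i hi => eq_inv_of_mul_eq_one_left ?_
    have hi := mem_range.1 hi
    have := ZMod.pow_card_sub_one_eq_one (natCast_zmod_ne_zero (p := p) (i := i + 1)
      (by omega) (by omega))
    rw [← pow_add, show m + 3 = p - 1 by omega]
    exact_mod_cast this
  have h2 : (8 : ZMod p) * 2 ^ m = 1 := by
    have := ZMod.pow_card_sub_one_eq_one (natCast_zmod_ne_zero (p := p) (i := 2)
      (by omega) (by omega))
    rw [show p - 1 = 3 + m by omega, pow_add] at this
    push_cast at this
    linear_combination this
  have h3 : (3 : ZMod p) ≠ 0 := by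
    exact_mod_cast natCast_zmod_ne_zero (p := p) (i := 3) (by omega) (by omega)
  have h4 : (m : ZMod p) = -4 := by
    have : ((m + 4 : ℕ) : ZMod p) = 0 := by rw [← hm]; simp
    push_cast at this
    linear_combination this
  rw [← hT]
  push_cast at c4
  rw [h4] at c4
  apply mul_left_cancel₀ h3
  linear_combination (-8) * c4 + (2 * (s : ZMod p) - 3 * T) * h2

end PowerSum

/-- The summand of the Domb numbers. -/
def dombTerm (n k : ℕ) : ℕ :=
  n.choose k ^ 2 * (2 * k).choose k * (2 * n - 2 * k).choose (n - k)

lemma dombTerm_symm {n k : ℕ} (hk : k ≤ n) : dombTerm n (n - k) = dombTerm n k := by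
  unfold dombTerm
  rw [Nat.choose_symm hk, Nat.sub_sub_self hk, ← Nat.mul_sub, ← Nat.mul_sub, Nat.sub_sub_self hk]
  ring

/-- The coefficients governing the summands `dombTerm (n * p) j` with `p ∤ j`. -/
def dombCoeff (n k : ℕ) : ℕ :=
  (n + 1) ^ 2 * n.choose k ^ 2 * (2 * k).choose k *
    ((2 * (n - k) + 1) * (2 * (n - k)).choose (n - k))

lemma sum_dombCoeff (n : ℕ) :
    ∑ k ∈ range (n + 1), dombCoeff n k =
      ∑ k ∈ range (n + 1), (n + 1).choose k ^ 2 * (2 * k).choose k *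
        (2 * (n + 1) - 2 * k - 2).choose (n + 1 - k - 1) * (n + 1) * (n + 1 - k) ^ 2 := by
  have e : ∀ k ∈ range (n + 1), dombCoeff n k + dombCoeff n (n + 1 - 1 - k) =
      2 * ((n + 1).choose k ^ 2 * (2 * k).choose k *
        (2 * (n + 1) - 2 * k - 2).choose (n + 1 - k - 1) * (n + 1) * (n + 1 - k) ^ 2) := by
    intro k hk
    obtain ⟨m, rfl⟩ := Nat.exists_eq_add_of_le (Nat.lt_succ_iff.1 (mem_range.1 hk))
    have h1 := Nat.choose_mul_succ_eq (k + m) k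
    have h2 := Nat.choose_symm_add (a := k) (b := m)
    unfold dombCoeff
    rw [show k + m + 1 - 1 - k = m by omega, show k + m - k = m by omega,
      show k + m - m = k by omega, show 2 * (k + m + 1) - 2 * k - 2 = 2 * m by omega,
      show k + m + 1 - k - 1 = m by omega, ← h2]
    calc _ = 2 * (((k + m).choose k * (k + m + 1)) ^ 2 * (2 * k).choose k *
          (2 * m).choose m * (k + m + 1)) := by ring
      _ = _ := by rw [h1]; ring
  have h := sum_congr rfl e
  rw [sum_add_distrib, sum_range_reflect, ← mul_sum] at h
  omega

lemma sum_range_mul_succ {M : Type*} [AddCommMonoid M] (f : ℕ → M) (n p : ℕ) :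
    ∑ j ∈ range (n * (p + 1) + 1), f j =
      ∑ k ∈ range (n + 1), f (k * (p + 1)) +
        ∑ k ∈ range n, ∑ r ∈ range p, f (k * (p + 1) + (r + 1)) := by
  induction n with
  | zero => simp
  | succ n ih =>
    rw [show (n + 1) * (p + 1) + 1 = (n * (p + 1) + 1) + (p + 1) by ring, sum_range_add, ih,
      sum_range_succ (fun k => ∑ r ∈ range p, f (k * (p + 1) + (r + 1))),
      sum_range_succ _ (n + 1), sum_range_succ _ p]
    have e : ∑ r ∈ range p, f (n * (p + 1) + 1 + r) =
        ∑ r ∈ range p, f (n * (p + 1) + (r + 1)) :=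
      sum_congr rfl fun r _ => by congr 1; ring
    rw [e, show n * (p + 1) + 1 + p = (n + 1) * (p + 1) by ring]
    abel

section NonMultiples

variable {p : ℕ} [hpf : Fact p.Prime]

lemma dombTerm_nonmultiple {n k i : ℕ} (hk : k ≤ n) (hi : 2 * (i + 1) < p) :
    p ^ 3 ∣ dombTerm ((n + 1) * p) (k * p + (i + 1)) ∧
      ((dombTerm ((n + 1) * p) (k * p + (i + 1)) / p ^ 3 : ℕ) : ZMod p) =
        -2 * dombCoeff n k * (((i : ZMod p) + 1) ^ 3)⁻¹ := by
  obtain ⟨m, rfl⟩ := Nat.exists_eq_add_of_le hk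
  obtain ⟨a, ha, ha'⟩ := exists_choose_mul_prime_eq (p := p) (k + m) k (i := i) (by omega)
  obtain ⟨w, hw, hw'⟩ := exists_centralBinom_mul (p := p) k m hi
  have e1 : (k + m + 1) * p - (k * p + (i + 1)) = m * p + (p - (i + 1)) := by
    rw [show (k + m + 1) * p = k * p + m * p + p by ring]; omega
  have e : dombTerm ((k + m + 1) * p) (k * p + (i + 1)) = p ^ 3 * (a ^ 2 * w) := by
    unfold dombTerm
    rw [← Nat.mul_sub, e1, mul_assoc, hw, ha]
    ring
  refine ⟨⟨_, e⟩, ?_⟩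
  rw [e, Nat.mul_div_cancel_left _ (pow_pos hpf.out.pos 3)]
  have hne : (i : ZMod p) + 1 ≠ 0 := by
    exact_mod_cast natCast_zmod_ne_zero (p := p) (i := i + 1) (by omega) (by omega)
  rw [eq_mul_inv_iff_mul_eq₀ (pow_ne_zero 3 hne)]
  unfold dombCoeff
  rw [show k + m - k = m by omega]
  push_cast at ha' ⊢
  have h3 : ((-1 : ZMod p) ^ i) ^ 2 = 1 := by rw [← pow_mul, mul_comm, pow_mul]; simp
  calc _ = (a * ((i : ZMod p) + 1)) ^ 2 * (w * (i + 1)) := by ring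
    _ = ((-1 : ZMod p) ^ i) ^ 2 * (((k + m + 1) * ((k + m).choose k : ℕ)) ^ 2 *
        (-2 * (2 * k).choose k * ((2 * m + 1) * (2 * m).choose m))) := by rw [ha', hw']; ring
    _ = _ := by rw [h3]; ring

/-- The contribution to `domb (n * p)` of the summands with index prime to `p`. -/
lemma exists_sum_nonmultiples (hp5 : 5 ≤ p) {s : ℤ}
    (hs : ∑ i ∈ range (p - 1), ((i : ℤ) + 1) ^ (p - 3) = p * s) (n : ℕ) :
    ∃ w : ℕ, ∑ k ∈ range (n + 1), ∑ r ∈ range (p - 1),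
        dombTerm ((n + 1) * p) (k * p + (r + 1)) = p ^ 3 * w ∧
      (w : ZMod p) = 8 * s * (∑ k ∈ range (n + 1), dombCoeff n k : ℕ) := by
  obtain ⟨h, hh⟩ := hpf.out.odd_of_ne_two (by omega)
  set T := fun k i => dombTerm ((n + 1) * p) (k * p + (i + 1))
  have e : ∑ k ∈ range (n + 1), ∑ r ∈ range (p - 1), T k r =
      2 * ∑ k ∈ range (n + 1), ∑ i ∈ range h, T k i := by
    have e1 : ∀ k, ∑ r ∈ range (p - 1), T k r =
        ∑ i ∈ range h, T k i + ∑ i ∈ range h, T k (p - (i + 1) - 1) := by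
      intro k
      have := sum_range_two_mul_succ' (fun i => T k (i - 1)) h
      rw [← sum_add_distrib, show p - 1 = 2 * h by omega]
      simpa only [Nat.add_sub_cancel, hh] using this
    simp only [e1, sum_add_distrib]
    rw [two_mul]
    congr 1
    rw [← sum_range_reflect]
    refine sum_congr rfl fun k hk => sum_congr rfl fun i hi => ?_
    obtain ⟨m, rfl⟩ := Nat.exists_eq_add_of_le (Nat.lt_succ_iff.1 (mem_range.1 hk))
    have hi := mem_range.1 hi
    simp only [T]
    have hle : k * p + (i + 1) ≤ (k + m + 1) * p := by
      rw [show (k + m + 1) * p = k * p + m * p + p by ring]; omega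
    rw [← dombTerm_symm hle]
    congr 1
    rw [show (k + m + 1) * p = k * p + m * p + p by ring, show k + m + 1 - 1 - k = m by omega]
    omega
  have hT : ∀ k ∈ range (n + 1), ∀ i ∈ range h, T k i = p ^ 3 * (T k i / p ^ 3) := by
    intro k hk i hi
    have hi := mem_range.1 hi
    exact (Nat.mul_div_cancel' (dombTerm_nonmultiple (Nat.lt_succ_iff.1 (mem_range.1 hk))
      (by omega)).1).symm
  refine ⟨2 * ∑ k ∈ range (n + 1), ∑ i ∈ range h, T k i / p ^ 3, ?_, ?_⟩
  · rw [e, sum_congr rfl fun k hk => sum_congr rfl (hT k hk)]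
    simp only [← mul_sum]
    ring
  · have hS := sum_half_inv_cube hh hp5 hs
    push_cast
    have : ∀ k ∈ range (n + 1), ∑ i ∈ range h, ((T k i / p ^ 3 : ℕ) : ZMod p) =
        4 * s * dombCoeff n k := by
      intro k hk
      have : ∀ i ∈ range h, ((T k i / p ^ 3 : ℕ) : ZMod p) =
          -2 * dombCoeff n k * (((i : ZMod p) + 1) ^ 3)⁻¹ := by
        intro i hi
        have hi := mem_range.1 hi
        exact (dombTerm_nonmultiple (Nat.lt_succ_iff.1 (mem_range.1 hk)) (by omega)).2
      rw [sum_congr rfl this, ← mul_sum, hS]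
      ring
    rw [sum_congr rfl this, ← mul_sum]
    ring

end NonMultiples

section Jacobsthal

open Polynomial in
/-- The rising product `(X + 1) ⋯ (X + (p - 1))`. -/
noncomputable def risingPoly (p : ℕ) : ℤ[X] :=
  ((univ : Finset (Fin (p - 1))).val.map fun i : Fin (p - 1) => X + C (((i : ℕ) : ℤ) + 1)).prod

/-- The elementary symmetric functions of `1, …, p - 1`. -/
noncomputable def esymmRange (p k : ℕ) : ℤ :=
  MvPolynomial.aeval (fun i : Fin (p - 1) => (i : ℤ) + 1) (MvPolynomial.esymm (Fin (p - 1)) ℤ k)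

lemma risingPoly_coeff {p k : ℕ} (hk : k ≤ p - 1) :
    (risingPoly p).coeff k = esymmRange p (p - 1 - k) := by
  unfold risingPoly esymmRange
  rw [Multiset.prod_X_add_C_coeff', MvPolynomial.aeval_esymm_eq_multiset_esymm]
  · rw [Finset.card_val, Finset.card_univ, Fintype.card_fin]
  · simpa using hk

lemma risingPoly_eval (p : ℕ) (x : ℤ) :
    (risingPoly p).eval x = ∏ i ∈ range (p - 1), (x + (i + 1)) := by
  unfold risingPoly
  rw [← Fin.prod_univ_eq_prod_range (fun i => x + ((i : ℤ) + 1)), Polynomial.eval_multiset_prod,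
    Multiset.map_map]
  unfold Finset.prod
  congr 1
  refine Multiset.map_congr rfl fun i _ => ?_
  simp

lemma esymmRange_zero (p : ℕ) : esymmRange p 0 = 1 := by simp [esymmRange]

lemma mul_esymmRange (p k : ℕ) : (k : ℤ) * esymmRange p k = (-1) ^ (k + 1) *
    ∑ a ∈ antidiagonal k with a.1 < k,
      (-1) ^ a.1 * esymmRange p a.1 * ∑ i ∈ range (p - 1), ((i : ℤ) + 1) ^ a.2 := by
  have h := congrArg (MvPolynomial.aeval (fun i : Fin (p - 1) => (i : ℤ) + 1))
    (MvPolynomial.mul_esymm_eq_sum (Fin (p - 1)) ℤ k)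
  simp only [map_mul, map_sum, map_pow, map_neg, map_one, map_natCast, MvPolynomial.psum,
    MvPolynomial.aeval_X] at h
  unfold esymmRange
  rw [h]
  congr 1
  refine sum_congr rfl fun a _ => ?_
  rw [← Fin.sum_univ_eq_sum_range (fun i => ((i : ℤ) + 1) ^ a.2)]

variable {p : ℕ} [hpf : Fact p.Prime]

lemma dvd_sum_range_pow {i : ℕ} (h0 : 0 < i) (hi : i < p - 1) :
    (p : ℤ) ∣ ∑ j ∈ range (p - 1), ((j : ℤ) + 1) ^ i := by
  have h := FiniteField.sum_pow_lt_card_sub_one (ZMod p) i (by rwa [ZMod.card])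
  rw [← ZMod.intCast_zmod_eq_zero_iff_dvd, ← h]
  push_cast
  obtain ⟨q, rfl⟩ : ∃ q, p = q + 1 := ⟨p - 1, (Nat.sub_add_cancel hpf.out.pos).symm⟩
  have := Fin.sum_univ_eq_sum_range (fun j => ((j : ZMod (q + 1))) ^ i) (q + 1)
  rw [sum_range_succ'] at this
  simp only [Nat.cast_zero, zero_pow h0.ne', add_zero] at this
  rw [Nat.add_sub_cancel]
  push_cast at this
  rw [← this]
  refine Fintype.sum_congr _ _ fun a => ?_
  congr 1
  exact ZMod.natCast_zmod_val (n := q + 1) a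

lemma dvd_esymmRange {k : ℕ} (h0 : 0 < k) (hk : k < p - 1) : (p : ℤ) ∣ esymmRange p k := by
  have h : (p : ℤ) ∣ k * esymmRange p k := by
    rw [mul_esymmRange]
    refine Dvd.dvd.mul_left (dvd_sum fun a ha => Dvd.dvd.mul_left ?_ _) _
    obtain ⟨h1, h2⟩ := mem_filter.1 ha
    rw [HasAntidiagonal.mem_antidiagonal] at h1
    exact dvd_sum_range_pow (by omega) (by omega)
  refine ((Nat.prime_iff_prime_int.1 hpf.out).dvd_or_dvd h).resolve_left ?_
  rw [Int.natCast_dvd_natCast]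
  exact Nat.not_dvd_of_pos_of_lt h0 (by omega)

lemma exists_esymmRange_prime_sub_three (hp5 : 5 ≤ p) {s : ℤ}
    (hs : ∑ i ∈ range (p - 1), ((i : ℤ) + 1) ^ (p - 3) = p * s) :
    ∃ d : ℤ, esymmRange p (p - 3) = p * d ∧ (p : ℤ) ∣ 3 * d - s := by
  obtain ⟨d, hd⟩ := dvd_esymmRange (p := p) (k := p - 3) (by omega) (by omega)
  refine ⟨d, hd, ?_⟩
  have hodd := hpf.out.odd_of_ne_two (by omega)
  have h := mul_esymmRange p (p - 3)
  have hmem : ((0, p - 3) : ℕ × ℕ) ∈ (antidiagonal (p - 3)).filter (fun a => a.1 < p - 3) := by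
    simp; omega
  rw [← add_sum_erase _ _ hmem, hs, esymmRange_zero] at h
  have hrest : (p : ℤ) * p ∣ ∑ a ∈ ((antidiagonal (p - 3)).filter (fun a => a.1 < p - 3)).erase
      (0, p - 3), (-1) ^ a.1 * esymmRange p a.1 * ∑ i ∈ range (p - 1), ((i : ℤ) + 1) ^ a.2 := by
    refine dvd_sum fun a ha => ?_
    obtain ⟨h1, h2⟩ := mem_erase.1 ha
    obtain ⟨h2, h3⟩ := mem_filter.1 h2
    rw [HasAntidiagonal.mem_antidiagonal] at h2
    have h4 : a.1 ≠ 0 := fun h4 => h1 (Prod.ext h4 (by simp; omega))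
    exact mul_dvd_mul (Dvd.dvd.mul_left (dvd_esymmRange (by omega) (by omega)) _)
      (dvd_sum_range_pow (by omega) (by omega))
  obtain ⟨q, hq⟩ := hrest
  have hev : Odd (p - 3 + 1) := by rw [Nat.odd_iff] at hodd ⊢; omega
  rw [hq, hd, hev.neg_one_pow, Nat.cast_sub (by omega)] at h
  refine ⟨d - q * (-1), ?_⟩
  have hp0 : (p : ℤ) ≠ 0 := by exact_mod_cast hpf.out.ne_zero
  apply mul_left_cancel₀ hp0
  push_cast at h
  linear_combination (-1) * h

lemma exists_risingPoly_eval (hp5 : 5 ≤ p) {d : ℤ} (hd : esymmRange p (p - 3) = p * d) :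
    ∃ c : ℤ, IsUnit (c : ZMod (p ^ 4)) ∧ ∀ j : ℕ, (((risingPoly p).eval (j * p : ℤ) : ℤ) : ZMod (p ^ 4)) =
      c * (1 - (p : ZMod (p ^ 4)) ^ 3 * d * (j + j ^ 2)) := by
  have hF : ∃ G : Polynomial ℤ, ∀ x : ℤ, (risingPoly p).eval x = (risingPoly p).coeff 0 +
      x * ((risingPoly p).coeff 1 + x * ((risingPoly p).coeff 2 +
        x * ((risingPoly p).coeff 3 + x * G.eval x))) := by
    refine ⟨(risingPoly p).divX.divX.divX.divX, fun x => ?_⟩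
    have e : ∀ P : Polynomial ℤ, P.eval x = P.coeff 0 + x * P.divX.eval x := fun P => by
      conv_lhs => rw [← P.divX_mul_X_add]
      simp; ring
    rw [e (risingPoly p), e (risingPoly p).divX, e (risingPoly p).divX.divX,
      e (risingPoly p).divX.divX.divX]
    simp [Polynomial.coeff_divX]
  obtain ⟨G, hG⟩ := hF
  have h2 : (risingPoly p).coeff 2 = p * d := by
    rw [risingPoly_coeff (by omega), ← hd]; congr 1
  obtain ⟨g, h3⟩ : (p : ℤ) ∣ (risingPoly p).coeff 3 := by
    rw [risingPoly_coeff (by omega)]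
    exact dvd_esymmRange (by omega) (by omega)
  set c := (risingPoly p).coeff 0 with hc
  set c1 := (risingPoly p).coeff 1
  rw [h2, h3] at hG
  have hev : Even (p - 1) := by
    have := Nat.odd_iff.1 (hpf.out.odd_of_ne_two (by omega)); rw [Nat.even_iff]; omega
  have hfac : c = ((p - 1).factorial : ℕ) := by
    have := hG 0
    rw [zero_mul, add_zero, risingPoly_eval] at this
    rw [← this, ← prod_range_add_one_eq_factorial]
    push_cast
    simp
  have hsym : (risingPoly p).eval (-p : ℤ) = c := by
    rw [hfac, risingPoly_eval, ← prod_range_add_one_eq_factorial,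
      ← prod_range_reflect (fun i => i + 1)]
    have e : ∀ i ∈ range (p - 1), (-(p : ℤ) + (i + 1)) = (-1) * ((p - 1 - 1 - i + 1 : ℕ) : ℤ) := by
      intro i hi
      have := mem_range.1 hi
      omega
    rw [prod_congr rfl e, prod_mul_distrib]
    simp [hev.neg_one_pow]
  obtain ⟨u, hu⟩ : (p : ℤ) ∣ c + 1 := by
    rw [← ZMod.intCast_zmod_eq_zero_iff_dvd, hfac]
    push_cast
    rw [ZMod.wilsons_lemma]
    ring
  have hp0 : (p : ℤ) ≠ 0 := by exact_mod_cast hpf.out.ne_zero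
  have h1 := hG (-p)
  rw [hsym] at h1
  have h1' : c1 = p ^ 2 * d - p ^ 3 * g + p ^ 3 * G.eval (-p : ℤ) := by
    apply mul_left_cancel₀ hp0
    linear_combination h1
  refine ⟨c, ?_, fun j => ?_⟩
  · rw [hfac, Int.cast_natCast, ZMod.isUnit_iff_coprime]
    refine Nat.Coprime.pow_right 4 (Nat.Coprime.symm ((hpf.out.coprime_iff_not_dvd).2 ?_))
    rw [hpf.out.dvd_factorial]
    have := hpf.out.pos
    omega
  · rw [← sub_eq_zero]
    have : ((p ^ 4 : ℕ) : ℤ) ∣ (risingPoly p).eval (j * p : ℤ) - c * (1 - p ^ 3 * d * (j + j ^ 2)) := by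
      rw [hG, h1']
      refine ⟨j * (- g + G.eval (-p : ℤ)) + j ^ 3 * g + j ^ 4 * G.eval (j * p : ℤ) + u * d * (j + j ^ 2), ?_⟩
      push_cast
      linear_combination p ^ 3 * d * (j + j ^ 2) * hu
    rw [← ZMod.intCast_zmod_eq_zero_iff_dvd] at this
    push_cast at this
    exact this

lemma factorial_mul_prime (p : ℕ) (hp : 0 < p) (a : ℕ) : (a * p).factorial =
    p ^ a * a.factorial * ∏ j ∈ range a, ∏ i ∈ range (p - 1), (j * p + (i + 1)) := by
  induction a with
  | zero => simp
  | succ a ih =>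
    have e : ∏ i ∈ range p, (a * p + (i + 1)) =
        (∏ i ∈ range (p - 1), (a * p + (i + 1))) * (a * p + p) := by
      obtain ⟨q, rfl⟩ : ∃ q, p = q + 1 := ⟨p - 1, by omega⟩
      rw [prod_range_succ, Nat.add_sub_cancel]
    have h := Nat.factorial_mul_ascFactorial (a * p) p
    rw [Nat.ascFactorial_eq_prod_range, ih] at h
    rw [show (a + 1) * p = a * p + p by ring, ← h, prod_range_succ, pow_succ, Nat.factorial_succ]
    have e' : ∏ i ∈ range p, (a * p + 1 + i) = ∏ i ∈ range p, (a * p + (i + 1)) :=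
      prod_congr rfl fun i _ => by ring
    rw [e', e]
    ring

lemma eq_mul_one_sub_of_pow_four_eq_zero {R : Type*} [CommRing R] {π A K x y z : R}
    (hπ : π ^ 4 = 0)
    (h : A * (1 - π ^ 3 * x) * (1 - π ^ 3 * y) = K * (1 - π ^ 3 * (x + y + z))) :
    A = K * (1 - π ^ 3 * z) := by
  linear_combination (1 + π ^ 3 * (x + y)) * h + (-A * π ^ 2 * (x * y - (x + y) ^ 2)
    - A * π ^ 5 * x * y * (x + y) - K * π ^ 2 * (x + y + z) * (x + y)) * hπ

/-- Jacobsthal's congruence, with `d` a third of the normalised sum of the `p - 3`-rd powers. -/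
lemma choose_mul_prime_mul_prime (hp5 : 5 ≤ p) {d : ℤ} (hd : esymmRange p (p - 3) = p * d)
    (b m : ℕ) : ((((b + m) * p).choose (b * p) : ℕ) : ZMod (p ^ 4)) =
      (b + m).choose b * (1 - (p : ZMod (p ^ 4)) ^ 3 * d * ((b + m) * b * m)) := by
  obtain ⟨c, hc, hF⟩ := exists_risingPoly_eval hp5 hd
  set P := fun a => ∏ j ∈ range a, ∏ i ∈ range (p - 1), (j * p + (i + 1)) with hP
  have hnat : ((b + m) * p).choose (b * p) * P b * P m = (b + m).choose b * P (b + m) := by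
    have h1 := Nat.add_choose_mul_factorial_mul_factorial (b * p) (m * p)
    have h2 := Nat.add_choose_mul_factorial_mul_factorial b m
    rw [← add_mul, factorial_mul_prime p hpf.out.pos, factorial_mul_prime p hpf.out.pos,
      factorial_mul_prime p hpf.out.pos, ← h2, ← Nat.choose_symm_add, add_mul,
      ← Nat.choose_symm_add] at h1
    rw [add_mul]
    have h3 : 0 < p ^ (b + m) * b.factorial * m.factorial := by
      have := hpf.out.pos; positivity
    apply Nat.eq_of_mul_eq_mul_left h3
    simp only [hP]
    rw [pow_add] at h1 ⊢
    linarith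
  have hπ : (p : ZMod (p ^ 4)) ^ 4 = 0 := by
    exact_mod_cast ZMod.natCast_self (p ^ 4)
  set π := (p : ZMod (p ^ 4))
  have hPa : ∀ a, ((P a : ℕ) : ZMod (p ^ 4)) =
      c ^ a * (1 - π ^ 3 * d * (∑ j ∈ range a, (j + j ^ 2) : ℕ)) := by
    intro a
    induction a with
    | zero => simp [hP]
    | succ a ih =>
      have h := hF a
      rw [risingPoly_eval] at h
      push_cast at h
      simp only [hP] at ih ⊢
      rw [prod_range_succ, Nat.cast_mul, ih, sum_range_succ]
      push_cast
      rw [h]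
      linear_combination
        (c : ZMod (p ^ 4)) ^ (a + 1) * π ^ 2 * d ^ 2 * (∑ j ∈ range a, (j + j ^ 2 : ZMod (p ^ 4))) *
          (a + a ^ 2) * hπ
  have hE : ∑ j ∈ range (b + m), (j + j ^ 2) = ∑ j ∈ range b, (j + j ^ 2) +
      ∑ j ∈ range m, (j + j ^ 2) + (b + m) * b * m := by
    clear hnat
    induction m with
    | zero => simp
    | succ m ih =>
      rw [← add_assoc, sum_range_succ, sum_range_succ, ih]
      ring
  have h := congrArg (Nat.cast : ℕ → ZMod (p ^ 4)) hnat
  rw [Nat.cast_mul, Nat.cast_mul, Nat.cast_mul, hPa, hPa, hPa, hE] at h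
  refine (eq_mul_one_sub_of_pow_four_eq_zero (R := ZMod (p ^ 4)) (π := π) (K := ((b + m).choose b : ℕ)) hπ
    (x := d * (∑ j ∈ range b, (j + j ^ 2) : ℕ))
    (y := d * (∑ j ∈ range m, (j + j ^ 2) : ℕ)) (z := d * ((b + m) * b * m)) ?_).trans ?_
  · exact (hc.pow (b + m)).mul_left_cancel (by
      rw [pow_add] at h ⊢
      push_cast at h ⊢
      linear_combination h)
  · rw [mul_assoc (π ^ 3)]

end Jacobsthal

section Multiples

variable {p : ℕ} [hpf : Fact p.Prime]

lemma dombTerm_multiple (hp5 : 5 ≤ p) {d : ℤ} (hd : esymmRange p (p - 3) = p * d) {n k : ℕ}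
    (hk : k ≤ n) : (dombTerm (n * p) (k * p) : ZMod (p ^ 4)) =
      dombTerm n k - (p : ZMod (p ^ 4)) ^ 3 * d *
        (dombTerm n k * (2 * n * k * (n - k) + 2 * k ^ 3 + 2 * (n - k) ^ 3) : ℕ) := by
  obtain ⟨m, rfl⟩ := Nat.exists_eq_add_of_le hk
  have hπ : (p : ZMod (p ^ 4)) ^ 4 = 0 := by
    exact_mod_cast ZMod.natCast_self (p ^ 4)
  have h1 := choose_mul_prime_mul_prime hp5 hd k m
  have h2 := choose_mul_prime_mul_prime hp5 hd k k
  have h3 := choose_mul_prime_mul_prime hp5 hd m m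
  have e : (k + m) * p - k * p = m * p := by rw [add_mul]; omega
  unfold dombTerm
  rw [← Nat.mul_sub, ← Nat.mul_sub, e, Nat.add_sub_cancel_left, two_mul k, two_mul m,
    show 2 * (k * p) = (k + k) * p by ring, show 2 * (m * p) = (m + m) * p by ring]
  push_cast
  rw [h1, h2, h3]
  generalize (p : ZMod (p ^ 4)) = π at hπ ⊢
  generalize (((k + m).choose k : ℕ) : ZMod (p ^ 4)) = a
  generalize (((k + k).choose k : ℕ) : ZMod (p ^ 4)) = b
  generalize (((m + m).choose m : ℕ) : ZMod (p ^ 4)) = c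
  have key : ∀ x y z : ZMod (p ^ 4), (1 - π ^ 3 * x) ^ 2 * (1 - π ^ 3 * y) * (1 - π ^ 3 * z) =
      1 - π ^ 3 * (2 * x + y + z) := by
    intro x y z
    linear_combination (π ^ 2 * (x ^ 2 + 2 * x * y + 2 * x * z + y * z)
      - π ^ 5 * (x ^ 2 * y + x ^ 2 * z + 2 * x * y * z) + π ^ 8 * x ^ 2 * y * z) * hπ
  have := key (d * ((k + m) * k * m)) (d * ((k + k) * k * k)) (d * ((m + m) * m * m))
  linear_combination a ^ 2 * b * c * this

lemma domb_mul_prime_dvd (hp5 : 5 ≤ p) {s d : ℤ}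
    (hs : ∑ i ∈ range (p - 1), ((i : ℤ) + 1) ^ (p - 3) = p * s)
    (hd : esymmRange p (p - 3) = p * d) (n : ℕ) :
    (p : ℤ) ^ 4 ∣ (∑ k ∈ range ((n + 1) * p + 1), dombTerm ((n + 1) * p) k : ℕ) -
      (∑ k ∈ range (n + 1 + 1), dombTerm (n + 1) k : ℕ) -
      p ^ 3 * (8 * s * (∑ k ∈ range (n + 1), dombCoeff n k : ℕ) -
        d * (∑ k ∈ range (n + 1 + 1), dombTerm (n + 1) k * (2 * (n + 1) * k * (n + 1 - k) +
          2 * k ^ 3 + 2 * (n + 1 - k) ^ 3) : ℕ)) := by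
  obtain ⟨w, hw, hw'⟩ := exists_sum_nonmultiples hp5 hs n
  have hsplit := sum_range_mul_succ (dombTerm ((n + 1) * p)) (n + 1) (p - 1)
  rw [Nat.sub_add_cancel hpf.out.pos, hw] at hsplit
  have hq : (p : ℤ) ∣ w - 8 * s * (∑ k ∈ range (n + 1), dombCoeff n k : ℕ) := by
    rw [← ZMod.intCast_zmod_eq_zero_iff_dvd]
    push_cast at hw' ⊢
    rw [hw', sub_self]
  obtain ⟨q, hq⟩ := hq
  have hM : ((∑ k ∈ range (n + 1 + 1), dombTerm ((n + 1) * p) (k * p) : ℕ) : ZMod (p ^ 4)) =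
      (∑ k ∈ range (n + 1 + 1), dombTerm (n + 1) k : ℕ) - (p : ZMod (p ^ 4)) ^ 3 * d *
        (∑ k ∈ range (n + 1 + 1), dombTerm (n + 1) k * (2 * (n + 1) * k * (n + 1 - k) +
          2 * k ^ 3 + 2 * (n + 1 - k) ^ 3) : ℕ) := by
    rw [Nat.cast_sum, Nat.cast_sum, Nat.cast_sum, mul_sum, ← sum_sub_distrib]
    exact sum_congr rfl fun k hk =>
      dombTerm_multiple hp5 hd (Nat.lt_succ_iff.1 (mem_range.1 hk))
  rw [hsplit]
  have hM' : ((p ^ 4 : ℕ) : ℤ) ∣ (∑ k ∈ range (n + 1 + 1), dombTerm ((n + 1) * p) (k * p) : ℕ) -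
      ((∑ k ∈ range (n + 1 + 1), dombTerm (n + 1) k : ℕ) - p ^ 3 * d *
        (∑ k ∈ range (n + 1 + 1), dombTerm (n + 1) k * (2 * (n + 1) * k * (n + 1 - k) +
          2 * k ^ 3 + 2 * (n + 1 - k) ^ 3) : ℕ)) := by
    rw [← ZMod.intCast_zmod_eq_zero_iff_dvd, Int.cast_sub, Int.cast_natCast, hM]
    push_cast
    ring
  obtain ⟨v, hv⟩ := hM'
  refine ⟨v + q, ?_⟩
  rw [Nat.cast_add, Nat.cast_mul]
  rw [Nat.cast_pow] at hv ⊢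
  linear_combination hv + (p : ℤ) ^ 3 * hq

end Multiples

section Bernoulli

variable {p : ℕ} [hpf : Fact p.Prime]

lemma padicNorm_bernoulli_le_one {n : ℕ} (hn : n + 1 < p) : padicNorm p (bernoulli n) ≤ 1 := by
  have h' : padicNorm p (bernoulli' n) ≤ 1 := by
    induction n using Nat.strong_induction_on with
    | _ n ih =>
      rw [bernoulli'_def]
      refine padicNorm.sub.trans (max_le padicNorm.one.le (padicNorm.sum_le' ?_ zero_le_one))
      intro k hk
      have hk := mem_range.1 hk
      have e : (n : ℚ) - k + 1 = ((n - k + 1 : ℕ) : ℚ) := by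
        rw [Nat.cast_add, Nat.cast_sub hk.le]; simp
      rw [padicNorm.mul, padicNorm.div, e, (padicNorm.nat_eq_one_iff (n - k + 1)).2
        (Nat.not_dvd_of_pos_of_lt (by omega) (by omega)), div_one]
      exact mul_le_one₀ (padicNorm.of_nat _) (padicNorm.nonneg _) (ih k hk (by omega))
  rw [bernoulli, padicNorm.mul]
  refine mul_le_one₀ ?_ (padicNorm.nonneg _) h'
  exact_mod_cast padicNorm.of_int (p := p) ((-1) ^ n)

lemma padicNorm_pow (e : ℕ) : padicNorm p ((p : ℚ) ^ e) = (p : ℚ) ^ (-(e : ℤ)) := by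
  induction e with
  | zero => simp
  | succ e ih =>
    have : (p : ℚ) ≠ 0 := by exact_mod_cast hpf.out.ne_zero
    rw [pow_succ, padicNorm.mul, ih, padicNorm.padicNorm_p_of_prime, zpow_neg, zpow_neg,
      Nat.cast_succ, zpow_add_one₀ this, mul_inv]

lemma padicNorm_pow_mul_le {e : ℕ} {x : ℚ} (hx : padicNorm p x ≤ 1) :
    padicNorm p ((p : ℚ) ^ e * x) ≤ (p : ℚ) ^ (-(e : ℤ)) := by
  rw [padicNorm.mul, padicNorm_pow]
  exact mul_le_of_le_one_right (by positivity) hx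

lemma padicNorm_sub_bernoulli_le (hp5 : 5 ≤ p) {s : ℤ}
    (hs : ∑ i ∈ range (p - 1), ((i : ℤ) + 1) ^ (p - 3) = p * s) :
    padicNorm p (s - bernoulli (p - 3)) ≤ (p : ℚ) ^ (-(1 : ℤ)) := by
  have h := sum_range_pow p (p - 3)
  rw [sum_range_succ] at h
  have hs' : ∑ k ∈ range p, (k : ℚ) ^ (p - 3) = p * s := by
    conv_lhs => rw [← Nat.sub_add_cancel hpf.out.pos]
    rw [sum_range_succ', Nat.cast_zero, zero_pow (by omega), add_zero]
    exact_mod_cast hs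
  rw [hs', Nat.choose_succ_self_right, Nat.add_sub_cancel_left, pow_one] at h
  have hne : ((p - 3 : ℕ) : ℚ) + 1 ≠ 0 := by positivity
  have h1 : (p : ℚ) * (s - bernoulli (p - 3)) = ∑ i ∈ range (p - 3), bernoulli i *
      ((p - 3 + 1).choose i) * (p : ℚ) ^ (p - 3 + 1 - i) / ((p - 3 : ℕ) + 1) := by
    rw [mul_sub, h]
    push_cast
    field_simp
    ring
  have h2 : padicNorm p ((p : ℚ) * (s - bernoulli (p - 3))) ≤ (p : ℚ) ^ (-(2 : ℕ) : ℤ) := by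
    rw [h1]
    refine padicNorm.sum_le' (fun i hi => ?_) (by positivity)
    have hi := mem_range.1 hi
    have e : bernoulli i * ((p - 3 + 1).choose i) * (p : ℚ) ^ (p - 3 + 1 - i) /
        ((p - 3 : ℕ) + 1) = (p : ℚ) ^ 2 * (bernoulli i * ((p - 3 + 1).choose i * p ^ (p - 4 - i) : ℕ) /
          ((p - 3 + 1 : ℕ) : ℚ)) := by
      rw [show p - 3 + 1 - i = 2 + (p - 4 - i) by omega, pow_add]
      push_cast
      ring
    rw [e]
    apply padicNorm_pow_mul_le
    rw [padicNorm.div, (padicNorm.nat_eq_one_iff _).2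
        (Nat.not_dvd_of_pos_of_lt (by omega) (by omega)), div_one, padicNorm.mul]
    exact mul_le_one₀ (padicNorm_bernoulli_le_one (by omega)) (padicNorm.nonneg _)
      (padicNorm.of_nat _)
  have hpos : (0 : ℚ) < p := by exact_mod_cast hpf.out.pos
  rw [padicNorm.mul, padicNorm.padicNorm_p_of_prime] at h2
  rw [inv_mul_le_iff₀ hpos] at h2
  refine h2.trans_eq ?_
  rw [zpow_neg, zpow_neg]
  push_cast
  field_simp

end Bernoulli

lemma domb_eq_sum_dombTerm (n : ℕ) : domb n = (∑ k ∈ range (n + 1), dombTerm n k : ℕ) := by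
  simp [domb, dombTerm]

lemma dombD_succ (n : ℕ) : dombD (n + 1) = 8 * (∑ k ∈ range (n + 1), dombCoeff n k : ℕ) -
    (1 / 3) * (∑ k ∈ range (n + 1 + 1), dombTerm (n + 1) k * (2 * (n + 1) * k * (n + 1 - k) +
          2 * k ^ 3 + 2 * (n + 1 - k) ^ 3) : ℕ) := by
  rw [sum_dombCoeff, dombD]
  simp only [dombTerm, Nat.cast_sum, Nat.cast_mul, Nat.cast_pow, Nat.cast_add, Nat.cast_one,
    Nat.cast_ofNat]

theorem domb_supercongruence (p : ℕ) (hp : p.Prime) (hp5 : 5 ≤ p) (n : ℕ) (hn : 0 < n) :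
    padicNorm p (domb (n * p) - (domb n + (p : ℚ) ^ 3 * bernoulli (p - 3) * dombD n)) ≤
      (p : ℚ) ^ (-(4 : ℤ)) := by
  have : Fact p.Prime := ⟨hp⟩
  obtain ⟨n, rfl⟩ : ∃ m, n = m + 1 := ⟨n - 1, by omega⟩
  obtain ⟨s, hs⟩ := dvd_sum_range_pow (p := p) (i := p - 3) (by omega) (by omega)
  obtain ⟨d, hd, q, hq⟩ := exists_esymmRange_prime_sub_three hp5 hs
  obtain ⟨v, hv⟩ := domb_mul_prime_dvd hp5 hs hd n
  have hB := padicNorm_sub_bernoulli_le hp5 hs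
  rw [domb_eq_sum_dombTerm, domb_eq_sum_dombTerm, dombD_succ]
  set X := ∑ k ∈ range (n + 1), dombCoeff n k
  set Y := ∑ k ∈ range (n + 1 + 1), dombTerm (n + 1) k * (2 * (n + 1) * k * (n + 1 - k) +
          2 * k ^ 3 + 2 * (n + 1 - k) ^ 3)
  set D' := ∑ k ∈ range ((n + 1) * p + 1), dombTerm ((n + 1) * p) k
  set D := ∑ k ∈ range (n + 1 + 1), dombTerm (n + 1) k
  have hv' : (D' : ℚ) - D - p ^ 3 * (8 * s * X - d * Y) = p ^ 4 * v := by exact_mod_cast hv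
  have hq' : 3 * (d : ℚ) - s = p * q := by exact_mod_cast hq
  have h3 : padicNorm p 3 = 1 := by
    have := (padicNorm.nat_eq_one_iff (p := p) 3).2 (Nat.not_dvd_of_pos_of_lt (by omega) (by omega))
    exact_mod_cast this
  have e : 3 * ((D' : ℚ) - (D + p ^ 3 * bernoulli (p - 3) * (8 * X - 1 / 3 * Y))) =
      p ^ 4 * ((3 * v - Y * q : ℤ) : ℚ) +
        p ^ 3 * (((24 * X - Y : ℤ) : ℚ) * (s - bernoulli (p - 3))) := by
    push_cast
    linear_combination 3 * hv' - (p : ℚ) ^ 3 * Y * hq'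
  have e' := padicNorm.mul (p := p) 3 (D' - (D + p ^ 3 * bernoulli (p - 3) * (8 * X - 1 / 3 * Y)))
  rw [h3, one_mul] at e'
  rw [← e', e]
  refine padicNorm.nonarchimedean.trans (max_le (padicNorm_pow_mul_le (padicNorm.of_int _)) ?_)
  have hp0 : (p : ℚ) ≠ 0 := by exact_mod_cast hp.ne_zero
  rw [padicNorm.mul, padicNorm_pow, padicNorm.mul, show (-(4 : ℤ)) = -((3 : ℕ) : ℤ) + -1 by norm_num,
    zpow_add₀ hp0]
  gcongr
  exact (mul_le_of_le_one_left (padicNorm.nonneg _) (padicNorm.of_int _)).trans hB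
end

section
/- Let $p \ge 5$ be a prime and $r, s, n$ positive integers with $r \ge 2$ and $r + s \ge 4$. Then $D_{np}^{(r,s)} \equiv D_n^{(r,s)} + p^3 B_{p-3} \mathcal{D}_n^{(r,s)} \pmod{p^4}$ (as a congruence of rational numbers, i.e. the $p$-adic valuation of the difference is at least $4$), where $\mathcal{D}_n^{(r,s)} = -\frac{1}{3}\sum_{k=0}^{n}\binom{n}{k}^r\left(\binom{2k}{k}\binom{2n-2k}{n-k}\right)^s\bigl(rnk(n-k)+2sk^3+2s(n-k)^3\bigr)$. -/
open Finset

/-- The generalized Domb numbers `Dₙ^{(r,s)}`, as rational numbers. -/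
def dombRS (r s n : ℕ) : ℚ :=
  ∑ k ∈ range (n + 1),
    (n.choose k : ℚ) ^ r * (((2 * k).choose k : ℚ) * ((2 * n - 2 * k).choose (n - k))) ^ s

/-- The coefficient `𝒟ₙ^{(r,s)}` from the theorem. -/
def dombRSD (r s n : ℕ) : ℚ :=
  -(1 / 3) * ∑ k ∈ range (n + 1),
      (n.choose k : ℚ) ^ r * (((2 * k).choose k : ℚ) * ((2 * n - 2 * k).choose (n - k))) ^ s *
        ((r : ℚ) * n * k * ((n - k : ℕ) : ℚ) + 2 * s * (k : ℚ) ^ 3 + 2 * s * ((n - k : ℕ) : ℚ) ^ 3)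

/-- Evaluation of Newton's identity at integers. -/
lemma natCast_mul_aeval_esymm {σ : Type*} [Fintype σ] (x : σ → ℤ) (k : ℕ) :
    (k : ℤ) * MvPolynomial.aeval x (MvPolynomial.esymm σ ℤ k) =
      (-1) ^ (k + 1) * ∑ a ∈ antidiagonal k with a.1 < k,
        (-1) ^ a.1 * MvPolynomial.aeval x (MvPolynomial.esymm σ ℤ a.1) * ∑ i, x i ^ a.2 := by
  have h := congrArg (MvPolynomial.aeval x) (MvPolynomial.mul_esymm_eq_sum σ ℤ k)
  simpa [MvPolynomial.psum] using h

lemma dvd_aeval_esymm {σ : Type*} [Fintype σ] (x : σ → ℤ) {p N : ℕ} (hp : p.Prime)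
    (hN : N < p) (hx : ∀ j, 0 < j → j ≤ N → (p : ℤ) ∣ ∑ i, x i ^ j) {k : ℕ} (hk : 0 < k)
    (hkN : k ≤ N) : (p : ℤ) ∣ MvPolynomial.aeval x (MvPolynomial.esymm σ ℤ k) := by
  have h : (p : ℤ) ∣ (k : ℤ) * MvPolynomial.aeval x (MvPolynomial.esymm σ ℤ k) := by
    rw [natCast_mul_aeval_esymm]
    refine Dvd.dvd.mul_left (dvd_sum fun a ha => ?_) _
    simp only [mem_filter, HasAntidiagonal.mem_antidiagonal] at ha
    exact Dvd.dvd.mul_left (hx _ (by omega) (by omega)) _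
  rcases (Nat.prime_iff_prime_int.mp hp).dvd_or_dvd h with h | h
  · have := Nat.le_of_dvd hk (Int.natCast_dvd_natCast.mp h)
    omega
  · exact h

lemma sq_dvd_mul_aeval_esymm_sub {σ : Type*} [Fintype σ] (x : σ → ℤ) {p N : ℕ} (hp : p.Prime)
    (hN : N < p) (hx : ∀ j, 0 < j → j ≤ N → (p : ℤ) ∣ ∑ i, x i ^ j) (hN0 : 0 < N) :
    (p : ℤ) ^ 2 ∣ (N : ℤ) * MvPolynomial.aeval x (MvPolynomial.esymm σ ℤ N) -
      (-1) ^ (N + 1) * ∑ i, x i ^ N := by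
  rw [natCast_mul_aeval_esymm, ← mul_sub]
  refine Dvd.dvd.mul_left ?_ _
  have h0 : ((0, N) : ℕ × ℕ) ∈ (antidiagonal N).filter (fun a => a.1 < N) := by
    simp [hN0]
  rw [← add_sum_erase _ _ h0]
  simp only [pow_zero, one_mul, MvPolynomial.esymm_zero, map_one, add_sub_cancel_left]
  refine dvd_sum fun a ha => ?_
  simp only [mem_erase, mem_filter, HasAntidiagonal.mem_antidiagonal, ne_eq, Prod.ext_iff] at ha
  rw [sq]
  exact mul_dvd_mul (Dvd.dvd.mul_left (dvd_aeval_esymm x hp hN hx (by omega) (by omega)) _)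
    (hx _ (by omega) (by omega))

lemma sum_fin_pow_eq_sum_range {p j : ℕ} (hp : 0 < p) (hj : 0 < j) :
    ∑ i : Fin (p - 1), ((i : ℤ) + 1) ^ j = ∑ i ∈ range p, (i : ℤ) ^ j := by
  obtain ⟨q, rfl⟩ : ∃ q, p = q + 1 := ⟨p - 1, by omega⟩
  rw [sum_range_succ', Nat.add_sub_cancel, Fin.sum_univ_eq_sum_range (fun i => ((i : ℤ) + 1) ^ j)]
  simp [hj.ne']

lemma prime_dvd_sum_pow {p j : ℕ} (hp : p.Prime) (hj : 0 < j) (hjp : j < p - 1) :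
    (p : ℤ) ∣ ∑ i : Fin (p - 1), ((i : ℤ) + 1) ^ j := by
  have := Fact.mk hp
  rw [sum_fin_pow_eq_sum_range hp.pos hj, ← ZMod.intCast_zmod_eq_zero_iff_dvd]
  push_cast
  have h2 := FiniteField.sum_pow_lt_card_sub_one (ZMod p) j (by rwa [ZMod.card])
  rw [← h2]
  refine sum_bij' (fun i _ => (i : ZMod p)) (fun a _ => a.val) ?_ ?_ ?_ ?_ ?_
  · simp
  · intro a _
    simpa using ZMod.val_lt a
  · intro i hi
    exact ZMod.val_cast_of_lt (mem_range.mp hi)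
  · simp
  · simp

lemma padicNorm_bernoulli_le_one_s1 {p : ℕ} [hp : Fact p.Prime] {k : ℕ} (hk : k + 1 < p) :
    padicNorm p (bernoulli k) ≤ 1 := by
  have hmain : padicNorm p (bernoulli' k) ≤ 1 := by
    induction k using Nat.strong_induction_on with
    | _ k ih =>
      rw [bernoulli'_def]
      refine padicNorm.sub.trans (max_le (by simp) (padicNorm.sum_le' (fun i hi => ?_) zero_le_one))
      have hik := mem_range.mp hi
      have hden : ((k : ℚ) - i + 1) = ((k - i + 1 : ℕ) : ℚ) := by
        push_cast [Nat.cast_sub hik.le]; ring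
      have hunit : padicNorm p ((k - i + 1 : ℕ) : ℚ) = 1 := by
        rw [padicNorm.nat_eq_one_iff]
        intro h
        have := Nat.le_of_dvd (by omega) h
        omega
      rw [padicNorm.mul, padicNorm.div, hden, hunit, div_one]
      exact mul_le_one₀ (padicNorm.of_nat _) (padicNorm.nonneg _) (ih i hik (by omega))
  rw [bernoulli, padicNorm.mul]
  refine mul_le_one₀ ?_ (padicNorm.nonneg _) hmain
  exact_mod_cast padicNorm.of_int ((-1 : ℤ) ^ k)

/-- Faulhaber's formula modulo `p ^ 2`. -/
lemma padicNorm_sum_range_pow_sub_le {p : ℕ} [hp : Fact p.Prime] {k : ℕ} (hk : k + 1 < p) :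
    padicNorm p (∑ i ∈ range p, (i : ℚ) ^ k - p * bernoulli k) ≤ (p : ℚ) ^ (-(2 : ℤ)) := by
  have hk0 : ((k : ℚ) + 1) ≠ 0 := by positivity
  have hlast : bernoulli k * ((k + 1).choose k : ℚ) * (p : ℚ) ^ (k + 1 - k) / (k + 1) =
      p * bernoulli k := by
    rw [Nat.choose_succ_self_right, Nat.add_sub_cancel_left]
    push_cast
    field_simp
  rw [sum_range_pow, sum_range_succ, hlast, add_sub_cancel_right]
  refine padicNorm.sum_le' (fun i hi => ?_) (by positivity)
  have hik := mem_range.mp hi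
  have hunit : padicNorm p ((k : ℚ) + 1) = 1 := by
    have : padicNorm p ((k + 1 : ℕ) : ℚ) = 1 := by
      rw [padicNorm.nat_eq_one_iff]
      intro h
      have := Nat.le_of_dvd (by omega) h
      omega
    exact_mod_cast this
  have hpow : padicNorm p ((p : ℚ) ^ (k + 1 - i)) ≤ (p : ℚ) ^ (-(2 : ℤ)) := by
    have : ((p ^ 2 : ℕ) : ℤ) ∣ ((p ^ (k + 1 - i) : ℕ) : ℤ) :=
      Int.natCast_dvd_natCast.mpr (pow_dvd_pow _ (by omega))
    rw [padicNorm.dvd_iff_norm_le] at this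
    exact_mod_cast this
  rw [padicNorm.div, hunit, div_one, padicNorm.mul, padicNorm.mul]
  calc _ ≤ 1 * (p : ℚ) ^ (-(2 : ℤ)) := by
        refine mul_le_mul ?_ hpow (padicNorm.nonneg _) zero_le_one
        exact mul_le_one₀ (padicNorm_bernoulli_le_one_s1 (by omega)) (padicNorm.nonneg _)
          (padicNorm.of_nat _)
    _ = _ := one_mul _

/-- The values at multiples of `p` of `(x + 1) ⋯ (x + p - 1)` modulo `p ^ 4`. -/
lemma exists_prod_add_modEq {p : ℕ} (hp : p.Prime) (hp5 : 5 ≤ p) :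
    ∃ d : ℤ, padicNorm p (3 * (d : ℚ) - bernoulli (p - 3)) ≤ (p : ℚ) ^ (-(1 : ℤ)) ∧
      ∀ x : ℤ, ∏ i ∈ range (p - 1), (x * p + (i + 1)) ≡
        (∏ i ∈ range (p - 1), ((i : ℤ) + 1)) * (1 - d * (p : ℤ) ^ 3 * (x ^ 2 + x))
          [ZMOD (p : ℤ) ^ 4] := by
  have := Fact.mk hp
  set y : Fin (p - 1) → ℤ := fun i => (i : ℤ) + 1 with hy
  set g : Polynomial ℤ := ∏ i : Fin (p - 1), (Polynomial.X + Polynomial.C (y i)) with hg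
  have heval (x : ℤ) : g.eval x = ∏ i ∈ range (p - 1), (x + ((i : ℤ) + 1)) := by
    rw [hg, Polynomial.eval_prod, ← Fin.prod_univ_eq_prod_range (fun i => x + ((i : ℤ) + 1))]
    simp [hy]
  have hcoeff (k : ℕ) (hk : k ≤ p - 1) : g.coeff k =
      MvPolynomial.aeval y (MvPolynomial.esymm (Fin (p - 1)) ℤ (p - 1 - k)) := by
    rw [hg, Finset.prod_X_add_C_coeff _ _ (by simpa using hk)]
    simp [MvPolynomial.esymm, map_sum, map_prod]
  have hx : ∀ j, 0 < j → j ≤ p - 2 → (p : ℤ) ∣ ∑ i, y i ^ j := fun j hj hjp =>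
    prime_dvd_sum_pow hp hj (by omega)
  have hc3 : (p : ℤ) ∣ g.coeff 3 := by
    rw [hcoeff 3 (by omega)]
    exact dvd_aeval_esymm y hp (N := p - 2) (by omega) hx (by omega) (by omega)
  have hc2 : (p : ℤ) ∣ g.coeff 2 := by
    rw [hcoeff 2 (by omega)]
    exact dvd_aeval_esymm y hp (N := p - 2) (by omega) hx (by omega) (by omega)
  have hnewton : (p : ℤ) ^ 2 ∣ 3 * g.coeff 2 - ∑ i, y i ^ (p - 3) := by
    have h := sq_dvd_mul_aeval_esymm_sub y hp (N := p - 3) (by omega)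
      (fun j hj hjp => hx j hj (by omega)) (by omega)
    have hodd : Odd (p - 3 + 1) := by
      have := hp.odd_of_ne_two (by omega)
      obtain ⟨t, ht⟩ := this
      exact ⟨t - 1, by omega⟩
    have h2 := hcoeff 2 (by omega)
    rw [show p - 1 - 2 = p - 3 by omega] at h2
    rw [hodd.neg_one_pow, ← h2, Nat.cast_sub (by omega)] at h
    obtain ⟨a, ha⟩ := h
    obtain ⟨b, hb⟩ := hc2
    refine ⟨b - a, ?_⟩
    rw [hb] at ha ⊢
    push_cast at ha
    linear_combination -ha
  obtain ⟨d, hd⟩ := hc2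
  obtain ⟨e, he⟩ := hc3
  have hwilson : (p : ℤ) ∣ g.coeff 0 + 1 := by
    have h := ZMod.wilsons_lemma p
    have h0 : g.coeff 0 = ((p - 1).factorial : ℤ) := by
      rw [Polynomial.coeff_zero_eq_eval_zero, heval, ← prod_range_add_one_eq_factorial]
      push_cast
      simp
    rw [← ZMod.intCast_zmod_eq_zero_iff_dvd, h0]
    push_cast
    rw [h]; ring
  have hexp (x : ℤ) : ∃ h : ℤ, g.eval x =
      g.coeff 0 + g.coeff 1 * x + g.coeff 2 * x ^ 2 + g.coeff 3 * x ^ 3 + h * x ^ 4 := by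
    have h0 := congrArg (Polynomial.eval x) (Polynomial.divX_mul_X_add g)
    have h1 := congrArg (Polynomial.eval x) (Polynomial.divX_mul_X_add g.divX)
    have h2 := congrArg (Polynomial.eval x) (Polynomial.divX_mul_X_add g.divX.divX)
    have h3 := congrArg (Polynomial.eval x) (Polynomial.divX_mul_X_add g.divX.divX.divX)
    simp only [Polynomial.eval_add, Polynomial.eval_mul, Polynomial.eval_X, Polynomial.eval_C,
      Polynomial.coeff_divX] at h0 h1 h2 h3
    refine ⟨g.divX.divX.divX.divX.eval x, ?_⟩
    rw [← h0, ← h1, ← h2, ← h3]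
    ring
  have hsymm : g.eval (-(p : ℤ)) = g.coeff 0 := by
    rw [Polynomial.coeff_zero_eq_eval_zero, heval, heval, ← prod_range_reflect]
    have heven : Even (p - 1) := hp.even_sub_one (by omega)
    have : ∀ j ∈ range (p - 1), (-(p : ℤ) + (((p - 1 - 1 - j : ℕ) : ℤ) + 1)) =
        -1 * (0 + ((j : ℤ) + 1)) := by
      intro j hj
      have := mem_range.mp hj
      push_cast [Nat.cast_sub (show j ≤ p - 1 - 1 by omega), Nat.cast_sub (show 1 ≤ p - 1 by omega),
        Nat.cast_sub (show 1 ≤ p by omega)]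
      ring
    rw [prod_congr rfl this, prod_mul_distrib, prod_const, card_range, heven.neg_one_pow, one_mul]
  obtain ⟨w, hw⟩ := hwilson
  obtain ⟨m, hm⟩ := hexp (-p)
  refine ⟨d, ?_, fun x => ?_⟩
  · have h1 : padicNorm p ((3 * g.coeff 2 - ∑ i, y i ^ (p - 3) : ℤ) : ℚ) ≤
        (p : ℚ) ^ (-(2 : ℤ)) := by
      have := (padicNorm.dvd_iff_norm_le (p := p) (n := 2)).mp (by exact_mod_cast hnewton)
      exact_mod_cast this
    have h2 := padicNorm_sum_range_pow_sub_le (p := p) (k := p - 3) (by omega)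
    have hsum : ∑ i, y i ^ (p - 3) = ∑ i ∈ range p, (i : ℤ) ^ (p - 3) :=
      sum_fin_pow_eq_sum_range hp.pos (by omega)
    rw [hsum, hd] at h1
    push_cast at h1
    have h3 : padicNorm p ((p : ℚ) * (3 * (d : ℚ) - bernoulli (p - 3))) ≤
        (p : ℚ) ^ (-(2 : ℤ)) := by
      refine le_trans (le_of_eq ?_) ((padicNorm.nonarchimedean (p := p)).trans (max_le h1 h2))
      congr 1
      ring
    have hpq : (0 : ℚ) < p := by exact_mod_cast hp.pos
    rw [padicNorm.mul, padicNorm.padicNorm_p_of_prime] at h3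
    calc _ = (p : ℚ) * ((p : ℚ)⁻¹ * padicNorm p (3 * (d : ℚ) - bernoulli (p - 3))) := by
          field_simp
      _ ≤ p * (p : ℚ) ^ (-(2 : ℤ)) := by gcongr
      _ = _ := by
          rw [← zpow_one_add₀ hpq.ne']; norm_num
  · obtain ⟨h, hh⟩ := hexp (x * p)
    rw [heval] at hh
    have h0 : ∏ i ∈ range (p - 1), ((i : ℤ) + 1) = g.coeff 0 := by
      rw [Polynomial.coeff_zero_eq_eval_zero, heval]; simp
    rw [h0, hh]
    rw [hsymm, hd, he] at hm
    have hc1 : g.coeff 1 * p = p ^ 4 * (m - e) + p ^ 3 * d := by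
      linear_combination hm
    refine (Int.modEq_iff_dvd.mpr ⟨-(m - e) * x - e * x ^ 3 - h * x ^ 4 - w * d * (x ^ 2 + x), ?_⟩)
    rw [hd, he]
    linear_combination (-x) * hc1 - (p : ℤ) ^ 3 * d * (x ^ 2 + x) * hw

lemma factorial_add_eq_mul_prod (m k : ℕ) :
    (m + k).factorial = m.factorial * ∏ i ∈ range k, (m + (i + 1)) := by
  induction k with
  | zero => simp
  | succ k ih => rw [prod_range_succ, ← mul_assoc, ← ih, ← add_assoc, Nat.factorial_succ, mul_comm]

lemma factorial_mul_eq {p : ℕ} (hp : 0 < p) (n : ℕ) :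
    (n * p).factorial = n.factorial * p ^ n *
      ∏ j ∈ range n, ∏ i ∈ range (p - 1), (j * p + (i + 1)) := by
  induction n with
  | zero => simp
  | succ n ih =>
    obtain ⟨q, rfl⟩ : ∃ q, p = q + 1 := ⟨p - 1, by omega⟩
    rw [Nat.add_sub_cancel] at ih ⊢
    rw [add_mul, one_mul, factorial_add_eq_mul_prod, ih, prod_range_succ, prod_range_succ,
      Nat.factorial_succ]
    ring

lemma prod_modEq_one_sub_sum {p : ℕ} {d c : ℤ} {f : ℕ → ℤ}
    (hf : ∀ j, f j ≡ c * (1 - d * (p : ℤ) ^ 3 * ((j : ℤ) ^ 2 + j)) [ZMOD (p : ℤ) ^ 4]) (n : ℕ) :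
    ∏ j ∈ range n, f j ≡
      c ^ n * (1 - d * (p : ℤ) ^ 3 * ∑ j ∈ range n, ((j : ℤ) ^ 2 + j)) [ZMOD (p : ℤ) ^ 4] := by
  induction n with
  | zero => simp
  | succ n ih =>
    rw [prod_range_succ, sum_range_succ]
    refine (ih.mul (hf n)).trans (Int.modEq_iff_dvd.mpr ⟨-c ^ (n + 1) * d ^ 2 * p ^ 2 *
      (∑ j ∈ range n, ((j : ℤ) ^ 2 + j)) * ((n : ℤ) ^ 2 + n), ?_⟩)
    ring

lemma sum_range_add_sq_add (k m : ℕ) :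
    ∑ j ∈ range (k + m), ((j : ℤ) ^ 2 + j) = ∑ j ∈ range k, ((j : ℤ) ^ 2 + j) +
      ∑ j ∈ range m, ((j : ℤ) ^ 2 + j) + k * m * (k + m) := by
  induction m with
  | zero => simp
  | succ m ih =>
    rw [← add_assoc, sum_range_succ, ih, sum_range_succ]
    push_cast
    ring

/-- The binomial coefficients `(np choose kp)` modulo `p ^ 4`. -/
lemma exists_choose_mul_mul_modEq {p : ℕ} (hp : p.Prime) (hp5 : 5 ≤ p) :
    ∃ d : ℤ, padicNorm p (3 * (d : ℚ) - bernoulli (p - 3)) ≤ (p : ℚ) ^ (-(1 : ℤ)) ∧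
      ∀ k m : ℕ, ((((k + m) * p).choose (k * p) : ℕ) : ℤ) ≡
        ((k + m).choose k : ℕ) * (1 - d * (p : ℤ) ^ 3 * (k * m * (k + m))) [ZMOD (p : ℤ) ^ 4] := by
  obtain ⟨d, hd, hprod⟩ := exists_prod_add_modEq hp hp5
  refine ⟨d, hd, fun k m => ?_⟩
  set c : ℤ := ∏ i ∈ range (p - 1), ((i : ℤ) + 1) with hc
  set F : ℕ → ℤ := fun n => ∏ j ∈ range n, ∏ i ∈ range (p - 1), ((j : ℤ) * p + (i + 1)) with hF
  set S : ℕ → ℤ := fun n => ∑ j ∈ range n, ((j : ℤ) ^ 2 + j) with hS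
  have hFmod (n : ℕ) : F n ≡ c ^ n * (1 - d * (p : ℤ) ^ 3 * S n) [ZMOD (p : ℤ) ^ 4] :=
    prod_modEq_one_sub_sum (fun j => hprod j) n
  have hfact (n : ℕ) : ((n * p).factorial : ℤ) = n.factorial * p ^ n * F n := by
    rw [factorial_mul_eq hp.pos]; push_cast; rfl
  have hkey : ((((k + m) * p).choose (k * p) : ℕ) : ℤ) * (F k * F m) =
      ((k + m).choose k : ℕ) * F (k + m) := by
    have h1 : ((k + m).choose k : ℤ) * k.factorial * m.factorial = (k + m).factorial := by
      rw [Nat.choose_symm_add]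
      exact_mod_cast Nat.add_choose_mul_factorial_mul_factorial k m
    have h2 : (((k + m) * p).choose (k * p) : ℤ) * (k * p).factorial * (m * p).factorial =
        ((k + m) * p).factorial := by
      rw [add_mul, Nat.choose_symm_add]
      exact_mod_cast Nat.add_choose_mul_factorial_mul_factorial (k * p) (m * p)
    rw [hfact, hfact, hfact, ← h1] at h2
    have hne : (k.factorial * m.factorial * p ^ (k + m) : ℤ) ≠ 0 := by positivity
    refine mul_left_cancel₀ hne ?_
    linear_combination h2
  have hcop : IsCoprime c ((p : ℤ) ^ 4) := by
    refine IsCoprime.pow_right (IsCoprime.prod_left fun i hi => ?_)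
    have := mem_range.mp hi
    have h : Nat.Coprime (i + 1) p :=
      (Nat.coprime_of_lt_prime (by omega) (by omega) hp).symm
    exact_mod_cast Nat.isCoprime_iff_coprime.mpr h
  have hgcd : Int.gcd ((p : ℤ) ^ 4) (c ^ (k + m)) = 1 :=
    Int.isCoprime_iff_gcd_eq_one.mp (hcop.pow_left (m := k + m)).symm
  have hS' : S (k + m) = S k + S m + k * m * (k + m) := sum_range_add_sq_add k m
  have h1 := ((hFmod k).mul (hFmod m)).mul_left ((((k + m) * p).choose (k * p) : ℕ) : ℤ)
  rw [hkey] at h1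
  replace h1 := h1.symm.trans ((hFmod (k + m)).mul_left (((k + m).choose k : ℕ) : ℤ))
  rw [hS'] at h1
  generalize ((((k + m) * p).choose (k * p) : ℕ) : ℤ) = A at h1 ⊢
  generalize (((k + m).choose k : ℕ) : ℤ) = B at h1 ⊢
  generalize S k = U at h1
  generalize S m = V at h1
  generalize (k : ℤ) * m * (k + m) = W at h1 ⊢
  have h2 : c ^ (k + m) * A * ((1 - d * p ^ 3 * U) * (1 - d * p ^ 3 * V) * (1 + d * p ^ 3 * (U + V))) ≡
      c ^ (k + m) * B * ((1 - d * p ^ 3 * (U + V + W)) * (1 + d * p ^ 3 * (U + V)))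
        [ZMOD (p : ℤ) ^ 4] := by
    convert h1.mul_right (1 + d * p ^ 3 * (U + V)) using 1 <;> ring
  have h3 : (1 - d * p ^ 3 * U) * (1 - d * p ^ 3 * V) * (1 + d * p ^ 3 * (U + V)) ≡ 1
      [ZMOD (p : ℤ) ^ 4] := by
    refine (Int.modEq_iff_dvd.mpr ⟨d ^ 2 * p ^ 2 * ((U + V) ^ 2 - U * V) -
      d ^ 3 * p ^ 5 * U * V * (U + V), ?_⟩)
    ring
  have h4 : (1 - d * p ^ 3 * (U + V + W)) * (1 + d * p ^ 3 * (U + V)) ≡ 1 - d * p ^ 3 * W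
      [ZMOD (p : ℤ) ^ 4] := by
    refine (Int.modEq_iff_dvd.mpr ⟨d ^ 2 * p ^ 2 * (U + V + W) * (U + V), ?_⟩)
    ring
  have h5 := ((h3.mul_left _).symm.trans h2).trans (h4.mul_left _)
  rw [mul_one, mul_assoc] at h5
  have h6 := Int.ModEq.cancel_left_div_gcd (by positivity) h5
  rwa [hgcd, Nat.cast_one, Int.ediv_one] at h6

lemma one_sub_mul_pow_modEq (p : ℕ) (u : ℤ) (r : ℕ) :
    (1 - (p : ℤ) ^ 3 * u) ^ r ≡ 1 - (p : ℤ) ^ 3 * (r * u) [ZMOD (p : ℤ) ^ 4] := by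
  induction r with
  | zero => simp
  | succ r ih =>
    rw [pow_succ (1 - (p : ℤ) ^ 3 * u)]
    refine (ih.mul_right _).trans (Int.modEq_iff_dvd.mpr ⟨-(p : ℤ) ^ 2 * r * u ^ 2, ?_⟩)
    push_cast
    ring

lemma prime_dvd_choose_of_mod_lt {p a b : ℕ} [Fact p.Prime] (h : a % p < b % p) :
    p ∣ a.choose b := by
  have := Choose.choose_modEq_choose_mod_mul_choose_div_nat (p := p) (n := a) (k := b)
  rw [Nat.choose_eq_zero_of_lt h, zero_mul] at this
  exact (Nat.modEq_zero_iff_dvd).mp this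

lemma prime_dvd_two_mul_choose {p k : ℕ} [hp : Fact p.Prime] (hp2 : 2 < p) (h : p < 2 * (k % p)) :
    p ∣ (2 * k).choose k := by
  apply prime_dvd_choose_of_mod_lt
  have hlt := Nat.mod_lt k hp.out.pos
  have : 2 * k % p = 2 * (k % p) - p := by
    rw [Nat.mul_mod, Nat.mod_eq_of_lt (show 2 < p by omega), Nat.mod_eq_sub_mod (by omega),
      Nat.mod_eq_of_lt (by omega)]
  omega

lemma sum_range_mul_add_one {M : Type*} [AddCommMonoid M] (f : ℕ → M) {p : ℕ} (hp : 0 < p)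
    (n : ℕ) : ∑ k ∈ range (n * p + 1), f k =
      ∑ k ∈ range (n + 1), f (k * p) + ∑ k ∈ range (n * p + 1) with ¬ p ∣ k, f k := by
  rw [← sum_filter_add_sum_filter_not (range (n * p + 1)) (fun k => p ∣ k) f]
  congr 1
  symm
  refine sum_bij' (fun k _ => k * p) (fun k _ => k / p) ?_ ?_ ?_ ?_ ?_
  · intro k hk
    simp only [mem_filter, mem_range] at hk ⊢
    exact ⟨by have := Nat.mul_le_mul_right p (show k ≤ n by omega); omega, dvd_mul_left _ _⟩
  · intro k hk
    simp only [mem_filter, mem_range] at hk ⊢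
    have := Nat.div_le_of_le_mul (show k ≤ p * n by rw [mul_comm]; omega)
    omega
  · intro k _
    exact Nat.mul_div_cancel _ hp
  · intro k hk
    exact Nat.div_mul_cancel (mem_filter.mp hk).2
  · intro k _
    rfl

lemma prime_pow_dvd_term {p r s n k : ℕ} (hp : p.Prime) (hp5 : 5 ≤ p) (hrs : 4 ≤ r + s)
    (hk : k ≤ n * p) (hpk : ¬ p ∣ k) :
    p ^ 4 ∣ ((n * p).choose k) ^ r *
      ((2 * k).choose k * (2 * (n * p) - 2 * k).choose (n * p - k)) ^ s := by
  have := Fact.mk hp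
  have h0 : 0 < k % p := Nat.pos_of_ne_zero fun h => hpk (Nat.dvd_of_mod_eq_zero h)
  have h1 : p ∣ (n * p).choose k := prime_dvd_choose_of_mod_lt (by simpa using h0)
  have h2 : p ∣ (2 * k).choose k * (2 * (n * p) - 2 * k).choose (n * p - k) := by
    rcases lt_or_ge p (2 * (k % p)) with h | h
    · exact (prime_dvd_two_mul_choose (by omega) h).mul_right _
    · refine Dvd.dvd.mul_left ?_ _
      rw [← Nat.mul_sub]
      apply prime_dvd_two_mul_choose (by omega)
      have hodd := hp.odd_of_ne_two (by omega)
      have hlt := Nat.mod_lt k hp.pos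
      have hmod : (n * p - k) % p = p - k % p := by
        have hdm := Nat.div_add_mod k p
        have hq : k / p < n := by
          by_contra! hc
          have := Nat.mul_le_mul_right p hc
          rw [mul_comm (k / p)] at this
          omega
        obtain ⟨t, rfl⟩ := Nat.exists_eq_add_of_lt hq
        have : (k / p + t + 1) * p - k = t * p + (p - k % p) := by
          have h' : (k / p + t + 1) * p = p * (k / p) + t * p + p := by ring
          omega
        rw [this, Nat.add_mod, Nat.mul_mod_left, zero_add, Nat.mod_mod, Nat.mod_eq_of_lt (by omega)]
      rw [hmod]
      obtain ⟨t, ht⟩ := hodd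
      omega
  calc p ^ 4 ∣ p ^ (r + s) := pow_dvd_pow _ hrs
    _ = p ^ r * p ^ s := pow_add _ _ _
    _ ∣ _ := mul_dvd_mul (pow_dvd_pow_of_dvd h1 _) (pow_dvd_pow_of_dvd h2 _)

theorem dombRS_supercongruence (p : ℕ) (hp : p.Prime) (hp5 : 5 ≤ p) (r s n : ℕ)
    (hr : 2 ≤ r) (hs : 0 < s) (hn : 0 < n) (hrs : 4 ≤ r + s) :
    padicNorm p
        (dombRS r s (n * p) - (dombRS r s n + (p : ℚ) ^ 3 * bernoulli (p - 3) * dombRSD r s n)) ≤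
      (p : ℚ) ^ (-(4 : ℤ)) := by
  have := Fact.mk hp
  obtain ⟨d, hd, hchoose⟩ := exists_choose_mul_mul_modEq hp hp5
  set T : ℕ → ℕ → ℤ := fun n k => (n.choose k : ℤ) ^ r *
    (((2 * k).choose k : ℤ) * ((2 * n - 2 * k).choose (n - k) : ℤ)) ^ s with hT
  set W : ℕ → ℤ := fun k => (r : ℤ) * n * k * ((n - k : ℕ) : ℤ) + 2 * s * (k : ℤ) ^ 3 +
    2 * s * ((n - k : ℕ) : ℤ) ^ 3 with hW
  set M : ℤ := ∑ k ∈ range (n + 1), T n k * W k with hM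
  have hD (m : ℕ) : dombRS r s m = ((∑ k ∈ range (m + 1), T m k : ℤ) : ℚ) := by
    simp [dombRS, hT]
  have hDD : dombRSD r s n = -(1 / 3) * (M : ℚ) := by
    simp [dombRSD, hM, hT, hW]
  have hterm : ∀ k ∈ range (n + 1), T (n * p) (k * p) ≡ T n k * (1 - (p : ℤ) ^ 3 * (d * W k))
      [ZMOD (p : ℤ) ^ 4] := by
    intro k hk
    obtain ⟨m, rfl⟩ := Nat.exists_eq_add_of_le (Nat.lt_succ_iff.mp (mem_range.mp hk))
    have e1 : 2 * (k * p) = (k + k) * p := by ring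
    have e2 : 2 * ((k + m) * p) - 2 * (k * p) = (m + m) * p := by
      rw [show 2 * ((k + m) * p) = (m + m) * p + 2 * (k * p) by ring, Nat.add_sub_cancel]
    have e3 : (k + m) * p - k * p = m * p := by rw [add_mul, Nat.add_sub_cancel_left]
    have e4 : 2 * (k + m) - 2 * k = m + m := by omega
    simp only [hT, hW, e2, e3, e4, Nat.add_sub_cancel_left]
    rw [e1, two_mul k]
    have h1 := ((hchoose k m).pow r).mul (((hchoose k k).mul (hchoose m m)).pow s)
    refine h1.trans ?_
    have q1 := one_sub_mul_pow_modEq p (d * (k * m * (k + m))) r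
    have q2 := one_sub_mul_pow_modEq p (d * (k * k * (k + k))) s
    have q3 := one_sub_mul_pow_modEq p (d * (m * m * (m + m))) s
    have q := ((q1.mul (q2.mul q3)).mul_left
      (((k + m).choose k : ℤ) ^ r * (((k + k).choose k : ℤ) * ((m + m).choose m : ℤ)) ^ s))
    refine Int.ModEq.trans ?_ (q.trans ?_)
    · unfold Int.ModEq
      congr 1
      simp only [mul_pow]
      ring
    · refine Int.ModEq.mul_left _ ?_
      generalize hu : (d * (k * m * (k + m)) : ℤ) = u
      generalize hv : (d * (k * k * (k + k)) : ℤ) = v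
      generalize hw : (d * (m * m * (m + m)) : ℤ) = w
      refine (Int.modEq_iff_dvd.mpr ⟨-(p : ℤ) ^ 2 * (r * u * (s * v) + r * u * (s * w) +
        s * v * (s * w)) + (p : ℤ) ^ 5 * (r * u * (s * v) * (s * w)), ?_⟩)
      push_cast
      subst hu hv hw
      ring
  have hmain : (p : ℤ) ^ 4 ∣ ∑ k ∈ range (n * p + 1), T (n * p) k -
      (∑ k ∈ range (n + 1), T n k - (p : ℤ) ^ 3 * d * M) := by
    rw [sum_range_mul_add_one _ hp.pos]
    have h1 : (p : ℤ) ^ 4 ∣ ∑ k ∈ range (n * p + 1) with ¬ p ∣ k, T (n * p) k := by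
      refine dvd_sum fun k hk => ?_
      simp only [mem_filter, mem_range] at hk
      have := Int.natCast_dvd_natCast.mpr
        (prime_pow_dvd_term hp hp5 hrs (Nat.lt_succ_iff.mp hk.1) hk.2)
      simpa [hT] using this
    have h2 : (p : ℤ) ^ 4 ∣ ∑ k ∈ range (n + 1), (T (n * p) (k * p) -
        T n k * (1 - (p : ℤ) ^ 3 * (d * W k))) :=
      dvd_sum fun k hk => (hterm k hk).symm.dvd
    have h3 : ∑ k ∈ range (n + 1), T n k * (1 - (p : ℤ) ^ 3 * (d * W k)) =
        ∑ k ∈ range (n + 1), T n k - (p : ℤ) ^ 3 * d * M := by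
      rw [hM, mul_sum, ← sum_sub_distrib]
      exact sum_congr rfl fun k _ => by ring
    rw [sum_sub_distrib, h3] at h2
    refine (Int.dvd_add h2 h1).trans (dvd_of_eq ?_)
    ring
  have hpq : (0 : ℚ) < p := by exact_mod_cast hp.pos
  have hnorm := (padicNorm.dvd_iff_norm_le (p := p) (n := 4)).mp (by exact_mod_cast hmain)
  have hthree : padicNorm p (3 : ℚ) = 1 := by
    have : padicNorm p ((3 : ℕ) : ℚ) = 1 := by
      rw [padicNorm.nat_eq_one_iff]
      intro h
      have := Nat.le_of_dvd (by omega) h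
      omega
    exact_mod_cast this
  have hcorr : padicNorm p ((p : ℚ) ^ 3 * (M / 3) * (3 * (d : ℚ) - bernoulli (p - 3))) ≤
      (p : ℚ) ^ (-(4 : ℤ)) := by
    have hp3 : padicNorm p ((p : ℚ) ^ 3) = (p : ℚ) ^ (-(3 : ℤ)) := by
      rw [pow_succ, pow_two, padicNorm.mul, padicNorm.mul, padicNorm.padicNorm_p_of_prime]
      rw [show (-(3 : ℤ)) = -1 + -1 + -1 by norm_num, zpow_add₀ hpq.ne', zpow_add₀ hpq.ne',
        zpow_neg_one]
    rw [padicNorm.mul, padicNorm.mul, padicNorm.div, hthree, div_one, hp3]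
    calc _ ≤ (p : ℚ) ^ (-(3 : ℤ)) * 1 * (p : ℚ) ^ (-(1 : ℤ)) := by
          gcongr
          · exact padicNorm.nonneg _
          · exact padicNorm.of_int _
      _ = _ := by rw [mul_one, ← zpow_add₀ hpq.ne']; norm_num
  rw [hD, hD, hDD]
  refine le_trans (le_of_eq ?_) ((padicNorm.sub (p := p)).trans (max_le hnorm hcorr))
  congr 1
  push_cast
  ring
end

section
/- Let $p \ge 5$ be a prime and $n$ a positive integer. Then $C^{*}_{np} \equiv C^{*}_n + p^2 \left(\frac{p}{3}\right) B_{p-2}\!\left(\frac{1}{3}\right) \mathcal{C}^{*}_n \pmod{p^3}$ (as a congruence of rational numbers, i.e. the $p$-adic valuation of the difference is at least $3$), where $\mathcal{C}^{*}_n = \frac{1}{2}\sum_{k=0}^{n-1}\binom{n}{k}^2\binom{2k}{k}(n-k)^2$ and $\left(\frac{p}{3}\right)$ denotes the Legendre symbol of $p$ modulo $3$. -/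
open Finset

/-- The Apéry-like numbers `C*ₙ`, as rational numbers. -/
def cstar (n : ℕ) : ℚ :=
  ∑ k ∈ range (n + 1), (n.choose k : ℚ) ^ 2 * ((2 * k).choose k)

/-- The coefficient `𝒞*ₙ` from the theorem. -/
def cstarC (n : ℕ) : ℚ :=
  (1 / 2) * ∑ k ∈ range n, (n.choose k : ℚ) ^ 2 * ((2 * k).choose k) * ((n - k : ℕ) : ℚ) ^ 2

open Polynomial in
lemma Polynomial.eq_C_of_derivative_eq_zero_of_natDegree_lt {K : Type*} [Field K] {p : ℕ}
    [CharP K p] {f : K[X]} (hf : f.natDegree < p) (h : derivative f = 0) : f = C (f.coeff 0) := by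
  ext i
  rcases i with _ | i
  · simp
  · rw [coeff_C_succ]
    by_cases hi : i + 1 < p
    · have h1 := congrArg (fun g => g.coeff i) h
      simp only [coeff_derivative, coeff_zero, mul_eq_zero] at h1
      refine h1.resolve_right fun h2 => ?_
      have h3 : ((i + 1 : ℕ) : K) = 0 := by exact_mod_cast h2
      rw [CharP.cast_eq_zero_iff K p] at h3
      exact absurd (Nat.le_of_dvd (by omega) h3) (by omega)
    · exact coeff_eq_zero_of_natDegree_lt (by omega)

lemma natCast_ne_zero_of_lt {K : Type*} [Field K] {p : ℕ} [CharP K p] {k : ℕ}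
    (hk : k ≠ 0) (hkp : k < p) : (k : K) ≠ 0 := by
  rw [Ne, CharP.cast_eq_zero_iff K p]
  exact fun h => absurd (Nat.le_of_dvd (by omega) h) (by omega)

lemma centralBinom_cast_eq {K : Type*} [Field K] {m : ℕ} [CharP K (2 * m + 1)] :
    ∀ {k : ℕ}, k < 2 * m + 1 → (k.centralBinom : K) = (-4) ^ k * (m.choose k : K) := by
  intro k
  induction k with
  | zero => simp
  | succ k ih =>
    intro hk
    have ih := ih (by omega)
    have hne : ((k + 1 : ℕ) : K) ≠ 0 := natCast_ne_zero_of_lt (by omega) hk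
    have h1 : ((k + 1 : ℕ) : K) * ((k + 1).centralBinom : K)
        = 2 * (2 * k + 1) * (k.centralBinom : K) := by
      exact_mod_cast congrArg (Nat.cast : ℕ → K) (Nat.succ_mul_centralBinom_succ k)
    have h2 : (m.choose (k + 1) : K) * ((k + 1 : ℕ) : K) = (m.choose k : K) * (m - k) := by
      rcases le_or_gt k m with h | h
      · have := congrArg (Nat.cast : ℕ → K) (Nat.choose_succ_right_eq m k)
        push_cast [Nat.cast_sub h] at this ⊢
        exact this
      · simp [Nat.choose_eq_zero_of_lt h, Nat.choose_eq_zero_of_lt (show m < k + 1 by omega)]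
    have h3 : (2 * m + 1 : K) = 0 := by exact_mod_cast CharP.cast_eq_zero K (2 * m + 1)
    apply mul_left_cancel₀ hne
    rw [h1, ih]
    linear_combination (-(-4) ^ (k + 1)) * h2 + (-4) ^ k * (m.choose k : K) * 2 * h3

section PolynomialIdentities

open Polynomial

variable {K : Type*} [Field K] {m : ℕ}

lemma sum_centralBinom_mul_pow [CharP K (2 * m + 1)] :
    ∑ k ∈ range (m + 1), C (k.centralBinom : K) * (X * (1 - X)) ^ k
      = (1 - 2 * X) ^ (2 * m) := by
  have h : ((1 - 2 * X) ^ (2 * m) : K[X]) = (-4 * (X * (1 - X)) + 1) ^ m := by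
    rw [pow_mul]; congr 1; ring
  rw [h, add_pow]
  refine sum_congr rfl fun k hk => ?_
  rw [mem_range] at hk
  have h4 : C ((-4 : K) ^ k) = (-4 : K[X]) ^ k := by simp [← C_ofNat]
  rw [centralBinom_cast_eq (m := m) (by omega), mul_pow (-4 : K[X]), C_mul, h4, C_eq_natCast]
  ring

variable (K m) in
/-- The truncated generating polynomial of `centralBinom k / k ^ i`, at `X * (1 - X)`. -/
noncomputable def centralBinomPolylog (i : ℕ) : K[X] :=
  ∑ k ∈ range (m + 1), C ((k.centralBinom : K) * ((k : K) ^ i)⁻¹) * (X * (1 - X)) ^ k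

variable (K) in
/-- The finite polylogarithm `∑ X ^ k / k ^ i` over `k < n`. -/
noncomputable def finitePolylog (n i : ℕ) : K[X] :=
  ∑ k ∈ range n, C (((k : K) ^ i)⁻¹) * X ^ k

lemma natDegree_centralBinomPolylog_lt (i : ℕ) :
    (centralBinomPolylog K m i).natDegree < 2 * m + 1 := by
  refine Nat.lt_succ_of_le (natDegree_sum_le_of_forall_le _ _ fun k hk => ?_)
  rw [mem_range] at hk
  have : (X * (1 - X) : K[X]).natDegree ≤ 2 := by compute_degree
  calc _ ≤ ((X * (1 - X) : K[X]) ^ k).natDegree := natDegree_C_mul_le _ _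
    _ ≤ k * (X * (1 - X) : K[X]).natDegree := natDegree_pow_le
    _ ≤ k * 2 := Nat.mul_le_mul_left _ this
    _ ≤ 2 * m := by omega

lemma natDegree_finitePolylog_lt (i : ℕ) :
    (finitePolylog K (2 * m + 1) i).natDegree < 2 * m + 1 := by
  refine Nat.lt_succ_of_le (natDegree_sum_le_of_forall_le _ _ fun k hk => ?_)
  rw [mem_range] at hk
  exact (natDegree_C_mul_X_pow_le _ _).trans (by omega)

lemma eval_zero_centralBinomPolylog {i : ℕ} (hi : i ≠ 0) :
    (centralBinomPolylog K m i).eval 0 = 0 := by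
  rw [centralBinomPolylog, eval_finsetSum]
  refine sum_eq_zero fun k _ => ?_
  rcases eq_or_ne k 0 with rfl | hk <;> simp [*]

lemma eval_zero_finitePolylog {i : ℕ} (hi : i ≠ 0) (n : ℕ) :
    (finitePolylog K n i).eval 0 = 0 := by
  rw [finitePolylog, eval_finsetSum]
  refine sum_eq_zero fun k _ => ?_
  rcases eq_or_ne k 0 with rfl | hk <;> simp [*]

lemma X_mul_derivative_finitePolylog [CharP K (2 * m + 1)] {i : ℕ} (hi : i ≠ 0) :
    X * derivative (finitePolylog K (2 * m + 1) (i + 1)) = finitePolylog K (2 * m + 1) i := by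
  rw [finitePolylog, finitePolylog, derivative_sum, mul_sum]
  refine sum_congr rfl fun k hk => ?_
  rw [mem_range] at hk
  rcases k with _ | k
  · simp [hi]
  · have hne : ((k + 1 : ℕ) : K) ≠ 0 := natCast_ne_zero_of_lt (by omega) hk
    have h : (((k + 1 : ℕ) : K) ^ (i + 1))⁻¹ * ((k + 1 : ℕ) : K) = (((k + 1 : ℕ) : K) ^ i)⁻¹ := by
      field_simp
      ring
    rw [derivative_C_mul_X_pow, h]
    simp only [Nat.add_sub_cancel]
    ring

lemma X_mul_derivative_finitePolylog_one [CharP K (2 * m + 1)] :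
    X * derivative (finitePolylog K (2 * m + 1) 1) = ∑ k ∈ range (2 * m), (X : K[X]) ^ (k + 1) := by
  rw [finitePolylog, derivative_sum, mul_sum, sum_range_succ']
  simp only [Nat.cast_zero, pow_one, inv_zero, C_0, zero_mul, derivative_zero, mul_zero, add_zero]
  refine sum_congr rfl fun k hk => ?_
  rw [mem_range] at hk
  have hne : ((k + 1 : ℕ) : K) ≠ 0 :=
    natCast_ne_zero_of_lt (p := 2 * m + 1) (by omega) (by omega)
  rw [derivative_C_mul_X_pow, inv_mul_cancel₀ hne]
  simp
  ring

lemma mul_derivative_centralBinomPolylog [CharP K (2 * m + 1)] (i : ℕ) :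
    (X * (1 - X)) * derivative (centralBinomPolylog K m (i + 1))
      = (centralBinomPolylog K m i - if i = 0 then 1 else 0) * (1 - 2 * X) := by
  rw [centralBinomPolylog, centralBinomPolylog, derivative_sum, mul_sum, sum_range_succ',
    sum_range_succ' (n := m)]
  have h0 : (C (((Nat.centralBinom 0 : ℕ) : K) * (((0 : ℕ) : K) ^ i)⁻¹) * (X * (1 - X)) ^ 0 : K[X])
      - (if i = 0 then 1 else 0) = 0 := by
    split_ifs with h <;> simp [h]
  have h1 : (X * (1 - X)) * derivative (C (((Nat.centralBinom 0 : ℕ) : K) *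
      (((0 : ℕ) : K) ^ (i + 1))⁻¹) * (X * (1 - X)) ^ 0 : K[X]) = 0 := by simp
  rw [add_sub_assoc, h0, h1, add_zero, add_zero, sum_mul]
  refine sum_congr rfl fun k hk => ?_
  rw [mem_range] at hk
  have hne : ((k + 1 : ℕ) : K) ≠ 0 :=
    natCast_ne_zero_of_lt (p := 2 * m + 1) (by omega) (by omega)
  have h : (((k + 1 : ℕ) : K) ^ (i + 1))⁻¹ * ((k + 1 : ℕ) : K) = (((k + 1 : ℕ) : K) ^ i)⁻¹ := by
    field_simp
    ring
  rw [← h, derivative_C_mul, derivative_pow, derivative_mul]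
  simp only [derivative_X, derivative_sub, derivative_one, C_mul, C_eq_natCast,
    Nat.add_sub_cancel]
  ring

lemma X_mul_one_sub_X_ne_zero : (X * (1 - X) : K[X]) ≠ 0 := by
  refine mul_ne_zero X_ne_zero fun h => ?_
  simpa using congrArg (eval 0) h

lemma centralBinomPolylog_one_eq [CharP K (2 * m + 1)] [Fact (2 * m + 1).Prime] :
    centralBinomPolylog K m 1 = 2 * finitePolylog K (2 * m + 1) 1 := by
  rw [← sub_eq_zero]
  have hd : derivative (centralBinomPolylog K m 1 - 2 * finitePolylog K (2 * m + 1) 1) = 0 := by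
    apply mul_left_cancel₀ (X_mul_one_sub_X_ne_zero (K := K))
    have h0 : centralBinomPolylog K m 0 = (1 - 2 * X) ^ (2 * m) := by
      rw [← sum_centralBinom_mul_pow]
      simp [centralBinomPolylog]
    have h1 := mul_derivative_centralBinomPolylog (K := K) (m := m) 0
    rw [h0, if_pos rfl, zero_add] at h1
    have h2 : (1 - 2 * X : K[X]) ^ (2 * m + 1) = 1 - 2 * X ^ (2 * m + 1) := by
      have : (1 - 2 * X : K[X]) = 1 - X - X := by ring
      rw [this, sub_pow_char (p := 2 * m + 1), sub_pow_char (p := 2 * m + 1), one_pow]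
      ring
    have h3 := X_mul_derivative_finitePolylog_one (K := K) (m := m)
    simp only [pow_succ, ← sum_mul] at h3
    have h4 := mul_neg_geom_sum (X : K[X]) (2 * m)
    have h5 : derivative (2 : K[X]) = 0 := derivative_ofNat 2
    rw [derivative_sub, derivative_mul, h5]
    linear_combination h1 + h2 - 2 * (1 - X) * h3 - 2 * X * h4
  have hdeg : (centralBinomPolylog K m 1 - 2 * finitePolylog K (2 * m + 1) 1).natDegree
      < 2 * m + 1 := by
    refine (natDegree_sub_le _ _).trans_lt (max_lt (natDegree_centralBinomPolylog_lt 1) ?_)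
    exact (natDegree_C_mul_le (2 : K) _).trans_lt (natDegree_finitePolylog_lt 1)
  rw [eq_C_of_derivative_eq_zero_of_natDegree_lt hdeg hd, coeff_zero_eq_eval_zero]
  simp [eval_zero_centralBinomPolylog, eval_zero_finitePolylog]

lemma centralBinomPolylog_comp_one_sub_X (i : ℕ) :
    (centralBinomPolylog K m i).comp (1 - X) = centralBinomPolylog K m i := by
  simp only [centralBinomPolylog, Polynomial.sum_comp, mul_comp, pow_comp, C_comp, X_comp, sub_comp,
    one_comp]
  refine sum_congr rfl fun k _ => ?_
  ring

lemma centralBinomPolylog_two_eq [CharP K (2 * m + 1)] [Fact (2 * m + 1).Prime]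
    (h0 : ∑ k ∈ range (2 * m + 1), ((k : K) ^ 2)⁻¹ = 0) :
    centralBinomPolylog K m 2 = 2 * (finitePolylog K (2 * m + 1) 2 +
      (finitePolylog K (2 * m + 1) 2).comp (1 - X)) := by
  rw [← sub_eq_zero]
  have h5 : derivative (2 : K[X]) = 0 := derivative_ofNat 2
  have hd : derivative (centralBinomPolylog K m 2 - 2 * (finitePolylog K (2 * m + 1) 2 +
      (finitePolylog K (2 * m + 1) 2).comp (1 - X))) = 0 := by
    apply mul_left_cancel₀ (X_mul_one_sub_X_ne_zero (K := K))
    have h1 := mul_derivative_centralBinomPolylog (K := K) (m := m) 1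
    rw [if_neg one_ne_zero] at h1
    have h2 := centralBinomPolylog_one_eq (K := K) (m := m)
    have h3 := congrArg (fun f => f.comp (1 - X)) h2
    simp only [centralBinomPolylog_comp_one_sub_X, mul_comp, ofNat_comp] at h3
    have h4 := X_mul_derivative_finitePolylog (K := K) (m := m) one_ne_zero
    have h6 := congrArg (fun f => f.comp (1 - X)) h4
    simp only [mul_comp, X_comp] at h6
    rw [derivative_sub, derivative_mul, h5, derivative_add, derivative_comp]
    simp only [derivative_sub, derivative_one, derivative_X]
    linear_combination h1 - 2 * (1 - X) * h4 + 2 * X * h6 + (1 - X) * h2 - X * h3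
  have hdeg : (centralBinomPolylog K m 2 - 2 * (finitePolylog K (2 * m + 1) 2 +
      (finitePolylog K (2 * m + 1) 2).comp (1 - X))).natDegree < 2 * m + 1 := by
    have h1 : (1 - X : K[X]).natDegree ≤ 1 := by compute_degree
    refine (natDegree_sub_le _ _).trans_lt (max_lt (natDegree_centralBinomPolylog_lt 2) ?_)
    refine (natDegree_C_mul_le (2 : K) _).trans_lt ((natDegree_add_le _ _).trans_lt
      (max_lt (natDegree_finitePolylog_lt 2) ?_))
    rw [natDegree_comp]
    exact (Nat.mul_le_mul_left _ h1).trans_lt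
      (by rw [mul_one]; exact natDegree_finitePolylog_lt 2)
  rw [eq_C_of_derivative_eq_zero_of_natDegree_lt hdeg hd, coeff_zero_eq_eval_zero]
  have h1 : (finitePolylog K (2 * m + 1) 2).eval 1 = 0 := by
    rw [← h0, finitePolylog, eval_finsetSum]
    simp
  simp [eval_zero_centralBinomPolylog, eval_zero_finitePolylog, h1]

end PolynomialIdentities

lemma sum_range_natCast_zmod {M : Type*} [AddCommMonoid M] (p : ℕ) [NeZero p] (f : ZMod p → M) :
    ∑ k ∈ range p, f k = ∑ x, f x := by
  refine sum_bij' (fun k _ => (k : ZMod p)) (fun x _ => x.val) (by simp)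
    (fun x _ => mem_range.2 (ZMod.val_lt x)) (fun k hk => ZMod.val_cast_of_lt (mem_range.1 hk))
    (by simp) (by simp)

lemma sum_inv_sq_eq_zero {p : ℕ} [Fact p.Prime] (hp : 5 ≤ p) :
    ∑ k ∈ range p, ((k : ZMod p) ^ 2)⁻¹ = 0 := by
  rw [sum_range_natCast_zmod p (fun x => (x ^ 2)⁻¹),
    ← FiniteField.sum_pow_lt_card_sub_one (ZMod p) 2 (by rw [ZMod.card]; omega)]
  refine Fintype.sum_equiv (Equiv.inv (ZMod p)) _ _ fun x => ?_
  simp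

/-- `ζ ^ k + ζ ^ (-k)` for a primitive cube root of unity `ζ`. -/
def cubicTrace (k : ℕ) : ℤ := if 3 ∣ k then 2 else -1

lemma pow_add_one_sub_pow_eq {R : Type*} [CommRing R] {w : R} (hw : w ^ 2 - w + 1 = 0) :
    ∀ k : ℕ, w ^ k + (1 - w) ^ k = (-1) ^ k * (cubicTrace k : R)
  | 0 => by norm_num [cubicTrace]
  | 1 => by norm_num [cubicTrace]
  | 2 => by norm_num [cubicTrace]; linear_combination 2 * hw
  | k + 3 => by
    have ih := pow_add_one_sub_pow_eq hw k
    have hc : cubicTrace (k + 3) = cubicTrace k := by simp [cubicTrace]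
    rw [hc]
    linear_combination -ih + w ^ k * (w + 1) * hw + (1 - w) ^ k * (2 - w) * hw

lemma sum_range_odd_eq_pairs {M : Type*} [AddCommMonoid M] (f : ℕ → M) (h0 : f 0 = 0) (m : ℕ) :
    ∑ k ∈ range (2 * m + 1), f k = ∑ j ∈ range m, (f (j + 1) + f (2 * m + 1 - (j + 1))) := by
  rw [sum_range_succ', h0, add_zero, two_mul, sum_range_add, sum_add_distrib]
  congr 1
  rw [← sum_range_reflect]
  refine sum_congr rfl fun j hj => ?_
  rw [mem_range] at hj
  congr 1
  omega

lemma sum_range_odd_eq_even_add_odd {M : Type*} [AddCommMonoid M] (f : ℕ → M) (h0 : f 0 = 0)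
    (m : ℕ) : ∑ k ∈ range (2 * m + 1), f k
      = ∑ j ∈ range m, (f (2 * (j + 1)) + f (2 * m + 1 - 2 * (j + 1))) := by
  have h : ∀ n, ∑ k ∈ range (2 * n), f (k + 1)
      = ∑ j ∈ range n, f (2 * (j + 1)) + ∑ j ∈ range n, f (2 * j + 1) := by
    intro n
    induction n with
    | zero => simp
    | succ n ih =>
      rw [show 2 * (n + 1) = 2 * n + 1 + 1 by ring, sum_range_succ, sum_range_succ, ih,
        sum_range_succ, sum_range_succ]
      simp only [mul_add, mul_one, add_assoc]
      abel
  rw [sum_range_succ', h0, add_zero, h, sum_add_distrib,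
    ← sum_range_reflect (fun j => f (2 * j + 1))]
  congr 1
  refine sum_congr rfl fun j hj => ?_
  rw [mem_range] at hj
  congr 1
  omega

lemma cubicTrace_two_mul (k : ℕ) : cubicTrace (2 * k) = cubicTrace k := by
  unfold cubicTrace; split_ifs <;> omega

lemma cubicTrace_add_add {n i : ℕ} (hn : ¬ 3 ∣ n) (hi : 2 * i ≤ n) :
    cubicTrace i + cubicTrace (n - i) + cubicTrace (n - 2 * i) = 0 := by
  obtain ⟨c, rfl⟩ := Nat.exists_eq_add_of_le hi
  rw [show 2 * i + c - i = i + c by omega, Nat.add_sub_cancel_left]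
  have h : i % 3 = 0 ∨ i % 3 = 1 ∨ i % 3 = 2 := by omega
  unfold cubicTrace
  rcases h with h | h | h <;> split_ifs <;> omega

lemma two_mul_sum_neg_one_pow_mul_cubicTrace {m : ℕ} [Fact (2 * m + 1).Prime]
    (h3 : ¬ 3 ∣ 2 * m + 1) :
    2 * ∑ k ∈ range (2 * m + 1), ((k : ZMod (2 * m + 1)) ^ 2)⁻¹ * ((-1) ^ k * (cubicTrace k))
      = 3 * ∑ k ∈ range (2 * m + 1), ((k : ZMod (2 * m + 1)) ^ 2)⁻¹ * (cubicTrace k) := by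
  have hsub : ∀ i, i ≤ 2 * m + 1 → ((2 * m + 1 - i : ℕ) : ZMod (2 * m + 1)) = -i := by
    intro i hi
    rw [Nat.cast_sub hi, ZMod.natCast_self, zero_sub]
  have h4 : (4 : ZMod (2 * m + 1)) ≠ 0 := by
    have h2 : ((2 : ℕ) : ZMod (2 * m + 1)) ≠ 0 :=
      natCast_ne_zero_of_lt two_ne_zero (by have := (Fact.out : (2 * m + 1).Prime).two_le; omega)
    have : (4 : ZMod (2 * m + 1)) = ((2 : ℕ) : ZMod (2 * m + 1)) ^ 2 := by norm_num
    rw [this]; exact pow_ne_zero _ h2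
  have h4' : 4 * (((2 : ℕ) : ZMod (2 * m + 1)) ^ 2)⁻¹ = 1 := by
    rw [← mul_inv_cancel₀ h4]; norm_num
  set A := ∑ j ∈ range m, (((j + 1 : ℕ) : ZMod (2 * m + 1)) ^ 2)⁻¹ * (cubicTrace (j + 1)) with hA
  set B := ∑ j ∈ range m, (((j + 1 : ℕ) : ZMod (2 * m + 1)) ^ 2)⁻¹ *
    (cubicTrace (2 * m + 1 - 2 * (j + 1))) with hB
  have hD : ∑ k ∈ range (2 * m + 1), ((k : ZMod (2 * m + 1)) ^ 2)⁻¹ * (cubicTrace k) = -B := by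
    rw [sum_range_odd_eq_pairs _ (by simp), hB, ← sum_neg_distrib]
    refine sum_congr rfl fun j hj => ?_
    rw [mem_range] at hj
    have h : ((cubicTrace (j + 1) + cubicTrace (2 * m + 1 - (j + 1))
        + cubicTrace (2 * m + 1 - 2 * (j + 1)) : ℤ) : ZMod (2 * m + 1)) = 0 := by
      rw [cubicTrace_add_add h3 (by omega), Int.cast_zero]
    rw [Int.cast_add, Int.cast_add] at h
    rw [hsub _ (by omega), neg_sq]
    linear_combination (((j + 1 : ℕ) : ZMod (2 * m + 1)) ^ 2)⁻¹ * h
  have hD' : 4 * ∑ k ∈ range (2 * m + 1), ((k : ZMod (2 * m + 1)) ^ 2)⁻¹ * (cubicTrace k)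
      = A + B := by
    rw [sum_range_odd_eq_even_add_odd _ (by simp), hA, hB, ← sum_add_distrib, mul_sum]
    refine sum_congr rfl fun j hj => ?_
    rw [mem_range] at hj
    rw [hsub _ (by omega), neg_sq, cubicTrace_two_mul, Nat.cast_mul, mul_pow, mul_inv]
    linear_combination (((j + 1 : ℕ) : ZMod (2 * m + 1)) ^ 2)⁻¹ *
      (cubicTrace (j + 1) + cubicTrace (2 * m + 1 - 2 * (j + 1))) * h4'
  have hE : 4 * ∑ k ∈ range (2 * m + 1), ((k : ZMod (2 * m + 1)) ^ 2)⁻¹ *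
      ((-1) ^ k * (cubicTrace k)) = A - B := by
    rw [sum_range_odd_eq_even_add_odd _ (by simp), hA, hB, ← sum_sub_distrib, mul_sum]
    refine sum_congr rfl fun j hj => ?_
    rw [mem_range] at hj
    have h1 : (-1 : ZMod (2 * m + 1)) ^ (2 * (j + 1)) = 1 := Even.neg_one_pow (by simp)
    have h2 : (-1 : ZMod (2 * m + 1)) ^ (2 * m + 1 - 2 * (j + 1)) = -1 :=
      Odd.neg_one_pow ⟨m - (j + 1), by omega⟩
    rw [h1, h2, hsub _ (by omega), neg_sq, cubicTrace_two_mul, Nat.cast_mul, mul_pow, mul_inv]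
    linear_combination (((j + 1 : ℕ) : ZMod (2 * m + 1)) ^ 2)⁻¹ *
      (cubicTrace (j + 1) - cubicTrace (2 * m + 1 - 2 * (j + 1))) * h4'
  apply mul_left_cancel₀ h4
  linear_combination 2 * hE - 2 * hD' - 4 * hD

lemma sum_range_three_dvd {M : Type*} [AddCommMonoid M] (f : ℕ → M) (n : ℕ) :
    ∑ k ∈ range n, (if 3 ∣ k then f k else 0) = ∑ j ∈ range ((n + 2) / 3), f (3 * j) := by
  induction n with
  | zero => simp
  | succ n ih =>
    rw [sum_range_succ, ih]
    split_ifs with h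
    · obtain ⟨c, rfl⟩ := h
      rw [show (3 * c + 2) / 3 = c by omega, show (3 * c + 1 + 2) / 3 = c + 1 by omega,
        sum_range_succ]
    · rw [show (n + 1 + 2) / 3 = (n + 2) / 3 by omega, add_zero]

/-- The sum of `centralBinom k / k ^ 2` over `k < p`, modulo `p`. -/
lemma sum_centralBinom_div_sq {p : ℕ} [Fact p.Prime] (hp : 5 ≤ p) :
    ∑ k ∈ range p, (k.centralBinom : ZMod p) * ((k : ZMod p) ^ 2)⁻¹
      = ∑ k ∈ range ((p + 2) / 3), ((k : ZMod p) ^ 2)⁻¹ := by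
  have hprime : p.Prime := Fact.out
  have h3 : ¬ 3 ∣ p := fun h => by
    have := (Nat.prime_dvd_prime_iff_eq Nat.prime_three hprime).1 h
    omega
  have h30 : (3 : ZMod p) ≠ 0 := by
    exact_mod_cast natCast_ne_zero_of_lt (K := ZMod p) (p := p) three_ne_zero (by omega)
  obtain ⟨m, rfl⟩ := hprime.odd_of_ne_two (by omega)
  have hS : ∑ k ∈ range (2 * m + 1), (k.centralBinom : ZMod (2 * m + 1)) *
      ((k : ZMod (2 * m + 1)) ^ 2)⁻¹
      = 2 * ∑ k ∈ range (2 * m + 1), ((k : ZMod (2 * m + 1)) ^ 2)⁻¹ *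
        ((-1) ^ k * (cubicTrace k)) := by
    let K := AlgebraicClosure (ZMod (2 * m + 1))
    have : CharP K (2 * m + 1) := charP_of_injective_algebraMap
      (algebraMap (ZMod (2 * m + 1)) K).injective (2 * m + 1)
    obtain ⟨w, hw⟩ : ∃ w : K, w ^ 2 - w + 1 = 0 := by
      have hdeg : (Polynomial.X ^ 2 - Polynomial.X + 1 : Polynomial K).degree ≠ 0 := by
        have : (Polynomial.X ^ 2 - Polynomial.X + 1 : Polynomial K).degree = 2 := by
          compute_degree!
        rw [this]; norm_num
      obtain ⟨w, hw⟩ := IsAlgClosed.exists_root _ hdeg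
      exact ⟨w, by simpa using hw⟩
    apply (algebraMap (ZMod (2 * m + 1)) K).injective
    have h0 := congrArg (algebraMap (ZMod (2 * m + 1)) K) (sum_inv_sq_eq_zero hp)
    simp only [map_sum, map_inv₀, map_pow, map_natCast, map_zero] at h0
    have h := congrArg (Polynomial.eval w) (centralBinomPolylog_two_eq h0)
    have hw1 : w * (1 - w) = 1 := by linear_combination -hw
    simp only [centralBinomPolylog, finitePolylog, Polynomial.eval_mul, Polynomial.eval_add,
      Polynomial.eval_comp, Polynomial.eval_finsetSum, Polynomial.eval_pow, Polynomial.eval_C,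
      Polynomial.eval_X, Polynomial.eval_sub, Polynomial.eval_one, Polynomial.eval_ofNat, hw1,
      one_pow, mul_one, ← sum_add_distrib, ← mul_add, pow_add_one_sub_pow_eq hw] at h
    simp only [map_sum, map_inv₀, map_pow, map_natCast, map_mul, map_ofNat, map_neg, map_one,
      map_intCast]
    rw [← h]
    symm
    refine sum_subset (range_subset_range.2 (by omega)) fun k hk hk' => ?_
    rw [mem_range] at hk hk'
    rw [centralBinom_cast_eq hk, Nat.choose_eq_zero_of_lt (by omega)]
    simp
  have hT := sum_range_three_dvd (fun k => ((k : ZMod (2 * m + 1)) ^ 2)⁻¹) (2 * m + 1)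
  have hD : ∑ k ∈ range (2 * m + 1), ((k : ZMod (2 * m + 1)) ^ 2)⁻¹ * (cubicTrace k)
      = 3 * ∑ k ∈ range (2 * m + 1), (if 3 ∣ k then ((k : ZMod (2 * m + 1)) ^ 2)⁻¹ else 0) := by
    refine Eq.trans ?_ ((congrArg (_ - ·) (sum_inv_sq_eq_zero hp)).trans (sub_zero _))
    rw [mul_sum, ← sum_sub_distrib]
    refine sum_congr rfl fun k _ => ?_
    rw [cubicTrace]
    split_ifs <;> push_cast <;> ring
  rw [hS, two_mul_sum_neg_one_pow_mul_cubicTrace h3, hD, hT, mul_sum, mul_sum]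
  refine sum_congr rfl fun k _ => ?_
  rw [Nat.cast_mul, mul_pow, mul_inv]
  push_cast
  field_simp

lemma PadicInt.norm_bernoulli_le_one {p : ℕ} [Fact p.Prime] (n : ℕ) (hn : n + 1 < p) :
    ‖((bernoulli n : ℚ) : ℚ_[p])‖ ≤ 1 := by
  induction n using Nat.strong_induction_on with
  | _ n ih =>
    rcases Nat.eq_zero_or_pos n with rfl | hpos
    · simp
    have h := sum_bernoulli (n + 1)
    rw [if_neg (by omega), sum_range_succ, Nat.choose_succ_self_right] at h
    have h1 : (((n + 1 : ℕ) : ℚ) : ℚ_[p]) * ((bernoulli n : ℚ) : ℚ_[p])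
        = -∑ k ∈ range n, ((n + 1).choose k : ℚ_[p]) * ((bernoulli k : ℚ) : ℚ_[p]) := by
      have := congrArg (Rat.cast : ℚ → ℚ_[p]) (eq_neg_of_add_eq_zero_right h)
      push_cast at this ⊢
      exact this
    have h2 : ∑ k ∈ range n, ((n + 1).choose k : ℚ_[p]) * ((bernoulli k : ℚ) : ℚ_[p])
        ∈ PadicInt.subring p :=
      sum_mem fun k hk => mul_mem (natCast_mem _ _)
        (ih k (mem_range.1 hk) (by have := mem_range.1 hk; omega))
    have h3 : ‖((n + 1 : ℕ) : ℚ_[p])‖ = 1 := by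
      rw [Padic.norm_natCast_eq_one_iff, Nat.Prime.coprime_iff_not_dvd Fact.out]
      exact fun h => absurd (Nat.le_of_dvd (by omega) h) (by omega)
    have h4 := congrArg norm h1
    rw [Rat.cast_natCast, norm_mul, h3, one_mul, norm_neg] at h4
    exact h4 ▸ h2

lemma ZMod.inv_sq_eq_pow {p : ℕ} [Fact p.Prime] (hp : 5 ≤ p) (x : ZMod p) :
    (x ^ 2)⁻¹ = x ^ (p - 3) := by
  rcases eq_or_ne x 0 with rfl | hx
  · rw [zero_pow (by omega), zero_pow (by omega), inv_zero]
  · apply inv_eq_of_mul_eq_one_right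
    rw [← pow_add, show 2 + (p - 3) = p - 1 by omega, ZMod.pow_card_sub_one_eq_one hx]

lemma exists_padicInt_bernoulli_eval_one_third {p : ℕ} [Fact p.Prime] (hp : 5 ≤ p) :
    ∃ b : ℤ_[p], (b : ℚ_[p]) = (((Polynomial.bernoulli (p - 2)).eval (1 / 3 : ℚ) : ℚ) : ℚ_[p]) ∧
      2 * ∑ k ∈ range ((p + 2) / 3), ((k : ZMod p) ^ 2)⁻¹
        = (legendreSym 3 p : ZMod p) * PadicInt.toZMod b := by
  have hprime : p.Prime := Fact.out
  have h3 : ¬ 3 ∣ p := fun h => by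
    have := (Nat.prime_dvd_prime_iff_eq Nat.prime_three hprime).1 h
    omega
  have hodd : Odd (p - 2) := by
    obtain ⟨m, rfl⟩ := hprime.odd_of_ne_two (by omega)
    exact ⟨m - 1, by omega⟩
  obtain ⟨P, hP⟩ : ∃ P : Polynomial ℤ_[p], P.map (algebraMap ℤ_[p] ℚ_[p])
      = (Polynomial.bernoulli (p - 2)).map (algebraMap ℚ ℚ_[p]) := by
    rw [← Polynomial.mem_lifts, Polynomial.lifts_iff_coeff_lifts]
    intro i
    rw [Polynomial.coeff_map, Polynomial.coeff_bernoulli]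
    split_ifs with h
    · obtain ⟨b, hb⟩ : ∃ b : ℤ_[p], (b : ℚ_[p]) = ((bernoulli (p - 2 - i) : ℚ) : ℚ_[p]) :=
        ⟨⟨_, PadicInt.norm_bernoulli_le_one _ (by omega)⟩, rfl⟩
      refine ⟨b * ((p - 2).choose i : ℕ), ?_⟩
      rw [map_mul, map_natCast, map_mul, map_natCast, PadicInt.algebraMap_apply, hb]
      rfl
    · exact ⟨0, by simp⟩
  obtain ⟨t, ht⟩ : ∃ t : ℤ_[p], 3 * t = 1 := by
    have : IsUnit ((3 : ℕ) : ℤ_[p]) := by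
      rw [PadicInt.isUnit_iff, PadicInt.norm_natCast_eq_one_iff,
        Nat.Prime.coprime_iff_not_dvd hprime]
      exact fun h => absurd (Nat.le_of_dvd (by omega) h) (by omega)
    obtain ⟨t, ht⟩ := this.exists_right_inv
    exact ⟨t, by exact_mod_cast ht⟩
  have heval : ∀ (x : ℤ_[p]) (q : ℚ), (x : ℚ_[p]) = (q : ℚ_[p]) →
      ((P.eval x : ℤ_[p]) : ℚ_[p]) = (((Polynomial.bernoulli (p - 2)).eval q : ℚ) : ℚ_[p]) := by
    intro x q hx
    have h1 : ((P.eval x : ℤ_[p]) : ℚ_[p])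
        = (P.map (algebraMap ℤ_[p] ℚ_[p])).eval (x : ℚ_[p]) :=
      (Polynomial.eval_map_apply (algebraMap ℤ_[p] ℚ_[p]) x).symm
    rw [h1, hP, hx]
    exact Polynomial.eval_map_apply (algebraMap ℚ ℚ_[p]) q
  have ht' : (t : ℚ_[p]) = ((1 / 3 : ℚ) : ℚ_[p]) := by
    have h : (3 : ℚ_[p]) * t = 1 := by exact_mod_cast congrArg (Subtype.val) ht
    push_cast
    rw [eq_div_iff (by norm_num), mul_comm]
    exact h
  refine ⟨P.eval t, heval t _ ht', ?_⟩
  set N := (p + 2) / 3 with hN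
  have hsum : ((p - 2 : ℕ) : ℤ_[p]) * ∑ k ∈ range N, (k : ℤ_[p]) ^ (p - 3) = P.eval (N : ℤ_[p]) := by
    have h := Polynomial.sum_range_pow_eq_bernoulli_sub N (p - 3)
    rw [show (p - 3).succ = p - 2 by omega, bernoulli_eq_zero_of_odd hodd (by omega), sub_zero] at h
    apply Subtype.val_injective
    rw [heval N N (by simp), ← h, show p - 2 = p - 3 + 1 by omega]
    rw [← PadicInt.algebraMap_apply]
    simp
  have hsum' : -2 * ∑ k ∈ range N, ((k : ZMod p) ^ 2)⁻¹ = PadicInt.toZMod (P.eval (N : ℤ_[p])) := by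
    rw [← hsum]
    rw [map_mul, map_natCast, Nat.cast_sub (show 2 ≤ p by omega), ZMod.natCast_self]
    simp only [map_sum, map_pow, map_natCast, ZMod.inv_sq_eq_pow hp]
    push_cast
    ring
  have hcongr : ∀ x y : ℤ_[p], PadicInt.toZMod x = PadicInt.toZMod y →
      PadicInt.toZMod (P.eval x) = PadicInt.toZMod (P.eval y) := by
    intro x y h
    rw [← sub_eq_zero, ← map_sub]
    obtain ⟨c, hc⟩ := Polynomial.sub_dvd_eval_sub x y P
    rw [hc, map_mul, map_sub, h, sub_self, zero_mul]
  have h30 : (3 : ZMod p) ≠ 0 := by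
    exact_mod_cast natCast_ne_zero_of_lt (K := ZMod p) (p := p) three_ne_zero (by omega)
  have hmt : 3 * PadicInt.toZMod t = 1 := by
    simpa only [map_mul, map_ofNat, map_one] using congrArg PadicInt.toZMod ht
  have hleg : legendreSym 3 p = legendreSym 3 ((p % 3 : ℕ) : ℤ) := by
    rw [legendreSym.mod]; norm_cast
  rcases (by omega : p % 3 = 1 ∨ p % 3 = 2) with h | h
  · have hNt : PadicInt.toZMod (N : ℤ_[p]) = PadicInt.toZMod (1 - t) := by
      apply mul_left_cancel₀ h30
      have : ((3 * N : ℕ) : ZMod p) = ((p + 2 : ℕ) : ZMod p) := congrArg _ (by omega)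
      push_cast at this
      rw [ZMod.natCast_self] at this
      rw [map_natCast, map_sub, map_one]
      linear_combination this + hmt
    have hneg : P.eval (1 - t) = -P.eval t := by
      apply Subtype.val_injective
      rw [heval (1 - t) (1 - 1 / 3) (by push_cast [ht']; ring), Polynomial.bernoulli_eval_one_sub,
        hodd.neg_one_pow, neg_one_mul, Rat.cast_neg, ← heval t _ ht']
      rfl
    have hl : legendreSym 3 p = 1 := by rw [hleg, h]; decide
    rw [hcongr _ _ hNt, hneg, map_neg] at hsum'
    rw [hl]
    push_cast
    linear_combination -hsum'
  · have hNt : PadicInt.toZMod (N : ℤ_[p]) = PadicInt.toZMod t := by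
      apply mul_left_cancel₀ h30
      have : ((3 * N : ℕ) : ZMod p) = ((p + 1 : ℕ) : ZMod p) := congrArg _ (by omega)
      push_cast at this
      rw [ZMod.natCast_self] at this
      rw [map_natCast]
      linear_combination this - hmt
    have hl : legendreSym 3 p = -1 := by rw [hleg, h]; decide
    rw [hcongr _ _ hNt] at hsum'
    rw [hl]
    push_cast
    linear_combination -hsum'

lemma choose_prime_sub_one_cast {p : ℕ} [Fact p.Prime] {s : ℕ} (hs : s < p) :
    ((p - 1).choose s : ZMod p) = (-1) ^ s := by
  have hprime : p.Prime := Fact.out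
  induction s with
  | zero => simp
  | succ s ih =>
    have h1 : p.choose (s + 1) = (p - 1).choose s + (p - 1).choose (s + 1) := by
      conv_lhs => rw [← Nat.sub_add_cancel hprime.one_le]
      exact Nat.choose_succ_succ _ _
    have h2 : (p.choose (s + 1) : ZMod p) = 0 :=
      (ZMod.natCast_eq_zero_iff _ _).2 (hprime.dvd_choose_self (by omega) hs)
    rw [h1, Nat.cast_add, ih (by omega)] at h2
    linear_combination h2

lemma exists_choose_mul_add_eq {p : ℕ} [Fact p.Prime] (n j : ℕ) {r : ℕ} (hr0 : 0 < r)
    (hr : r < p) : ∃ u : ℕ, (n * p).choose (j * p + r) = p * u ∧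
      (u : ZMod p) = -(((n * (n - 1).choose j : ℕ) : ZMod p) * (-1) ^ r * (r : ZMod p)⁻¹) := by
  have hprime : p.Prime := Fact.out
  rcases n with _ | n
  · exact ⟨0, by rw [zero_mul, Nat.choose_eq_zero_of_lt (by omega), mul_zero], by simp⟩
  obtain ⟨s, rfl⟩ := Nat.exists_eq_succ_of_ne_zero hr0.ne'
  have h := Nat.add_one_mul_choose_eq (n * p + (p - 1)) (j * p + s)
  rw [show n * p + (p - 1) + 1 = (n + 1) * p by rw [add_mul]; omega] at h
  have hdvd : p ∣ ((n + 1) * p).choose (j * p + s + 1) := by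
    have hd : p ∣ ((n + 1) * p).choose (j * p + s + 1) * (j * p + s + 1) :=
      ⟨(n + 1) * (n * p + (p - 1)).choose (j * p + s), by rw [← h]; ring⟩
    refine (hprime.dvd_mul.1 hd).resolve_right ?_
    rw [add_assoc, Nat.dvd_add_right (dvd_mul_left p j)]
    exact fun h => absurd (Nat.le_of_dvd (by omega) h) (by omega)
  obtain ⟨u, hu⟩ := hdvd
  refine ⟨u, hu, ?_⟩
  rw [hu] at h
  have h1 : (n + 1) * (n * p + (p - 1)).choose (j * p + s) = u * (j * p + s + 1) := by
    apply Nat.eq_of_mul_eq_mul_left hprime.pos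
    rw [← mul_assoc, ← mul_assoc, ← h]; ring
  have h2 : ((n * p + (p - 1)).choose (j * p + s) : ZMod p) = (-1) ^ s * n.choose j := by
    have := (ZMod.natCast_eq_natCast_iff _ _ _).2
      (Choose.choose_modEq_choose_mod_mul_choose_div_nat (p := p)
        (n := n * p + (p - 1)) (k := j * p + s))
    rw [this, Nat.mul_add_mod_self_right, Nat.mul_add_mod_self_right, Nat.mod_eq_of_lt (by omega),
      Nat.mod_eq_of_lt (by omega), mul_comm n, mul_comm j, Nat.mul_add_div hprime.pos,
      Nat.mul_add_div hprime.pos, Nat.div_eq_of_lt (by omega), Nat.div_eq_of_lt (by omega),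
      Nat.cast_mul, choose_prime_sub_one_cast (by omega)]
    rfl
  have h3 := congrArg (Nat.cast : ℕ → ZMod p) h1
  have hne : ((s + 1 : ℕ) : ZMod p) ≠ 0 := natCast_ne_zero_of_lt (by omega) hr
  push_cast at h3 hne ⊢
  rw [h2, ZMod.natCast_self] at h3
  rw [Nat.succ_eq_add_one, pow_succ]
  field_simp
  linear_combination -h3

lemma pow_three_dvd_sum {ι : Type*} {p : ℕ} (s : Finset ι) (f g : ι → ℕ)
    (hf : ∀ i ∈ s, f i = p ^ 2 * g i) (hg : ∑ i ∈ s, (g i : ZMod p) = 0) :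
    p ^ 3 ∣ ∑ i ∈ s, f i := by
  rw [sum_congr rfl hf, ← mul_sum, pow_succ]
  refine mul_dvd_mul_left _ ((ZMod.natCast_eq_zero_iff _ _).1 ?_)
  rw [Nat.cast_sum, hg]

/-- The Jacobsthal–Kazandzidis congruence. -/
lemma choose_mul_prime_modEq {p : ℕ} [Fact p.Prime] (hp : 5 ≤ p) (n j : ℕ) :
    (n * p).choose (j * p) ≡ n.choose j [MOD p ^ 3] := by
  have hprime : p.Prime := Fact.out
  induction n generalizing j with
  | zero =>
    rcases j with _ | j
    · simp [Nat.ModEq]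
    · rw [zero_mul, Nat.choose_eq_zero_of_lt (Nat.mul_pos (by omega) hprime.pos),
        Nat.choose_eq_zero_of_lt (by omega)]
  | succ n ih =>
    rcases j with _ | j
    · simp [Nat.ModEq]
    obtain ⟨q, rfl⟩ := Nat.exists_eq_add_of_le' hprime.one_le
    have hexp : ((n + 1) * (q + 1)).choose ((j + 1) * (q + 1))
        = ∑ i ∈ range q, (q + 1).choose (i + 1) * (n * (q + 1)).choose (j * (q + 1) + (q - i))
          + ((n * (q + 1)).choose (j * (q + 1)) + (n * (q + 1)).choose ((j + 1) * (q + 1))) := by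
      rw [add_mul, one_mul, add_comm, Nat.add_choose_eq,
        Nat.sum_antidiagonal_eq_sum_range_succ_mk]
      have hsub : range (q + 2) ⊆ range ((j + 1) * (q + 1)).succ :=
        range_subset_range.2 (by rw [add_mul]; omega)
      rw [← sum_subset hsub, sum_range_succ, sum_range_succ']
      · have hq : (j + 1) * (q + 1) - (q + 1) = j * (q + 1) := by
          rw [add_mul, one_mul, Nat.add_sub_cancel]
        simp only [Nat.choose_self, Nat.choose_zero_right, one_mul, Nat.sub_zero, hq]
        rw [add_assoc, add_comm (Nat.choose _ ((j + 1) * (q + 1)))]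
        congr 1
        refine sum_congr rfl fun i hi => ?_
        rw [mem_range] at hi
        rw [show (j + 1) * (q + 1) - (i + 1) = j * (q + 1) + (q - i) by rw [add_mul]; omega]
      · intro i _ hi
        rw [mem_range] at hi
        simp [Nat.choose_eq_zero_of_lt (show q + 1 < i by omega)]
    have hv : ∀ i ∈ range q, ∃ v : ℕ, (q + 1).choose (i + 1) = (q + 1) * v ∧
        (v : ZMod (q + 1)) = -((-1) ^ (i + 1) * ((i + 1 : ℕ) : ZMod (q + 1))⁻¹) := by
      intro i hi
      rw [mem_range] at hi
      simpa using exists_choose_mul_add_eq (p := q + 1) 1 0 (r := i + 1) (by omega) (by omega)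
    have hu : ∀ i ∈ range q, ∃ u : ℕ,
        (n * (q + 1)).choose (j * (q + 1) + (q - i)) = (q + 1) * u ∧
        (u : ZMod (q + 1)) = -(((n * (n - 1).choose j : ℕ) : ZMod (q + 1)) * (-1) ^ (q - i)
          * ((q - i : ℕ) : ZMod (q + 1))⁻¹) := by
      intro i hi
      rw [mem_range] at hi
      exact exists_choose_mul_add_eq n j (by omega) (by omega)
    choose! v hv using hv
    choose! u hu using hu
    have hdvd : (q + 1) ^ 3 ∣ ∑ i ∈ range q, (q + 1).choose (i + 1) *
        (n * (q + 1)).choose (j * (q + 1) + (q - i)) := by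
      refine pow_three_dvd_sum _ _ (fun i => v i * u i) (fun i hi => ?_) ?_
      · rw [(hv i hi).1, (hu i hi).1]; ring
      · have h0 := sum_inv_sq_eq_zero (p := q + 1) hp
        rw [sum_range_succ'] at h0
        have h1 : ∀ i ∈ range q, ((v i * u i : ℕ) : ZMod (q + 1))
            = -((n * (n - 1).choose j : ℕ) : ZMod (q + 1)) * (-1) ^ (q + 1) *
              (((i + 1 : ℕ) : ZMod (q + 1)) ^ 2)⁻¹ := by
          intro i hi
          rw [Nat.cast_mul, (hv i hi).2, (hu i hi).2]
          rw [mem_range] at hi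
          have h2 : ((q - i : ℕ) : ZMod (q + 1)) = -((i + 1 : ℕ) : ZMod (q + 1)) := by
            rw [show q - i = q + 1 - (i + 1) by omega, Nat.cast_sub (by omega), ZMod.natCast_self,
              zero_sub]
          have h3 : (-1 : ZMod (q + 1)) ^ (q + 1) = (-1) ^ (i + 1) * (-1) ^ (q - i) := by
            rw [← pow_add]; congr 1; omega
          rw [h2, inv_neg, h3]
          ring
        rw [sum_congr rfl h1, ← mul_sum]
        simp only [Nat.cast_zero, ne_eq, OfNat.ofNat_ne_zero, not_false_eq_true, zero_pow, inv_zero,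
          add_zero] at h0
        rw [h0, mul_zero]
    rw [hexp, Nat.choose_succ_succ]
    simpa using ((Nat.modEq_zero_iff_dvd.2 hdvd).add ((ih j).add (ih (j + 1))))

lemma centralBinom_mul_add_cast {p : ℕ} [Fact p.Prime] (j : ℕ) {r : ℕ} (hr : r < p) :
    ((j * p + r).centralBinom : ZMod p) = j.centralBinom * r.centralBinom := by
  have hprime : p.Prime := Fact.out
  have key : ∀ i : ℕ, ((i * p + r).centralBinom : ZMod p)
      = if 2 * r < p then (i.centralBinom : ZMod p) * r.centralBinom else 0 := by
    intro i
    have h := (ZMod.natCast_eq_natCast_iff _ _ _).2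
      (Choose.choose_modEq_choose_mod_mul_choose_div_nat (p := p)
        (n := 2 * (i * p + r)) (k := i * p + r))
    rw [Nat.mul_add_mod_self_right i p r, Nat.mod_eq_of_lt hr, mul_comm i p,
      Nat.mul_add_div hprime.pos, Nat.div_eq_of_lt hr, add_zero] at h
    rw [mul_comm i p, Nat.centralBinom, h]
    split_ifs with h2
    · rw [show 2 * (p * i + r) = p * (2 * i) + 2 * r by ring, Nat.mul_add_mod, Nat.mod_eq_of_lt h2,
        Nat.mul_add_div hprime.pos, Nat.div_eq_of_lt h2, add_zero, Nat.centralBinom,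
        Nat.centralBinom]
      push_cast
      ring
    · have h3 : 2 * (p * i + r) = p * (2 * i + 1) + (2 * r - p) := by
        rw [mul_add, mul_add, mul_left_comm]; omega
      rw [h3,
        Nat.mul_add_mod, Nat.mod_eq_of_lt (by omega), Nat.choose_eq_zero_of_lt (by omega), zero_mul,
        Nat.cast_zero]
  have h0 := key 0
  rw [zero_mul, zero_add, Nat.centralBinom_zero] at h0
  rw [key j]
  split_ifs at h0 ⊢ with h
  · rfl
  · rw [h0, mul_zero]

lemma sum_range_mul_eq {M : Type*} [AddCommMonoid M] (f : ℕ → M) (n p : ℕ) :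
    ∑ k ∈ range (n * p), f k = ∑ j ∈ range n, ∑ r ∈ range p, f (j * p + r) := by
  induction n with
  | zero => simp
  | succ n ih => rw [add_mul, one_mul, sum_range_add, ih, sum_range_succ]

lemma sum_block_choose_sq_mul_centralBinom {p : ℕ} [Fact p.Prime] (hp : 5 ≤ p) (n j : ℕ) :
    ∃ M : ℕ, ((∑ r ∈ range p, (n * p).choose (j * p + r) ^ 2 * (j * p + r).centralBinom : ℕ) :
        ZMod (p ^ 3)) = (n.choose j ^ 2 * j.centralBinom + p ^ 2 * M : ℕ) ∧
      (M : ZMod p) = (n.choose j ^ 2 * j.centralBinom * (n - j) ^ 2 : ℕ) *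
        ∑ r ∈ range p, (r.centralBinom : ZMod p) * ((r : ZMod p) ^ 2)⁻¹ := by
  have hp0 : 0 ∈ range p := mem_range.2 (by omega)
  have hu : ∀ r ∈ (range p).erase 0, ∃ u : ℕ, (n * p).choose (j * p + r) = p * u ∧
      (u : ZMod p) = -(((n * (n - 1).choose j : ℕ) : ZMod p) * (-1) ^ r * (r : ZMod p)⁻¹) := by
    intro r hr
    rw [mem_erase, mem_range] at hr
    exact exists_choose_mul_add_eq n j (Nat.pos_of_ne_zero hr.1) hr.2
  choose! u hu using hu
  refine ⟨∑ r ∈ (range p).erase 0, u r ^ 2 * (j * p + r).centralBinom, ?_, ?_⟩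
  · rw [← add_sum_erase _ _ hp0, Nat.cast_add, Nat.cast_add, add_zero]
    congr 1
    · have h1 := (ZMod.natCast_eq_natCast_iff _ _ _).2 (choose_mul_prime_modEq hp n j)
      have h2 := (ZMod.natCast_eq_natCast_iff _ _ _).2 (choose_mul_prime_modEq hp (2 * j) j)
      rw [Nat.centralBinom, Nat.centralBinom, ← mul_assoc, Nat.cast_mul, Nat.cast_mul,
        Nat.cast_pow, Nat.cast_pow, h1, h2]
    · rw [mul_sum]
      congr 1
      refine sum_congr rfl fun r hr => ?_
      rw [(hu r hr).1]
      ring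
  · have hn : n * (n - 1).choose j = n.choose j * (n - j) := by
      rcases n with _ | n
      · simp
      · rw [Nat.add_sub_cancel, mul_comm]
        exact Nat.choose_mul_succ_eq n j
    rw [← add_sum_erase _ _ hp0, Nat.cast_zero, zero_pow two_ne_zero, inv_zero, mul_zero, zero_add,
      Nat.cast_sum, mul_sum]
    refine sum_congr rfl fun r hr => ?_
    have hr' := mem_range.1 (mem_of_mem_erase hr)
    have hsq : ((-1 : ZMod p) ^ r) ^ 2 = 1 := by rw [← pow_mul, mul_comm, pow_mul]; simp
    rw [Nat.cast_mul, Nat.cast_pow, (hu r hr).2, hn, centralBinom_mul_add_cast j hr']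
    push_cast
    rw [neg_sq, mul_pow, mul_pow, hsq, inv_pow]
    ring

lemma sum_choose_mul_prime_sq_mul_centralBinom {p : ℕ} [Fact p.Prime] (hp : 5 ≤ p) (n : ℕ) :
    ∃ M : ℕ, ((∑ k ∈ range (n * p + 1), (n * p).choose k ^ 2 * k.centralBinom : ℕ) :
        ZMod (p ^ 3)) = (∑ k ∈ range (n + 1), n.choose k ^ 2 * k.centralBinom + p ^ 2 * M : ℕ) ∧
      (M : ZMod p) = (∑ k ∈ range n, n.choose k ^ 2 * k.centralBinom * (n - k) ^ 2 : ℕ) *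
        ∑ r ∈ range p, (r.centralBinom : ZMod p) * ((r : ZMod p) ^ 2)⁻¹ := by
  choose M hM using sum_block_choose_sq_mul_centralBinom hp n
  refine ⟨∑ j ∈ range n, M j, ?_, ?_⟩
  · have h2 := (ZMod.natCast_eq_natCast_iff _ _ _).2 (choose_mul_prime_modEq hp (2 * n) n)
    rw [sum_range_succ, sum_range_succ, sum_range_mul_eq, Nat.cast_add, Nat.cast_sum,
      sum_congr rfl fun j _ => (hM j).1, ← Nat.cast_sum, sum_add_distrib, ← mul_sum,
      Nat.choose_self, Nat.choose_self, Nat.centralBinom, Nat.centralBinom, ← mul_assoc]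
    push_cast
    rw [h2]
    ring
  · rw [Nat.cast_sum, Nat.cast_sum, sum_mul]
    exact sum_congr rfl fun j _ => (hM j).2

lemma cstar_eq_natCast (n : ℕ) :
    cstar n = (∑ k ∈ range (n + 1), n.choose k ^ 2 * k.centralBinom : ℕ) := by
  simp [cstar, Nat.centralBinom]

lemma two_mul_cstarC_eq_natCast (n : ℕ) :
    2 * cstarC n = (∑ k ∈ range n, n.choose k ^ 2 * k.centralBinom * (n - k) ^ 2 : ℕ) := by
  rw [cstarC, ← mul_assoc]
  simp [Nat.centralBinom]

lemma PadicInt.dvd_of_toZMod_eq_zero {p : ℕ} [Fact p.Prime] {x : ℤ_[p]}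
    (hx : PadicInt.toZMod x = 0) : (p : ℤ_[p]) ∣ x := by
  rw [← Ideal.mem_span_singleton, ← PadicInt.maximalIdeal_eq_span_p, ← PadicInt.ker_toZMod]
  exact hx

theorem cstar_supercongruence (p : ℕ) (hp : p.Prime) (hp5 : 5 ≤ p) (n : ℕ) (hn : 0 < n) :
    padicNorm p
        (cstar (n * p) -
          (cstar n +
            (p : ℚ) ^ 2 * (legendreSym 3 p : ℚ) *
              (Polynomial.bernoulli (p - 2)).eval (1 / 3 : ℚ) * cstarC n)) ≤
      (p : ℚ) ^ (-(3 : ℤ)) := by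
  have : Fact p.Prime := ⟨hp⟩
  obtain ⟨M, hM, hM'⟩ := sum_choose_mul_prime_sq_mul_centralBinom hp5 n
  obtain ⟨b, hb, hb'⟩ := exists_padicInt_bernoulli_eval_one_third hp5
  rw [sum_centralBinom_div_sq hp5] at hM'
  generalize (Polynomial.bernoulli (p - 2)).eval (1 / 3 : ℚ) = β at hb ⊢
  have h1 := cstar_eq_natCast n
  have h2 := cstar_eq_natCast (n * p)
  have h3 := two_mul_cstarC_eq_natCast n
  set a := ∑ k ∈ range (n + 1), n.choose k ^ 2 * k.centralBinom
  set c := ∑ k ∈ range (n * p + 1), (n * p).choose k ^ 2 * k.centralBinom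
  set e := ∑ k ∈ range n, n.choose k ^ 2 * k.centralBinom * (n - k) ^ 2
  obtain ⟨d, hd⟩ : (p : ℤ_[p]) ∣ 2 * M - (legendreSym 3 p : ℤ_[p]) * b * e := by
    apply PadicInt.dvd_of_toZMod_eq_zero
    simp only [map_sub, map_mul, map_ofNat, map_natCast, map_intCast, hM']
    linear_combination (e : ZMod p) * hb'
  obtain ⟨z, hz⟩ := ((ZMod.natCast_eq_natCast_iff _ _ _).1 hM).symm.dvd
  have hz' := congrArg (Int.cast : ℤ → ℤ_[p]) hz
  push_cast at hz'
  set X := 2 * ((c : ℤ_[p]) - a) - p ^ 2 * (legendreSym 3 p : ℤ_[p]) * b * e with hX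
  have hXd : X = p ^ 3 * (2 * z + d) := by
    linear_combination 2 * hz' + (p : ℤ_[p]) ^ 2 * hd
  have hXn : ‖X‖ ≤ (p : ℝ) ^ (-(3 : ℤ)) :=
    (PadicInt.norm_le_pow_iff_mem_span_pow X 3).2 (Ideal.mem_span_singleton.2 ⟨_, hXd⟩)
  have h2n : ‖(2 : ℚ_[p])‖ = 1 := by
    have : ‖((2 : ℕ) : ℚ_[p])‖ = 1 := by
      rw [Padic.norm_natCast_eq_one_iff, Nat.Prime.coprime_iff_not_dvd hp]
      exact fun h => absurd (Nat.le_of_dvd (by omega) h) (by omega)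
    exact_mod_cast this
  set Y := cstar (n * p) - (cstar n + (p : ℚ) ^ 2 * (legendreSym 3 p : ℚ) * β *
    cstarC n) with hY
  have hXY : (X : ℚ_[p]) = 2 * (Y : ℚ_[p]) := by
    have hY' : 2 * Y = 2 * ((c : ℚ) - a) - (p : ℚ) ^ 2 * (legendreSym 3 p : ℚ) * β * e := by
      rw [hY, h1, h2, ← h3]; ring
    have hY'' := congrArg (Rat.cast : ℚ → ℚ_[p]) hY'
    push_cast at hY''
    rw [hY'', ← hb, hX, ← PadicInt.algebraMap_apply, ← PadicInt.algebraMap_apply]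
    simp only [map_sub, map_mul, map_pow, map_natCast, map_intCast, map_ofNat]
  rw [PadicInt.norm_def, hXY, norm_mul, h2n, one_mul, Padic.eq_padicNorm] at hXn
  have hYn : ((padicNorm p Y : ℚ) : ℝ) ≤ ((p : ℚ) ^ (-(3 : ℤ)) : ℚ) := by
    push_cast
    exact hXn
  exact Rat.cast_le.1 hYn
end

section
/- Let $p \ge 5$ be a prime and $n, k \in \mathbb{N}$ with $n \ge k$. Then $\binom{np}{kp} \equiv \binom{n}{k}\left(1 - \frac{1}{3} n k (n-k) p^3 B_{p-3}\right) \pmod{p^4}$ (as a congruence of rational numbers, i.e. the $p$-adic valuation of the difference is at least $4$). -/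
open Finset
open Polynomial hiding bernoulli sum_bernoulli bernoulli_zero

theorem ascPochhammer_int_comp_X_add_one (p : ℕ) :
    (ascPochhammer ℤ (p + 1)).comp (X + 1) =
      ascPochhammer ℤ (p + 1) + ((p + 1 : ℕ) : ℤ[X]) * (ascPochhammer ℤ (p + 1)).divX := by
  have h0 : (ascPochhammer ℤ (p + 1)).divX * X = ascPochhammer ℤ (p + 1) := by
    have h := divX_mul_X_add (ascPochhammer ℤ (p + 1))
    rw [coeff_zero_eq_eval_zero, ascPochhammer_eval_zero] at h
    simpa using h
  have h1 := (ascPochhammer_succ_left ℤ (p + 1)).symm.trans (ascPochhammer_succ_right ℤ (p + 1))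
  apply mul_left_cancel₀ (X_ne_zero (R := ℤ))
  rw [h1]
  linear_combination (-((p + 1 : ℕ) : ℤ[X])) * h0

theorem eval_one_hasseDeriv {R : Type*} [Semiring R] (f : R[X]) (i : ℕ) :
    (hasseDeriv i f).eval 1 = ∑ j ∈ range (f.natDegree + 1), (j.choose i : R) * f.coeff j := by
  rw [hasseDeriv_apply, sum_over_range _ (by simp), eval_finsetSum]
  simp

/-- The difference equation satisfied by rising factorials, read off on coefficients. -/
theorem sum_choose_mul_coeff_ascPochhammer {p : ℕ} (hp : p ≠ 0) {i : ℕ} (hi : i ≤ p) :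
    ∑ j ∈ Ico (i + 1) (p + 1), (j.choose i : ℤ) * (ascPochhammer ℤ p).coeff j =
      p * (ascPochhammer ℤ p).coeff (i + 1) := by
  obtain ⟨q, rfl⟩ := Nat.exists_eq_succ_of_ne_zero hp
  have h := congrArg (fun f => coeff f i) (ascPochhammer_int_comp_X_add_one q)
  have h2 : (ascPochhammer ℤ (q + 1)).comp (X + 1) = taylor 1 (ascPochhammer ℤ (q + 1)) := by
    simp [taylor_apply]
  simp only [h2, taylor_coeff, eval_one_hasseDeriv, ascPochhammer_natDegree, coeff_add,
    coeff_natCast_mul, coeff_divX] at h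
  rw [range_eq_Ico, ← sum_Ico_consecutive _ (Nat.zero_le i) (by omega : i ≤ q + 1 + 1),
    sum_eq_zero, sum_eq_sum_Ico_succ_bot (by omega)] at h
  · simp only [Nat.choose_self] at h
    push_cast at h ⊢
    linarith
  · intro j hj
    rw [Nat.choose_eq_zero_of_lt (mem_Ico.1 hj).2]
    simp

theorem coeff_self_ascPochhammer (p : ℕ) : (ascPochhammer ℤ p).coeff p = 1 := by
  have h := monic_ascPochhammer ℤ p
  rwa [Monic, leadingCoeff, ascPochhammer_natDegree] at h

theorem prime_dvd_coeff_ascPochhammer {p : ℕ} (hp : p.Prime) {j : ℕ} (hj : 2 ≤ j) (hjp : j < p) :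
    (p : ℤ) ∣ (ascPochhammer ℤ p).coeff j := by
  have key : ∀ d j : ℕ, 2 ≤ j → j < p → p - j = d → (p : ℤ) ∣ (ascPochhammer ℤ p).coeff j := by
    intro d
    induction d using Nat.strong_induction_on with
    | _ d ih =>
      intro j hj hjp hd
      obtain ⟨i, rfl⟩ : ∃ i, j = i + 1 := ⟨j - 1, by omega⟩
      have h := sum_choose_mul_coeff_ascPochhammer hp.ne_zero (show i ≤ p by omega)
      rw [sum_eq_sum_Ico_succ_bot (by omega)] at h
      have hrest : (p : ℤ) ∣ ∑ j ∈ Ico (i + 1 + 1) (p + 1),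
          (j.choose i : ℤ) * (ascPochhammer ℤ p).coeff j := by
        refine dvd_sum fun j hj => ?_
        rw [mem_Ico] at hj
        rcases (show j ≤ p by omega).eq_or_lt with rfl | hlt
        · exact Dvd.dvd.mul_right
            (Int.natCast_dvd_natCast.2 (hp.dvd_choose_self (by omega) (by omega))) _
        · exact Dvd.dvd.mul_left (ih (p - j) (by omega) j (by omega) hlt rfl) _
      have hprod : (p : ℤ) ∣ ((i + 1).choose i : ℤ) * (ascPochhammer ℤ p).coeff (i + 1) :=
        (dvd_add_left hrest).1 (h ▸ dvd_mul_right _ _)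
      refine ((Nat.prime_iff_prime_int.1 hp).dvd_or_dvd hprod).resolve_left fun hdvd => ?_
      rw [Nat.choose_succ_self_right, Int.natCast_dvd_natCast] at hdvd
      exact absurd (Nat.le_of_dvd (by omega) hdvd) (by omega)
  exact key _ j hj hjp rfl

theorem sum_choose_mul_choose_mul_bernoulli {p i : ℕ} (hi : i + 2 ≤ p) :
    ∑ j ∈ Ico (i + 1) (p + 1), (j.choose i : ℚ) * (p.choose j * bernoulli (p - j)) = 0 := by
  have h := sum_bernoulli (p - i)
  rw [if_neg (by omega)] at h
  rw [← mul_zero (p.choose i : ℚ), ← h, mul_sum]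
  refine sum_nbij' (fun j => p - j) (fun m => p - m) ?_ ?_ ?_ ?_ ?_
  · intro j hj; simp only [mem_Ico, mem_range] at hj ⊢; omega
  · intro j hj; simp only [mem_Ico, mem_range] at hj ⊢; omega
  · intro j hj; simp only [mem_Ico] at hj; omega
  · intro j hj; simp only [mem_range] at hj; omega
  · intro j hj
    simp only [mem_Ico] at hj
    have h1 : p.choose j * j.choose i = p.choose i * (p - i).choose (p - j) := by
      rw [Nat.choose_mul (by omega), ← Nat.choose_symm (show j - i ≤ p - i by omega)]
      congr 2
      omega
    have h2 : (p.choose j : ℚ) * j.choose i = p.choose i * (p - i).choose (p - j) := by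
      exact_mod_cast h1
    linear_combination bernoulli (p - j) * h2

theorem padicNorm_coeff_ascPochhammer_sub_le {p : ℕ} [hp : Fact p.Prime] {j : ℕ} (hj : 2 ≤ j)
    (hjp : j ≤ p) :
    padicNorm p ((ascPochhammer ℤ p).coeff j - p.choose j * bernoulli (p - j)) ≤
      (p : ℚ) ^ (-(2 : ℤ)) := by
  have key : ∀ d j : ℕ, 2 ≤ j → j ≤ p → p - j = d →
      padicNorm p ((ascPochhammer ℤ p).coeff j - p.choose j * bernoulli (p - j)) ≤
        (p : ℚ) ^ (-(2 : ℤ)) := by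
    intro d
    induction d using Nat.strong_induction_on with
    | _ d ih =>
      intro j hj hjp hd
      rcases hjp.eq_or_lt with rfl | hlt
      · simp only [coeff_self_ascPochhammer, Nat.choose_self, Nat.sub_self, bernoulli_zero]
        simp
      obtain ⟨i, rfl⟩ : ∃ i, j = i + 1 := ⟨j - 1, by omega⟩
      have h : ∑ j ∈ Ico (i + 1) (p + 1), (j.choose i : ℚ) * (ascPochhammer ℤ p).coeff j =
          p * (ascPochhammer ℤ p).coeff (i + 1) := by
        exact_mod_cast sum_choose_mul_coeff_ascPochhammer hp.out.ne_zero (show i ≤ p by omega)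
      have hdiff : ∑ j ∈ Ico (i + 1) (p + 1), (j.choose i : ℚ) *
          ((ascPochhammer ℤ p).coeff j - p.choose j * bernoulli (p - j)) =
            p * (ascPochhammer ℤ p).coeff (i + 1) := by
        simp only [mul_sub, sum_sub_distrib]
        rw [h, sum_choose_mul_choose_mul_bernoulli (by omega), sub_zero]
      rw [sum_eq_sum_Ico_succ_bot (by omega), ← eq_sub_iff_add_eq] at hdiff
      have hright : padicNorm p (p * (ascPochhammer ℤ p).coeff (i + 1) : ℚ) ≤
          (p : ℚ) ^ (-(2 : ℤ)) := by
        have hdvd : ((p ^ 2 : ℕ) : ℤ) ∣ p * (ascPochhammer ℤ p).coeff (i + 1) := by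
          push_cast
          rw [sq]
          exact mul_dvd_mul_left _ (prime_dvd_coeff_ascPochhammer hp.out hj hlt)
        exact_mod_cast padicNorm.dvd_iff_norm_le.1 hdvd
      have hrest : padicNorm p (∑ j ∈ Ico (i + 1 + 1) (p + 1), (j.choose i : ℚ) *
          ((ascPochhammer ℤ p).coeff j - p.choose j * bernoulli (p - j))) ≤
            (p : ℚ) ^ (-(2 : ℤ)) := by
        refine padicNorm.sum_le (nonempty_Ico.2 (by omega)) fun j hj => ?_
        rw [mem_Ico] at hj
        rw [padicNorm.mul]
        exact (mul_le_of_le_one_left (padicNorm.nonneg _) (padicNorm.of_nat _)).trans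
          (ih (p - j) (by omega) j (by omega) (by omega) rfl)
      have hunit : padicNorm p ((i + 1).choose i : ℚ) = 1 := by
        rw [Nat.choose_succ_self_right, padicNorm.nat_eq_one_iff]
        exact fun hdvd => absurd (Nat.le_of_dvd (by omega) hdvd) (by omega)
      have hnorm := congrArg (padicNorm p) hdiff
      rw [padicNorm.mul, hunit, one_mul] at hnorm
      rw [hnorm]
      exact padicNorm.sub.trans (max_le hright hrest)
  exact key _ j hj hjp rfl

theorem coeff_one_ascPochhammer {p : ℕ} (hp : p ≠ 0) :
    (ascPochhammer ℤ p).coeff 1 = (p - 1).factorial := by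
  obtain ⟨q, rfl⟩ := Nat.exists_eq_succ_of_ne_zero hp
  rw [Nat.succ_eq_add_one, ascPochhammer_succ_left, coeff_X_mul, coeff_zero_eq_eval_zero, eval_comp]
  simp [ascPochhammer_eval_one]

theorem mul_eval_divX_ascPochhammer {p : ℕ} (hp : p ≠ 0) (x : ℤ) :
    x * (ascPochhammer ℤ p).divX.eval x = (ascPochhammer ℤ p).eval x := by
  conv_rhs => rw [← divX_mul_X_add (ascPochhammer ℤ p)]
  rw [coeff_zero_eq_eval_zero, ascPochhammer_eval_zero, if_neg hp]
  simp [mul_comm]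

theorem eval_neg_divX_ascPochhammer {p : ℕ} (hp : Odd p) :
    (ascPochhammer ℤ p).divX.eval (-p : ℤ) = (p - 1).factorial := by
  have hp0 : p ≠ 0 := hp.pos.ne'
  have h := mul_eval_divX_ascPochhammer hp0 (-p : ℤ)
  rw [ascPochhammer_eval_neg_eq_descPochhammer, descPochhammer_eval_eq_descFactorial,
    Nat.descFactorial_self, hp.neg_one_pow, ← Nat.mul_factorial_pred hp0] at h
  push_cast at h
  apply mul_left_cancel₀ (show (p : ℤ) ≠ 0 by exact_mod_cast hp0)
  linarith

theorem eval_divX_cubic_expansion {R : Type*} [CommSemiring R] (f : R[X]) (x : R) :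
    f.divX.eval x = f.coeff 1 + f.coeff 2 * x + f.coeff 3 * x ^ 2 + f.coeff 4 * x ^ 3 +
      f.divX.divX.divX.divX.divX.eval x * x ^ 4 := by
  have h : ∀ g : R[X], g.eval x = g.divX.eval x * x + g.coeff 0 := fun g => by
    conv_lhs => rw [← divX_mul_X_add g]
    simp
  rw [h f.divX, h f.divX.divX, h f.divX.divX.divX, h f.divX.divX.divX.divX]
  simp only [coeff_divX]
  ring

theorem eval_mul_prime_divX_ascPochhammer_modEq {p : ℕ} (hp : p.Prime) (hp5 : 5 ≤ p) {t : ℤ}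
    (ht : (ascPochhammer ℤ p).coeff 3 = p * t) (m : ℤ) :
    (ascPochhammer ℤ p).divX.eval (m * p) ≡
      (p - 1).factorial * (1 - p ^ 3 * t * (m * (m + 1))) [ZMOD p ^ 4] := by
  have := Fact.mk hp
  obtain ⟨u, hu⟩ := prime_dvd_coeff_ascPochhammer hp (j := 4) (by norm_num) (by omega)
  obtain ⟨w, hw⟩ : (p : ℤ) ∣ (p - 1).factorial + 1 := by
    rw [← ZMod.intCast_zmod_eq_zero_iff_dvd]
    push_cast
    rw [ZMod.wilsons_lemma]
    ring
  have hneg := eval_neg_divX_ascPochhammer (hp.odd_of_ne_two (by omega))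
  rw [eval_divX_cubic_expansion, coeff_one_ascPochhammer hp.ne_zero, ht, hu] at hneg
  rw [eval_divX_cubic_expansion, coeff_one_ascPochhammer hp.ne_zero, ht, hu]
  generalize eval (-(p : ℤ)) _ = Q at hneg
  generalize eval (m * (p : ℤ)) _ = Q'
  symm
  rw [Int.modEq_iff_dvd]
  refine ⟨m * (Q - u) + u * m ^ 3 + Q' * m ^ 4 + w * t * (m * (m + 1)), ?_⟩
  linear_combination (-m) * hneg + p ^ 3 * t * (m * (m + 1)) * hw

theorem prod_eval_mul_prime_modEq {p : ℕ} (hp : p.Prime) (hp5 : 5 ≤ p) {t : ℤ}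
    (ht : (ascPochhammer ℤ p).coeff 3 = p * t) (n : ℕ) :
    ∏ m ∈ range n, (ascPochhammer ℤ p).divX.eval ((m : ℤ) * p) ≡
      (p - 1).factorial ^ n * (1 - p ^ 3 * t * ∑ m ∈ range n, (m * (m + 1) : ℤ)) [ZMOD p ^ 4] := by
  induction n with
  | zero => simp
  | succ n ih =>
    rw [prod_range_succ, sum_range_succ]
    refine (ih.mul (eval_mul_prime_divX_ascPochhammer_modEq hp hp5 ht n)).trans ?_
    symm
    rw [Int.modEq_iff_dvd]
    refine ⟨((p - 1).factorial : ℤ) ^ (n + 1) * p ^ 2 * t ^ 2 *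
      (∑ m ∈ range n, (m * (m + 1) : ℤ)) * (n * (n + 1)), ?_⟩
    ring

theorem factorial_mul_eq_prod_eval {p : ℕ} (hp : p ≠ 0) (n : ℕ) :
    ((n * p).factorial : ℤ) = p ^ n * n.factorial *
      ∏ m ∈ range n, (ascPochhammer ℤ p).divX.eval ((m : ℤ) * p) := by
  induction n with
  | zero => simp
  | succ n ih =>
    obtain ⟨q, rfl⟩ := Nat.exists_eq_succ_of_ne_zero hp
    have hshift := congrArg (eval ((n : ℤ) * (q + 1 : ℕ))) (ascPochhammer_int_comp_X_add_one q)
    simp only [eval_comp, eval_add, eval_X, eval_one, eval_mul, eval_natCast] at hshift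
    rw [← mul_eval_divX_ascPochhammer hp ((n : ℤ) * _)] at hshift
    have hasc : ((n * (q + 1) + 1).ascFactorial (q + 1) : ℤ) =
        (ascPochhammer ℤ (q + 1)).eval ((n : ℤ) * (q + 1 : ℕ) + 1) := by
      rw [← ascPochhammer_nat_eq_ascFactorial, ascPochhammer_eval_cast]
      push_cast
      rfl
    rw [Nat.succ_eq_add_one] at *
    rw [add_one_mul, ← Nat.factorial_mul_ascFactorial, Nat.cast_mul, ih, hasc, hshift,
      prod_range_succ, Nat.factorial_succ]
    push_cast
    ring

theorem sum_range_mul_succ_add (k l : ℕ) :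
    ∑ m ∈ range (k + l), (m * (m + 1) : ℤ) =
      ∑ m ∈ range k, (m * (m + 1) : ℤ) + ∑ m ∈ range l, (m * (m + 1) : ℤ) +
        (k + l) * k * l := by
  have h : ∀ n : ℕ, 3 * ∑ m ∈ range n, (m * (m + 1) : ℤ) = n ^ 3 - n := fun n => by
    induction n with
    | zero => simp
    | succ n ih => rw [sum_range_succ, mul_add, ih]; push_cast; ring
  have h1 := h (k + l)
  push_cast at h1
  linarith [h k, h l]

theorem choose_mul_prime_modEq_s3 {p : ℕ} (hp : p.Prime) (hp5 : 5 ≤ p) {t : ℤ}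
    (ht : (ascPochhammer ℤ p).coeff 3 = p * t) (k l : ℕ) :
    (((k + l) * p).choose (k * p) : ℤ) ≡
      (k + l).choose k * (1 - p ^ 3 * t * ((k + l) * k * l)) [ZMOD p ^ 4] := by
  have hp0 : (p : ℤ) ≠ 0 := by exact_mod_cast hp.ne_zero
  set W : ℕ → ℤ := fun n => ∏ m ∈ range n, (ascPochhammer ℤ p).divX.eval ((m : ℤ) * p)
  set S : ℕ → ℤ := fun n => ∑ m ∈ range n, (m * (m + 1) : ℤ)
  have hprod : (((k + l) * p).choose (k * p) : ℤ) * (W k * W l) = (k + l).choose k * W (k + l) := by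
    have h1 : (((k + l) * p).choose (k * p) : ℤ) * (k * p).factorial * (l * p).factorial =
        ((k + l) * p).factorial := by
      have h := Nat.choose_mul_factorial_mul_factorial (Nat.le_add_right (k * p) (l * p))
      rw [Nat.add_sub_cancel_left] at h
      rw [add_mul]
      exact_mod_cast h
    have h2 : ((k + l).choose k : ℤ) * k.factorial * l.factorial = (k + l).factorial := by
      have h := Nat.choose_mul_factorial_mul_factorial (Nat.le_add_right k l)
      rw [Nat.add_sub_cancel_left] at h
      exact_mod_cast h
    rw [factorial_mul_eq_prod_eval hp.ne_zero, factorial_mul_eq_prod_eval hp.ne_zero,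
      factorial_mul_eq_prod_eval hp.ne_zero, ← h2] at h1
    have hne : (p : ℤ) ^ (k + l) * k.factorial * l.factorial ≠ 0 := by
      have := Nat.factorial_ne_zero
      positivity
    apply mul_left_cancel₀ hne
    linear_combination h1
  have hmod := ((prod_eval_mul_prime_modEq hp hp5 ht k).mul
    (prod_eval_mul_prime_modEq hp hp5 ht l)).mul_left (((k + l) * p).choose (k * p) : ℤ)
  rw [hprod] at hmod
  have hmod' := hmod.symm.trans ((prod_eval_mul_prime_modEq hp hp5 ht (k + l)).mul_left _)
  have hcop : IsCoprime ((p : ℤ) ^ 4) ((p - 1).factorial ^ (k + l)) := by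
    refine IsCoprime.pow (Nat.isCoprime_iff_coprime.2 ((Nat.Prime.coprime_iff_not_dvd hp).2 ?_))
    rw [hp.dvd_factorial]
    have := hp.pos
    omega
  have hcancel : (p : ℤ) ^ 4 ∣ (k + l).choose k * (1 - p ^ 3 * t * S (k + l)) -
      (((k + l) * p).choose (k * p) : ℤ) * ((1 - p ^ 3 * t * S k) * (1 - p ^ 3 * t * S l)) := by
    refine hcop.dvd_of_dvd_mul_left ?_
    obtain ⟨r, hr⟩ := hmod'.dvd
    exact ⟨r, by linear_combination hr⟩
  obtain ⟨r, hr⟩ := hcancel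
  have hadd : S (k + l) = S k + S l + (k + l) * k * l := sum_range_mul_succ_add k l
  generalize (((k + l) * p).choose (k * p) : ℤ) = c at hr ⊢
  generalize ((k + l).choose k : ℤ) = c' at hr ⊢
  rw [show ((k : ℤ) + l) * k * l = S (k + l) - S k - S l by rw [hadd]; ring]
  generalize S (k + l) = s at hr ⊢
  generalize S k = a at hr ⊢
  generalize S l = b at hr ⊢
  rw [Int.modEq_iff_dvd]
  refine ⟨r * (1 + p ^ 3 * t * a) * (1 + p ^ 3 * t * b) -
    p ^ 2 * t ^ 2 * (c * (a ^ 2 + b ^ 2 - p ^ 6 * t ^ 2 * a ^ 2 * b ^ 2) +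
      c' * (a * b - s * a - s * b - p ^ 3 * t * s * a * b)), ?_⟩
  linear_combination (1 + p ^ 3 * t * a) * (1 + p ^ 3 * t * b) * hr

theorem padicNorm_three_mul_sub_bernoulli_le {p : ℕ} [hp : Fact p.Prime] (hp5 : 5 ≤ p) {t : ℤ}
    (ht : (ascPochhammer ℤ p).coeff 3 = p * t) :
    padicNorm p (3 * t - bernoulli (p - 3)) ≤ (p : ℚ) ^ (-(1 : ℤ)) := by
  have hp0 : (0 : ℚ) < p := by exact_mod_cast hp.out.pos
  have hunit : ∀ d : ℕ, 0 < d → d < p → padicNorm p (d : ℚ) = 1 := fun d hd hdp => by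
    rw [padicNorm.nat_eq_one_iff]
    exact fun hdvd => absurd (Nat.le_of_dvd hd hdvd) (by omega)
  have hchoose : (6 : ℚ) * p.choose 3 = p * ((p - 1 : ℕ) * (p - 2 : ℕ)) := by
    have h := Nat.descFactorial_eq_factorial_mul_choose p 3
    simp only [Nat.descFactorial_succ, Nat.descFactorial_zero, Nat.factorial] at h
    have h' : 6 * p.choose 3 = p * ((p - 1) * (p - 2)) := by
      rw [show 6 * p.choose 3 = _ from h.symm]
      simp only [Nat.sub_zero]
      ring
    exact_mod_cast h'
  have hcast : ((p - 1 : ℕ) : ℚ) * (p - 2 : ℕ) = p * (p - 3 : ℕ) + 2 := by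
    rw [Nat.cast_sub (by omega), Nat.cast_sub (by omega), Nat.cast_sub (by omega)]
    push_cast
    ring
  set B := bernoulli (p - 3)
  have hcoeff : padicNorm p (6 * t - ((p - 1 : ℕ) * (p - 2 : ℕ)) * B) ≤ (p : ℚ) ^ (-(1 : ℤ)) := by
    have h := padicNorm_coeff_ascPochhammer_sub_le (p := p) (j := 3) (by norm_num) (by omega)
    have h6 : padicNorm p ((6 : ℤ) * ((ascPochhammer ℤ p).coeff 3 - p.choose 3 * B)) ≤
        (p : ℚ) ^ (-(2 : ℤ)) := by
      rw [padicNorm.mul]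
      exact (mul_le_of_le_one_left (padicNorm.nonneg _) (padicNorm.of_int _)).trans h
    rw [ht, show ((6 : ℤ) : ℚ) * (((p * t : ℤ) : ℚ) - p.choose 3 * B) =
        p * (6 * t - ((p - 1 : ℕ) * (p - 2 : ℕ)) * B) by
      push_cast
      linear_combination (-B) * hchoose, padicNorm.mul, padicNorm.padicNorm_p_of_prime] at h6
    calc _ = p * ((p : ℚ)⁻¹ * padicNorm p (6 * t - ((p - 1 : ℕ) * (p - 2 : ℕ)) * B)) := by
          field_simp
      _ ≤ p * (p : ℚ) ^ (-(2 : ℤ)) := by gcongr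
      _ = (p : ℚ) ^ (-(1 : ℤ)) := by rw [← zpow_one_add₀ hp0.ne']; norm_num
  have hle : (p : ℚ) ^ (-(1 : ℤ)) ≤ 1 :=
    zpow_le_one_of_nonpos₀ (by exact_mod_cast hp.out.one_le) (by norm_num)
  have hB : padicNorm p B ≤ 1 := by
    have h : padicNorm p (((p - 1 : ℕ) * (p - 2 : ℕ)) * B) ≤ 1 := by
      rw [show ((p - 1 : ℕ) * (p - 2 : ℕ)) * B =
        ((6 * t : ℤ) : ℚ) - (6 * t - ((p - 1 : ℕ) * (p - 2 : ℕ)) * B) by push_cast; ring]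
      exact padicNorm.sub.trans (max_le (padicNorm.of_int _) (hcoeff.trans hle))
    rwa [padicNorm.mul, padicNorm.mul, hunit _ (by omega) (by omega),
      hunit _ (by omega) (by omega), one_mul, one_mul] at h
  have h2 : padicNorm p ((2 : ℕ) * (3 * t - B)) = padicNorm p (3 * t - B) := by
    rw [padicNorm.mul, hunit 2 (by norm_num) (by omega), one_mul]
  rw [← h2, show ((2 : ℕ) : ℚ) * (3 * t - B) =
      (6 * t - ((p - 1 : ℕ) * (p - 2 : ℕ)) * B) + p * ((p - 3 : ℕ) * B) by
    push_cast
    linear_combination B * hcast]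
  refine padicNorm.nonarchimedean.trans (max_le hcoeff ?_)
  rw [padicNorm.mul, padicNorm.mul, padicNorm.padicNorm_p_of_prime, zpow_neg_one]
  exact mul_le_of_le_one_right (by positivity)
    (mul_le_one₀ (padicNorm.of_nat _) (padicNorm.nonneg _) hB)

theorem choose_mul_prime_congr (p : ℕ) (hp : p.Prime) (hp5 : 5 ≤ p) (n k : ℕ) (hkn : k ≤ n) :
    padicNorm p
        (((n * p).choose (k * p) : ℚ) -
          (n.choose k : ℚ) *
            (1 - (1 / 3) * n * k * ((n - k : ℕ) : ℚ) * (p : ℚ) ^ 3 * bernoulli (p - 3))) ≤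
      (p : ℚ) ^ (-(4 : ℤ)) := by
  have := Fact.mk hp
  obtain ⟨l, rfl⟩ := Nat.exists_eq_add_of_le hkn
  obtain ⟨t, ht⟩ := prime_dvd_coeff_ascPochhammer hp (j := 3) (by norm_num) (by omega)
  have hp0 : (p : ℚ) ≠ 0 := by exact_mod_cast hp.ne_zero
  have hchoose : padicNorm p (((k + l).choose k * (1 - p ^ 3 * t * ((k + l) * k * l)) -
      ((k + l) * p).choose (k * p) : ℤ) : ℚ) ≤ (p : ℚ) ^ (-(4 : ℤ)) := by
    have h := (choose_mul_prime_modEq_s3 hp hp5 ht k l).dvd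
    exact_mod_cast padicNorm.dvd_iff_norm_le.1 (show ((p ^ 4 : ℕ) : ℤ) ∣ _ by exact_mod_cast h)
  have hbern : padicNorm p (((k + l).choose k * (k + l) * k * l : ℕ) *
      (p ^ 3 * (3 * t - bernoulli (p - 3)))) ≤ (p : ℚ) ^ (-(4 : ℤ)) := by
    rw [padicNorm.mul]
    refine (mul_le_of_le_one_left (padicNorm.nonneg _) (padicNorm.of_nat _)).trans ?_
    have hpow : padicNorm p ((p : ℚ) ^ 3) = (p : ℚ) ^ (-(3 : ℤ)) := by
      have h := padicNorm.padicNorm_p_of_prime (p := p)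
      rw [pow_three, padicNorm.mul, padicNorm.mul, h, ← pow_three, inv_pow, zpow_neg]
      norm_cast
    rw [padicNorm.mul, hpow, show (-(4 : ℤ)) = -3 + -1 by norm_num, zpow_add₀ hp0]
    gcongr
    exact padicNorm_three_mul_sub_bernoulli_le hp5 ht
  have hthree : padicNorm p ((3 : ℕ) : ℚ) = 1 := by
    rw [padicNorm.nat_eq_one_iff]
    exact fun hdvd => absurd (Nat.le_of_dvd (by norm_num) hdvd) (by omega)
  rw [Nat.add_sub_cancel_left, ← one_mul (padicNorm p (_ - _)), ← congrArg (· * _) hthree,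
    ← padicNorm.mul, show ∀ C D B : ℚ, ((3 : ℕ) : ℚ) * (C - D * (1 - 1 / 3 * (k + l : ℕ) * k * l * p ^ 3 * B)) =
      -(((3 : ℕ) : ℚ) * (D * (1 - p ^ 3 * t * ((k + l) * k * l)) - C)) -
        D * (k + l) * k * l * (p ^ 3 * (3 * t - B)) from fun C D B => by push_cast; ring]
  refine padicNorm.sub.trans (max_le ?_ (by exact_mod_cast hbern))
  rw [padicNorm.neg, padicNorm.mul, hthree, one_mul]
  exact_mod_cast hchoose
end

section
/- For any prime $p \ge 5$, $\sum_{j=1}^{p-1} \frac{1}{j^2}\binom{2j}{j} \equiv \frac{1}{2}\left(\frac{p}{3}\right) B_{p-2}\!\left(\frac{1}{3}\right) \pmod{p}$ (as a congruence of rational numbers, i.e. the $p$-adic valuation of the difference is at least $1$), where $\left(\frac{p}{3}\right)$ denotes the Legendre symbol of $p$ modulo $3$. -/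
open Finset

open Polynomial in
/-- The polynomial `∑_{1 ≤ j ≤ n} a j / j ^ s * X ^ j`. -/
noncomputable def truncatedPolylog {K : Type*} [Field K] (a : ℕ → K) (s n : ℕ) : K[X] :=
  ∑ j ∈ Icc 1 n, C (a j / (j : K) ^ s) * X ^ j

section Polylog

open Polynomial

variable {K : Type*} [Field K] {p m : ℕ} [CharP K p]

lemma natCast_ne_zero_of_lt_s4 {j : ℕ} (h1 : 1 ≤ j) (h2 : j < p) : (j : K) ≠ 0 := by
  rw [Ne, CharP.cast_eq_zero_iff K p]
  exact Nat.not_dvd_of_pos_of_lt h1 h2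

lemma X_mul_derivative_truncatedPolylog (a : ℕ → K) (s : ℕ) {n : ℕ} (hn : n < p) :
    X * derivative (truncatedPolylog a (s + 1) n) = truncatedPolylog a s n := by
  simp only [truncatedPolylog, derivative_sum, mul_sum]
  refine sum_congr rfl fun j hj => ?_
  obtain ⟨h1, h2⟩ := mem_Icc.1 hj
  have hj0 : (j : K) ≠ 0 := natCast_ne_zero_of_lt_s4 (p := p) h1 (by omega)
  obtain ⟨i, rfl⟩ : ∃ i, j = i + 1 := ⟨j - 1, by omega⟩
  rw [derivative_C_mul_X_pow, Nat.add_sub_cancel, show a (i + 1) / ((i + 1 : ℕ) : K) ^ s =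
    a (i + 1) / ((i + 1 : ℕ) : K) ^ (s + 1) * ((i + 1 : ℕ) : K) by field_simp; ring]
  ring

lemma natDegree_truncatedPolylog_le (a : ℕ → K) (s n : ℕ) :
    (truncatedPolylog a s n).natDegree ≤ n :=
  natDegree_sum_le_of_forall_le _ _ fun _ hj =>
    (natDegree_C_mul_X_pow_le _ _).trans (mem_Icc.1 hj).2

lemma truncatedPolylog_eval (a : ℕ → K) (s n : ℕ) (x : K) :
    (truncatedPolylog a s n).eval x = ∑ j ∈ Icc 1 n, a j / (j : K) ^ s * x ^ j := by
  simp [truncatedPolylog, eval_finsetSum]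

lemma truncatedPolylog_eval_zero (a : ℕ → K) (s n : ℕ) :
    (truncatedPolylog a s n).eval 0 = 0 := by
  rw [truncatedPolylog_eval]
  refine sum_eq_zero fun j hj => ?_
  rw [zero_pow (by have := (mem_Icc.1 hj).1; omega), mul_zero]

lemma eq_C_of_derivative_eq_zero {P : K[X]} (hdeg : P.natDegree < p)
    (h : derivative P = 0) : P = C (P.eval 0) := by
  ext n
  rcases n with _ | n
  · simp [coeff_zero_eq_eval_zero]
  · rw [coeff_C_succ]
    by_cases hn : n + 1 < p
    · have h1 : (derivative P).coeff n = 0 := by rw [h, coeff_zero]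
      rw [coeff_derivative] at h1
      have := natCast_ne_zero_of_lt_s4 (K := K) (p := p) (j := n + 1) (by omega) hn
      push_cast at this
      exact (mul_eq_zero.1 h1).resolve_right this
    · exact coeff_eq_zero_of_natDegree_lt (by omega)

lemma centralBinom_cast_eq_s4 (hm : p = 2 * m + 1) {j : ℕ} (hj : j ≤ m) :
    (j.centralBinom : K) = (-4) ^ j * (m.choose j : K) := by
  induction j with
  | zero => simp
  | succ j ih =>
    have h0 : ((j + 1 : ℕ) : K) ≠ 0 := natCast_ne_zero_of_lt_s4 (p := p) (by omega) (by omega)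
    have hp : ((2 * m + 1 : ℕ) : K) = 0 := by rw [← hm]; exact CharP.cast_eq_zero K p
    have e1 := congrArg (Nat.cast : ℕ → K) (Nat.succ_mul_centralBinom_succ j)
    have e2 := congrArg (Nat.cast : ℕ → K) (Nat.choose_succ_right_eq m j)
    apply mul_left_cancel₀ h0
    rw [Nat.cast_mul] at e1
    rw [e1]
    push_cast [Nat.cast_sub (show j ≤ m by omega)] at e2 hp ⊢
    rw [ih (by omega), pow_succ]
    linear_combination (-4) ^ j * (m.choose j : K) * 2 * hp + 4 * (-4) ^ j * e2

lemma truncatedPolylog_centralBinom_zero_comp [Fact p.Prime] (hm : p = 2 * m + 1) :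
    (1 - 2 * X) * (truncatedPolylog (fun j => (j.centralBinom : K)) 0 m).comp (X - X ^ 2) =
      2 * (X - X ^ p) := by
  have h1 : 1 + (truncatedPolylog (fun j => (j.centralBinom : K)) 0 m).comp (X - X ^ 2) =
      (1 - 2 * X) ^ (2 * m) := by
    rw [pow_mul, show (1 - 2 * X : K[X]) ^ 2 = -4 * (X - X ^ 2) + 1 by ring, add_pow,
      sum_range_eq_add_Ico _ (by omega)]
    simp only [truncatedPolylog, Polynomial.sum_comp]
    congr 1
    · simp
    · refine sum_congr (by ext; simp) fun j hj => ?_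
      simp only [pow_zero, div_one, mul_comp, C_comp, X_pow_comp, one_pow, mul_one]
      rw [centralBinom_cast_eq_s4 (p := p) hm (by have := mem_Icc.1 hj; omega), mul_pow]
      simp only [map_mul, map_pow, map_neg, map_natCast]
      rw [show (C 4 : K[X]) = 4 from rfl]
      ring
  have h2 : (1 - 2 * X : K[X]) ^ p = 1 - 2 * X ^ p := by
    rw [sub_pow_char, mul_pow, one_pow]
    congr 2
    exact map_ofNat (frobenius K[X] p) 2
  rw [hm, pow_succ, ← hm] at h2
  linear_combination h1 * (1 - 2 * X) + h2

lemma one_sub_X_mul_truncatedPolylog (n : ℕ) :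
    (1 - X) * truncatedPolylog (fun _ => (1 : K)) 0 n = X - X ^ (n + 1) := by
  induction n with
  | zero => simp [truncatedPolylog]
  | succ n ih =>
    rw [truncatedPolylog] at ih ⊢
    rw [sum_Icc_succ_top (by omega), mul_add, ih]
    simp
    ring

lemma truncatedPolylog_centralBinom_one_comp [Fact p.Prime] (hm : p = 2 * m + 1) (hm0 : 0 < m) :
    (truncatedPolylog (fun j => (j.centralBinom : K)) 1 m).comp (X - X ^ 2) =
      2 * truncatedPolylog (fun _ => (1 : K)) 1 (2 * m) := by
  set F := truncatedPolylog (fun j => (j.centralBinom : K)) 1 m with hF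
  set L := truncatedPolylog (fun _ => (1 : K)) 1 (2 * m) with hL
  have hF' := X_mul_derivative_truncatedPolylog (p := p) (fun j => (j.centralBinom : K)) 0
    (n := m) (by omega)
  have hL' := X_mul_derivative_truncatedPolylog (p := p) (fun _ => (1 : K)) 0
    (n := 2 * m) (by omega)
  rw [zero_add, ← hF] at hF'
  rw [zero_add, ← hL] at hL'
  have hF'' := congrArg (fun P : K[X] => P.comp (X - X ^ 2)) hF'
  simp only [mul_comp, X_comp] at hF''
  have hd : derivative (F.comp (X - X ^ 2) - 2 * L) = 0 := by
    have hX : (X - X ^ 2 : K[X]) ≠ 0 := by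
      rw [show (X - X ^ 2 : K[X]) = X * (1 - X) by ring]
      refine mul_ne_zero X_ne_zero fun h => ?_
      simpa using congrArg (eval 0) h
    apply mul_left_cancel₀ hX
    rw [mul_zero]
    simp only [derivative_sub, derivative_comp, derivative_mul, derivative_X, derivative_X_pow,
      derivative_ofNat]
    have h0 := truncatedPolylog_centralBinom_zero_comp (K := K) hm
    have h1 := one_sub_X_mul_truncatedPolylog (K := K) (2 * m)
    rw [← hm] at h1
    simp only [Nat.cast_ofNat, Nat.add_one_sub_one, pow_one, map_ofNat]
    linear_combination (1 - 2 * X) * hF'' - 2 * (1 - X) * hL' + h0 - 2 * h1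
  have hc := eq_C_of_derivative_eq_zero (p := p) ?_ hd
  · rw [← sub_eq_zero, hc]
    simp [hF, hL, eval_comp, truncatedPolylog_eval_zero]
  · refine (natDegree_sub_le_of_le (m := 2 * m) (n := 2 * m) ?_ ?_).trans_lt (by simp; omega)
    · refine natDegree_comp_le.trans ?_
      rw [mul_comm]
      refine Nat.mul_le_mul ?_ (natDegree_truncatedPolylog_le _ _ _)
      compute_degree
    · rw [show (2 : K[X]) = C 2 from rfl]
      exact (natDegree_C_mul_le _ _).trans (natDegree_truncatedPolylog_le _ _ _)


lemma sum_Icc_inv_sq_eq_zero [Fact p.Prime] (hp5 : 5 ≤ p) :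
    ∑ k ∈ Icc 1 (p - 1), 1 / (k : K) ^ 2 = 0 := by
  have h1 : ∑ k ∈ Icc 1 (p - 1), 1 / (k : ZMod p) ^ 2 = ∑ x : ZMod p, x⁻¹ ^ 2 := by
    rw [← sum_erase_add _ _ (mem_univ (0 : ZMod p))]
    simp only [inv_zero, ne_eq, OfNat.ofNat_ne_zero, not_false_eq_true, zero_pow, add_zero]
    refine sum_bij' (fun k _ => (k : ZMod p)) (fun x _ => x.val) ?_ ?_ ?_ ?_ ?_
    · intro k hk
      obtain ⟨h1, h2⟩ := mem_Icc.1 hk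
      simpa using natCast_ne_zero_of_lt_s4 (K := ZMod p) (p := p) h1 (by omega)
    · intro x hx
      have h1 := (ZMod.val_ne_zero x).2 (mem_erase.1 hx).1
      have h2 := ZMod.val_lt x
      exact mem_Icc.2 ⟨by omega, by omega⟩
    · intro k hk
      have := (mem_Icc.1 hk).2
      exact ZMod.val_cast_of_lt (by omega)
    · intro x _
      exact ZMod.natCast_zmod_val x
    · intro k _
      rw [one_div, inv_pow]
  have h2 : ∑ x : ZMod p, x⁻¹ ^ 2 = 0 := by
    rw [Fintype.sum_equiv (Equiv.inv (ZMod p)) (fun x => x⁻¹ ^ 2) (fun x => x ^ 2) fun _ => rfl]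
    exact FiniteField.sum_pow_lt_card_sub_one _ _ (by rw [ZMod.card]; omega)
  have h3 := congrArg (ZMod.castHom (dvd_refl p) K) (h1.trans h2)
  rw [map_sum, map_zero] at h3
  simpa only [map_div₀, map_one, map_pow, map_natCast] using h3

lemma truncatedPolylog_centralBinom_two_comp [Fact p.Prime] (hm : p = 2 * m + 1) (hm0 : 2 ≤ m) :
    (truncatedPolylog (fun j => (j.centralBinom : K)) 2 m).comp (X - X ^ 2) =
      2 * (truncatedPolylog (fun _ => (1 : K)) 2 (2 * m) +
        (truncatedPolylog (fun _ => (1 : K)) 2 (2 * m)).comp (1 - X)) := by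
  have hG := truncatedPolylog_centralBinom_one_comp (K := K) hm (by omega)
  set F := truncatedPolylog (fun j => (j.centralBinom : K)) 2 m with hF
  set L := truncatedPolylog (fun _ => (1 : K)) 2 (2 * m) with hL
  have hF' := X_mul_derivative_truncatedPolylog (p := p) (fun j => (j.centralBinom : K)) 1
    (n := m) (by omega)
  have hL' := X_mul_derivative_truncatedPolylog (p := p) (fun _ => (1 : K)) 1
    (n := 2 * m) (by omega)
  rw [one_add_one_eq_two, ← hF] at hF'
  rw [one_add_one_eq_two, ← hL] at hL'
  set L1 := truncatedPolylog (fun _ => (1 : K)) 1 (2 * m)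
  have hF'' := congrArg (fun P : K[X] => P.comp (X - X ^ 2)) hF'
  have hL'' := congrArg (fun P : K[X] => P.comp (1 - X)) hL'
  simp only [mul_comp, X_comp] at hF'' hL''
  have h2 : (2 : K) ≠ 0 := by
    exact_mod_cast natCast_ne_zero_of_lt_s4 (K := K) (p := p) (j := 2) (by omega) (by omega)
  have hsymm : L1.comp (1 - X) = L1 := by
    have := congrArg (fun P : K[X] => P.comp (1 - X)) hG
    simp only [mul_comp, comp_assoc, ofNat_comp, sub_comp, X_comp, X_pow_comp] at this
    rw [show (1 - X - (1 - X) ^ 2 : K[X]) = X - X ^ 2 by ring, hG] at this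
    refine (mul_left_cancel₀ ?_ this).symm
    rw [show (2 : K[X]) = C 2 from rfl]
    exact C_ne_zero.2 h2
  have hd : derivative (F.comp (X - X ^ 2) - 2 * (L + L.comp (1 - X))) = 0 := by
    have hX : (X - X ^ 2 : K[X]) ≠ 0 := by
      rw [show (X - X ^ 2 : K[X]) = X * (1 - X) by ring]
      refine mul_ne_zero X_ne_zero fun h => ?_
      simpa using congrArg (eval 0) h
    apply mul_left_cancel₀ hX
    rw [mul_zero]
    simp only [derivative_sub, derivative_comp, derivative_mul, derivative_X, derivative_X_pow,
      derivative_ofNat, derivative_add, derivative_one]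
    simp only [Nat.cast_ofNat, Nat.add_one_sub_one, pow_one, map_ofNat]
    linear_combination (1 - 2 * X) * hF'' + (1 - 2 * X) * hG - 2 * (1 - X) * hL' +
      2 * X * hL'' + 2 * X * hsymm
  have hc := eq_C_of_derivative_eq_zero (p := p) ?_ hd
  · rw [← sub_eq_zero, hc]
    have hz := sum_Icc_inv_sq_eq_zero (K := K) (p := p) (by omega)
    rw [hm, Nat.add_sub_cancel] at hz
    have hL1 : L.eval 1 = 0 := by
      rw [hL, truncatedPolylog_eval]
      simpa using hz
    have hF0 : F.eval 0 = 0 := truncatedPolylog_eval_zero _ _ _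
    have hL0 : L.eval 0 = 0 := truncatedPolylog_eval_zero _ _ _
    simp [eval_comp, hF0, hL0, hL1]
  · have hL2 : L.natDegree ≤ 2 * m := natDegree_truncatedPolylog_le _ _ _
    refine (natDegree_sub_le_of_le (m := 2 * m) (n := 2 * m) ?_ ?_).trans_lt (by simp; omega)
    · refine natDegree_comp_le.trans ?_
      rw [mul_comm]
      refine Nat.mul_le_mul ?_ (natDegree_truncatedPolylog_le _ _ _)
      compute_degree
    · rw [show (2 : K[X]) = C 2 from rfl]
      refine (natDegree_C_mul_le _ _).trans (natDegree_add_le_of_degree_le hL2 ?_)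
      refine natDegree_comp_le.trans ?_
      rw [← mul_one (2 * m)]
      refine Nat.mul_le_mul hL2 ?_
      compute_degree

/-- The value at `x` of the dilogarithm series truncated after `n` terms. -/
def truncatedDilog (n : ℕ) (x : K) : K := ∑ k ∈ Icc 1 n, x ^ k / (k : K) ^ 2

lemma truncatedDilog_succ (n : ℕ) (x : K) :
    truncatedDilog (n + 1) x = truncatedDilog n x + x ^ (n + 1) / ((n + 1 : ℕ) : K) ^ 2 :=
  sum_Icc_succ_top (by omega) _

lemma sum_centralBinom_div_sq_mul_pow [Fact p.Prime] (hm : p = 2 * m + 1) (hm0 : 2 ≤ m) (x : K) :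
    ∑ j ∈ Icc 1 m, (j.centralBinom : K) / (j : K) ^ 2 * (x * (1 - x)) ^ j =
      2 * (truncatedDilog (2 * m) x + truncatedDilog (2 * m) (1 - x)) := by
  have h := congrArg (eval x) (truncatedPolylog_centralBinom_two_comp (K := K) hm hm0)
  simp only [eval_comp, eval_mul, eval_add, eval_sub, eval_X, eval_pow, eval_one, eval_ofNat,
    truncatedPolylog_eval, one_div_mul_eq_div] at h
  rw [show x * (1 - x) = x - x ^ 2 by ring]
  exact h

lemma truncatedDilog_add_neg (h2 : (2 : K) ≠ 0) (m : ℕ) (x : K) :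
    2 * (truncatedDilog (2 * m) x + truncatedDilog (2 * m) (-x)) = truncatedDilog m (x ^ 2) := by
  induction m with
  | zero => simp [truncatedDilog]
  | succ m ih =>
    rw [show 2 * (m + 1) = 2 * m + 1 + 1 by ring, truncatedDilog_succ, truncatedDilog_succ,
      truncatedDilog_succ, truncatedDilog_succ, truncatedDilog_succ, ← ih,
      show ((2 * m + 1 + 1 : ℕ) : K) = 2 * ((m + 1 : ℕ) : K) by push_cast; ring,
      Odd.neg_pow ⟨m, rfl⟩, Even.neg_pow ⟨m + 1, by ring⟩, ← pow_mul, mul_pow]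
    rw [show 2 * (m + 1) = 2 * m + 1 + 1 by ring]
    set y := ((m + 1 : ℕ) : K) ^ 2
    have e : x ^ (2 * m + 1 + 1) / (2 ^ 2 * y) * 4 = x ^ (2 * m + 1 + 1) / y := by
      rw [← div_div, div_right_comm, show (4 : K) = 2 ^ 2 by norm_num,
        div_mul_cancel₀ _ (pow_ne_zero 2 h2)]
    linear_combination e

lemma truncatedDilog_eq_add_inv (hm : p = 2 * m + 1) {x : K} (hx : x ≠ 0) :
    truncatedDilog (2 * m) x = truncatedDilog m x + x ^ p * truncatedDilog m x⁻¹ := by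
  have hu : Icc 1 (2 * m) = Icc 1 m ∪ Icc (m + 1) (2 * m) := by ext; simp; omega
  rw [truncatedDilog, hu, sum_union (by
    rw [disjoint_left]; intro a ha hb; rw [mem_Icc] at ha hb; omega)]
  congr 1
  rw [truncatedDilog, mul_sum]
  refine sum_bij' (fun k _ => p - k) (fun k _ => p - k) ?_ ?_ ?_ ?_ ?_
  · intro k hk; rw [mem_Icc] at hk ⊢; omega
  · intro k hk; rw [mem_Icc] at hk ⊢; omega
  · intro k hk; rw [mem_Icc] at hk; omega
  · intro k hk; rw [mem_Icc] at hk; omega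
  · intro k hk
    rw [mem_Icc] at hk
    rw [Nat.cast_sub (by omega), CharP.cast_eq_zero K p, zero_sub, neg_sq, mul_div_assoc', inv_pow]
    congr 1
    rw [← div_eq_mul_inv, eq_div_iff (pow_ne_zero _ hx), ← pow_add]
    congr 1
    omega

lemma truncatedDilog_cubeRoot (hm : p = 2 * m + 1) (hm0 : 2 ≤ m) (hp3 : p % 3 ≠ 0) {z : K}
    (hz : z ^ 2 + z + 1 = 0) :
    2 * (truncatedDilog (2 * m) (-z) + truncatedDilog (2 * m) (-z ^ 2)) =
      3 * (truncatedDilog (2 * m) z + truncatedDilog (2 * m) (z ^ 2)) := by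
  have h2 : (2 : K) ≠ 0 := by
    exact_mod_cast natCast_ne_zero_of_lt_s4 (K := K) (p := p) (j := 2) (by omega) (by omega)
  have hz3 : z ^ 3 = 1 := by linear_combination (z - 1) * hz
  have hz0 : z ≠ 0 := by rintro rfl; simp at hz3
  have hinv : z⁻¹ = z ^ 2 := inv_eq_of_mul_eq_one_right (by rw [← hz3]; ring)
  have hinv2 : (z ^ 2)⁻¹ = z := by rw [← hinv, inv_inv]
  have hη : (z ^ p) ^ 2 + z ^ p + 1 = 0 := by
    rw [← Nat.div_add_mod p 3, pow_add, pow_mul, hz3, one_pow, one_mul]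
    have h3 : p % 3 = 1 ∨ p % 3 = 2 := by omega
    rcases h3 with h | h <;> rw [h]
    · rw [pow_one, hz]
    · linear_combination z * hz3 + hz
  have e1 := truncatedDilog_eq_add_inv hm hz0
  have e2 := truncatedDilog_eq_add_inv hm (pow_ne_zero 2 hz0)
  have e3 := truncatedDilog_eq_add_inv hm (neg_ne_zero.2 hz0)
  have e4 := truncatedDilog_eq_add_inv hm (neg_ne_zero.2 (pow_ne_zero 2 hz0))
  have e5 := truncatedDilog_add_neg h2 m z
  have e6 := truncatedDilog_add_neg h2 m (z ^ 2)
  have hodd : Odd p := ⟨m, hm⟩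
  rw [show (z ^ 2) ^ 2 = z by rw [← pow_mul]; linear_combination z * hz3] at e6
  rw [inv_neg, hinv, hodd.neg_pow] at e3
  rw [inv_neg, hinv2, hodd.neg_pow, pow_right_comm] at e4
  rw [hinv] at e1
  rw [hinv2, pow_right_comm] at e2
  set η := z ^ p
  set a := truncatedDilog m z
  set b := truncatedDilog m (z ^ 2)
  set u := truncatedDilog (2 * m) z
  set v := truncatedDilog (2 * m) (-z)
  set w := truncatedDilog (2 * m) (-z ^ 2)
  set u2 := truncatedDilog (2 * m) (z ^ 2)
  have hη3 : η ^ 3 = 1 := by linear_combination (η - 1) * hη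
  have evw : v = -η * w := by rw [e3, e4]; linear_combination -truncatedDilog m (-z) * hη3
  have key : a * (-4 + η) + b * (1 - 4 * η) = 0 := by
    linear_combination 2 * evw - e5 - η * e6 + 2 * e1 + 2 * η * e2 + 2 * a * hη3
  linear_combination e5 + e6 - 5 * e1 - 5 * e2 - η * key - 4 * (a + b) * hη

lemma truncatedDilog_cubeRoot_add (hm : p = 2 * m + 1) (hm0 : 2 ≤ m) (hp3 : p % 3 ≠ 0) {z : K}
    (hz : z ^ 2 + z + 1 = 0) :
    3 * (truncatedDilog (2 * m) z + truncatedDilog (2 * m) (z ^ 2) + truncatedDilog (2 * m) 1) =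
      truncatedDilog (p / 3) 1 := by
  have h3 : (3 : K) ≠ 0 := by
    exact_mod_cast natCast_ne_zero_of_lt_s4 (K := K) (p := p) (j := 3) (by omega) (by omega)
  have hz3 : z ^ 3 = 1 := by linear_combination (z - 1) * hz
  have hpow {x : K} (hx : x ^ 3 = 1) (n : ℕ) : x ^ (3 * n + 1) = x ∧
      x ^ (3 * n + 1 + 1) = x ^ 2 ∧ x ^ (3 * n + 1 + 1 + 1) = 1 := by
    refine ⟨?_, ?_, ?_⟩
    · rw [pow_succ, pow_mul, hx, one_pow, one_mul]
    · rw [add_assoc, pow_add, pow_mul, hx, one_pow, one_mul]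
    · rw [show 3 * n + 1 + 1 + 1 = 3 * (n + 1) by ring, pow_mul, hx, one_pow]
  have hz6 : (z ^ 2) ^ 3 = 1 := by rw [pow_right_comm, hz3, one_pow]
  have hone (n : ℕ) : 3 * (truncatedDilog (3 * n + 1) z + truncatedDilog (3 * n + 1) (z ^ 2) +
      truncatedDilog (3 * n + 1) 1) = 3 * (truncatedDilog (3 * n) z +
      truncatedDilog (3 * n) (z ^ 2) + truncatedDilog (3 * n) 1) := by
    obtain ⟨h1, -⟩ := hpow hz3 n
    obtain ⟨h2, -⟩ := hpow hz6 n
    simp only [truncatedDilog_succ, h1, h2, one_pow]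
    linear_combination 3 / ((3 * n + 1 : ℕ) : K) ^ 2 * hz
  have hstep (n : ℕ) : 3 * (truncatedDilog (3 * n) z + truncatedDilog (3 * n) (z ^ 2) +
      truncatedDilog (3 * n) 1) = truncatedDilog n 1 := by
    induction n with
    | zero => simp [truncatedDilog]
    | succ n ih =>
      rw [show 3 * (n + 1) = 3 * n + 1 + 1 + 1 by ring, truncatedDilog_succ n, ← ih, ← hone]
      obtain ⟨-, h1, h1'⟩ := hpow hz3 n
      obtain ⟨-, h2, h2'⟩ := hpow hz6 n
      simp only [truncatedDilog_succ (3 * n + 1 + 1), truncatedDilog_succ (3 * n + 1),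
        h1, h1', h2, h2', one_pow]
      rw [show ((3 * n + 1 + 1 + 1 : ℕ) : K) = 3 * ((n + 1 : ℕ) : K) by push_cast; ring, mul_pow]
      set y := ((n + 1 : ℕ) : K) ^ 2
      have e : 1 / (3 ^ 2 * y) * 9 = 1 / y := by
        rw [← div_div, div_right_comm, show (9 : K) = 3 ^ 2 by norm_num,
          div_mul_cancel₀ _ (pow_ne_zero 2 h3)]
      linear_combination e + 3 / ((3 * n + 1 + 1 : ℕ) : K) ^ 2 * (hz + z * hz3)
  have hr : 2 * m = 3 * (p / 3) ∨ 2 * m = 3 * (p / 3) + 1 := by omega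
  rcases hr with h | h <;> rw [h]
  exacts [hstep _, (hone _).trans (hstep _)]

lemma sum_centralBinom_div_sq_s4 [Fact p.Prime] (hp5 : 5 ≤ p) :
    ∑ j ∈ Icc 1 (p - 1), (j.centralBinom : ZMod p) / (j : ZMod p) ^ 2 =
      ∑ i ∈ Icc 1 (p / 3), 1 / (i : ZMod p) ^ 2 := by
  have hp : p.Prime := Fact.out
  obtain ⟨m, hm⟩ := hp.odd_of_ne_two (by omega)
  have hp3 : p % 3 ≠ 0 := fun h => by
    have := (Nat.prime_dvd_prime_iff_eq Nat.prime_three hp).1 (Nat.dvd_of_mod_eq_zero h)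
    omega
  let L := AlgebraicClosure (ZMod p)
  have : CharP L p := charP_of_injective_algebraMap (algebraMap (ZMod p) L).injective p
  obtain ⟨z, hz⟩ : ∃ z : L, z ^ 2 + z + 1 = 0 := by
    have hd : (X ^ 2 + X + 1 : L[X]).degree = 2 := by compute_degree!
    obtain ⟨z, hz⟩ := IsAlgClosed.exists_root (X ^ 2 + X + 1 : L[X]) (by rw [hd]; norm_num)
    exact ⟨z, by simpa [IsRoot] using hz⟩
  have h1 := sum_centralBinom_div_sq_mul_pow (K := L) hm (by omega) (-z)
  rw [show 1 - -z = -z ^ 2 by linear_combination hz, truncatedDilog_cubeRoot hm (by omega) hp3 hz,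
    show -z * -z ^ 2 = 1 by linear_combination (z - 1) * hz] at h1
  have h2 := truncatedDilog_cubeRoot_add (K := L) hm (by omega) hp3 hz
  have h3 : truncatedDilog (2 * m) (1 : L) = 0 := by
    have := sum_Icc_inv_sq_eq_zero (K := L) hp5
    rw [show p - 1 = 2 * m by omega] at this
    simpa [truncatedDilog] using this
  rw [h3, add_zero, ← h1] at h2
  have h4 : ∑ j ∈ Icc 1 (p - 1), (j.centralBinom : ZMod p) / (j : ZMod p) ^ 2 =
      ∑ j ∈ Icc 1 m, (j.centralBinom : ZMod p) / (j : ZMod p) ^ 2 := by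
    symm
    apply sum_subset (Icc_subset_Icc_right (by omega))
    intro j hj hj'
    rw [mem_Icc] at hj hj'
    rw [(ZMod.natCast_eq_zero_iff _ _).2, zero_div]
    rw [Nat.centralBinom]
    exact hp.dvd_choose (by omega) (by omega) (by omega)
  rw [h4]
  apply (algebraMap (ZMod p) L).injective
  simpa [truncatedDilog] using h2

end Polylog

/-- The rational number `q` is `p`-integral and reduces to `k` modulo `p`. -/
def HasResidue (p : ℕ) [Fact p.Prime] (q : ℚ) (k : ZMod p) : Prop :=
  ∃ x : ℤ_[p], (x : ℚ_[p]) = q ∧ PadicInt.toZMod x = k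

namespace HasResidue

variable {p : ℕ} [Fact p.Prime] {q r : ℚ} {k l : ZMod p}

lemma add (h : HasResidue p q k) (h' : HasResidue p r l) : HasResidue p (q + r) (k + l) := by
  obtain ⟨x, hx, rfl⟩ := h
  obtain ⟨y, hy, rfl⟩ := h'
  exact ⟨x + y, by simp [hx, hy], map_add _ _ _⟩

lemma mul (h : HasResidue p q k) (h' : HasResidue p r l) : HasResidue p (q * r) (k * l) := by
  obtain ⟨x, hx, rfl⟩ := h
  obtain ⟨y, hy, rfl⟩ := h'
  exact ⟨x * y, by simp [hx, hy], map_mul _ _ _⟩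

lemma intCast (n : ℤ) : HasResidue p n n := ⟨n, by simp, map_intCast _ _⟩

lemma natCast (n : ℕ) : HasResidue p n n := ⟨n, by simp, map_natCast _ _⟩

lemma one : HasResidue p 1 1 := ⟨1, by simp, map_one _⟩

lemma neg (h : HasResidue p q k) : HasResidue p (-q) (-k) := by
  simpa using (intCast (-1)).mul h

lemma sub (h : HasResidue p q k) (h' : HasResidue p r l) : HasResidue p (q - r) (k - l) := by
  simpa only [sub_eq_add_neg] using h.add h'.neg

lemma pow (h : HasResidue p q k) (n : ℕ) : HasResidue p (q ^ n) (k ^ n) := by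
  obtain ⟨x, hx, rfl⟩ := h
  exact ⟨x ^ n, by simp [hx], map_pow _ _ _⟩

lemma sum {ι : Type*} {s : Finset ι} {f : ι → ℚ} {g : ι → ZMod p}
    (h : ∀ i ∈ s, HasResidue p (f i) (g i)) : HasResidue p (∑ i ∈ s, f i) (∑ i ∈ s, g i) := by
  classical
  induction s using Finset.induction_on with
  | empty => simpa using natCast (p := p) 0
  | insert a s ha ih =>
    rw [sum_insert ha, sum_insert ha]
    exact (h a (mem_insert_self a s)).add (ih fun i hi => h i (mem_insert_of_mem hi))

lemma inv (h : HasResidue p q k) (hk : k ≠ 0) : HasResidue p q⁻¹ k⁻¹ := by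
  obtain ⟨x, hx, rfl⟩ := h
  have hu : IsUnit x := by
    by_contra hu
    have h1 : x ∈ RingHom.ker (PadicInt.toZMod : ℤ_[p] →+* ZMod p) := by
      rw [PadicInt.ker_toZMod]
      exact hu
    exact hk h1
  obtain ⟨u, rfl⟩ := hu
  refine ⟨(u⁻¹ : ℤ_[p]ˣ), ?_, ?_⟩
  · rw [Rat.cast_inv, ← hx]
    refine eq_inv_of_mul_eq_one_left ?_
    rw [← PadicInt.coe_mul, Units.inv_mul, PadicInt.coe_one]
  · refine eq_inv_of_mul_eq_one_left ?_
    rw [← map_mul, Units.inv_mul, map_one]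

lemma div (h : HasResidue p q k) (h' : HasResidue p r l) (hl : l ≠ 0) :
    HasResidue p (q / r) (k / l) := by
  simpa only [div_eq_mul_inv] using h.mul (h'.inv hl)

lemma unique (h : HasResidue p q k) (h' : HasResidue p q l) : k = l := by
  obtain ⟨x, hx, rfl⟩ := h
  obtain ⟨y, hy, rfl⟩ := h'
  rw [Subtype.ext (hx.trans hy.symm)]

lemma padicNorm_le (h : HasResidue p q 0) : padicNorm p q ≤ (p : ℚ) ^ (-(1 : ℤ)) := by
  obtain ⟨x, hx, h0⟩ := h
  have h1 : x ∈ RingHom.ker (PadicInt.toZMod : ℤ_[p] →+* ZMod p) := h0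
  rw [PadicInt.ker_toZMod, PadicInt.maximalIdeal_eq_span_p, ← pow_one (p : ℤ_[p]),
    ← PadicInt.norm_le_pow_iff_mem_span_pow, PadicInt.norm_def, hx, Padic.eq_padicNorm] at h1
  apply (Rat.cast_le (K := ℝ)).1
  simpa using h1

open Polynomial in
lemma eval_congr {P : ℚ[X]} (hP : ∀ i, ∃ c, HasResidue p (P.coeff i) c)
    (hq : HasResidue p q k) (hr : HasResidue p r k) :
    ∃ c, HasResidue p (P.eval q) c ∧ HasResidue p (P.eval r) c := by
  choose c hc using hP
  refine ⟨∑ i ∈ range (P.natDegree + 1), c i * k ^ i, ?_, ?_⟩ <;> rw [eval_eq_sum_range]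
  exacts [sum fun i _ => (hc i).mul (hq.pow i), sum fun i _ => (hc i).mul (hr.pow i)]

end HasResidue

section Bernoulli

variable {p : ℕ} [Fact p.Prime]

lemma exists_hasResidue_bernoulli' {n : ℕ} (hn : n + 1 < p) :
    ∃ c, HasResidue p (bernoulli' n) c := by
  induction n using Nat.strong_induction_on with
  | _ n ih =>
    have h (k : ℕ) : ∃ c, k < n → HasResidue p (n.choose k / (n - k + 1) * bernoulli' k) c := by
      by_cases hk : k < n
      · obtain ⟨c, hc⟩ := ih k hk (by omega)
        have h1 := ((HasResidue.natCast (p := p) (n.choose k)).div (.natCast (n - k + 1))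
          (natCast_ne_zero_of_lt_s4 (p := p) (by omega) (by omega))).mul hc
        push_cast [Nat.cast_sub hk.le] at h1
        exact ⟨_, fun _ => h1⟩
      · exact ⟨0, fun h => absurd h hk⟩
    choose c hc using h
    rw [bernoulli'_def]
    exact ⟨_, HasResidue.one.sub (HasResidue.sum fun k hk => hc k (mem_range.1 hk))⟩

lemma exists_hasResidue_coeff_bernoulli {n : ℕ} (hn : n + 1 < p) (i : ℕ) :
    ∃ c, HasResidue p ((Polynomial.bernoulli n).coeff i) c := by
  rw [Polynomial.coeff_bernoulli]
  split_ifs with hi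
  · obtain ⟨c, hc⟩ := exists_hasResidue_bernoulli' (p := p) (n := n - i) (by omega)
    rw [bernoulli]
    have := (((HasResidue.intCast (p := p) (-1)).pow (n - i)).mul hc).mul (.natCast (n.choose i))
    push_cast at this
    exact ⟨_, this⟩
  · exact ⟨_, by simpa using HasResidue.natCast (p := p) 0⟩

lemma hasResidue_bernoulli_eval (hp5 : 5 ≤ p) :
    HasResidue p ((legendreSym 3 p : ℚ) * (Polynomial.bernoulli (p - 2)).eval (1 / 3 : ℚ))
      (2 * ∑ i ∈ Icc 1 (p / 3), 1 / (i : ZMod p) ^ 2) := by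
  have hp : p.Prime := Fact.out
  have hodd : Odd (p - 2) := Nat.Odd.sub_even (by omega) (hp.odd_of_ne_two (by omega)) even_two
  set n := p / 3 with hn
  set P := Polynomial.bernoulli (p - 2) with hP
  have hsum : HasResidue p (P.eval ((n + 1 : ℕ) : ℚ)) (-2 * ∑ i ∈ Icc 1 n, 1 / (i : ZMod p) ^ 2) := by
    have h1 := Polynomial.bernoulli_succ_eval (n + 1) (p - 3)
    rw [show (p - 3).succ = p - 2 by omega, bernoulli_eq_zero_of_odd hodd (by omega), zero_add,
      ← hP] at h1
    rw [h1]
    have h2 : ∑ i ∈ Icc 1 n, 1 / (i : ZMod p) ^ 2 =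
        ∑ i ∈ range (n + 1), (i : ZMod p) ^ (p - 3) := by
      rw [sum_range_eq_add_Ico _ (by omega)]
      rw [Nat.cast_zero, zero_pow (by omega), zero_add]
      refine sum_congr (by ext; simp) fun i hi => ?_
      rw [mem_Ico] at hi
      have hi0 := natCast_ne_zero_of_lt_s4 (K := ZMod p) (p := p) hi.1 (by omega)
      rw [div_eq_iff (pow_ne_zero 2 hi0), ← pow_add, show p - 3 + 2 = p - 1 by omega,
        ZMod.pow_card_sub_one_eq_one hi0]
    rw [h2]
    have h3 := (HasResidue.natCast (p := p) (p - 3 + 1)).mul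
      (HasResidue.sum (s := range (n + 1)) fun i _ => (HasResidue.natCast i).pow (p - 3))
    have h4 : ((p - 3 + 1 : ℕ) : ZMod p) = -2 := by
      rw [show p - 3 + 1 = p - 2 by omega, Nat.cast_sub (by omega)]
      simp
    rw [h4] at h3
    push_cast at h3 ⊢
    exact h3
  have h3 : (3 : ZMod p) ≠ 0 := by
    exact_mod_cast natCast_ne_zero_of_lt_s4 (K := ZMod p) (p := p) (j := 3) (by omega) (by omega)
  have hthird : HasResidue p (1 / 3) (1 / 3) := by
    have := HasResidue.one.div (.natCast (p := p) 3) (by exact_mod_cast h3)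
    exact_mod_cast this
  have hcoeff := exists_hasResidue_coeff_bernoulli (p := p) (n := p - 2) (by omega)
  have hp3 : p % 3 ≠ 0 := fun h => by
    have := (Nat.prime_dvd_prime_iff_eq Nat.prime_three hp).1 (Nat.dvd_of_mod_eq_zero h)
    omega
  have hr : p % 3 = 1 ∨ p % 3 = 2 := by omega
  have hdiv := congrArg (Nat.cast : ℕ → ZMod p) (Nat.div_add_mod p 3)
  rw [← hn] at hdiv
  rcases hr with h | h
  · have hleg : legendreSym 3 p = 1 := by
      rw [legendreSym.mod, show (p : ℤ) % (3 : ℕ) = 1 by omega, legendreSym.at_one]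
    rw [h] at hdiv
    have hx : ((n + 1 : ℕ) : ZMod p) = 1 - 1 / 3 := by
      push_cast at hdiv ⊢
      rw [CharP.cast_eq_zero (ZMod p) p] at hdiv
      field_simp
      linear_combination hdiv
    have hx' := HasResidue.natCast (p := p) (n + 1)
    rw [hx] at hx'
    obtain ⟨c, hc, hc'⟩ := HasResidue.eval_congr hcoeff hx' (HasResidue.one.sub hthird)
    rw [hc.unique hsum, Polynomial.bernoulli_eval_one_sub, hodd.neg_one_pow] at hc'
    simpa [hleg] using hc'.neg
  · have hleg : legendreSym 3 p = -1 := by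
      rw [legendreSym.mod, show (p : ℤ) % (3 : ℕ) = 2 by omega]
      decide
    rw [h] at hdiv
    have hx : ((n + 1 : ℕ) : ZMod p) = 1 / 3 := by
      push_cast at hdiv ⊢
      rw [CharP.cast_eq_zero (ZMod p) p] at hdiv
      field_simp
      linear_combination hdiv
    have hx' := HasResidue.natCast (p := p) (n + 1)
    rw [hx] at hx'
    obtain ⟨c, hc, hc'⟩ := HasResidue.eval_congr hcoeff hx' hthird
    rw [hc.unique hsum] at hc'
    simpa [hleg] using hc'.neg

end Bernoulli

theorem sum_central_binom_div_sq_congr (p : ℕ) (hp : p.Prime) (hp5 : 5 ≤ p) :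
    padicNorm p
        ((∑ j ∈ Icc 1 (p - 1), (1 / (j : ℚ) ^ 2) * ((2 * j).choose j)) -
          (1 / 2) * (legendreSym 3 p : ℚ) * (Polynomial.bernoulli (p - 2)).eval (1 / 3 : ℚ)) ≤
      (p : ℚ) ^ (-(1 : ℤ)) := by
  have : Fact p.Prime := ⟨hp⟩
  apply HasResidue.padicNorm_le
  have h2 : (2 : ZMod p) ≠ 0 := by
    exact_mod_cast natCast_ne_zero_of_lt_s4 (K := ZMod p) (p := p) (j := 2) (by omega) (by omega)
  have hhalf : HasResidue p (1 / 2) (1 / 2) := by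
    have := HasResidue.one.div (.natCast (p := p) 2) (by exact_mod_cast h2)
    exact_mod_cast this
  have hS : HasResidue p (∑ j ∈ Icc 1 (p - 1), (1 / (j : ℚ) ^ 2) * ((2 * j).choose j))
      (∑ j ∈ Icc 1 (p - 1), (j.centralBinom : ZMod p) / (j : ZMod p) ^ 2) := by
    refine HasResidue.sum fun j hj => ?_
    rw [mem_Icc] at hj
    rw [one_div_mul_eq_div]
    exact (HasResidue.natCast _).div ((HasResidue.natCast j).pow 2)
      (pow_ne_zero 2 (natCast_ne_zero_of_lt_s4 (p := p) hj.1 (by omega)))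
  have h := hS.sub (hhalf.mul (hasResidue_bernoulli_eval hp5))
  rw [sum_centralBinom_div_sq_s4 hp5, one_div (2 : ZMod p), inv_mul_cancel_left₀ h2, sub_self,
    ← mul_assoc] at h
  exact h
end
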